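/- For complex ν with Re ν > -1: ∫_{-1}^1 [P_{ν+2}(x)]³ (1-x²)^{(ν-1)/2} dx = ((3-2cos(νπ))/π) · (2ν³ + 15ν² + 36ν + 29)/(16(ν+2)³) · (cos(νπ/2)/2^ν)³ [Γ((1+ν)/2)/Γ(1+ν/2)]⁴. -/

import Mathlib

open Real MeasureTheory intervalIntegral Complex

/-- Complete elliptic integral of the first kind. -/
noncomputable def ellipticK (k : ℝ) : ℝ :=
  ∫ θ in (0:ℝ)..(π/2), (1 - k ^ 2 * Real.sin θ ^ 2) ^ (-(1/2 : ℝ))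

/-- Complete elliptic integral of the second kind. -/
noncomputable def ellipticE (k : ℝ) : ℝ :=
  ∫ θ in (0:ℝ)..(π/2), (1 - k ^ 2 * Real.sin θ ^ 2) ^ ((1/2 : ℝ))

/-- Legendre function of the first kind of degree ν : P_ν(1-2z) = ₂F₁(-ν, ν+1; 1; z). -/
noncomputable def legendreP (ν : ℂ) (x : ℂ) : ℂ :=
  ordinaryHypergeometric (-ν) (ν + 1) 1 ((1 - x) / 2)


noncomputable def lw (ν : ℂ) (n : ℕ) : ℂ :=
  ∏ k ∈ Finset.range n, (((k:ℂ) - ν) * (k + ν + 1) / (k + 1) ^ 2)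

noncomputable def lf (ν z : ℂ) : ℂ := ∑' n, lw ν n * z ^ n

lemma lw_succ (ν : ℂ) (n : ℕ) : lw ν (n+1) = lw ν n * ((n - ν) * (n + ν + 1) / (n + 1) ^ 2) := by
  unfold lw; rw [Finset.prod_range_succ]

lemma lw_zero (ν : ℂ) : lw ν 0 = 1 := by simp [lw]

lemma lw_eq (ν : ℂ) (n : ℕ) : ((n.factorial⁻¹ : ℂ) * (ascPochhammer ℂ n).eval (-ν) *
      (ascPochhammer ℂ n).eval (ν+1) * ((ascPochhammer ℂ n).eval 1)⁻¹) = lw ν n := by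
  induction n with
  | zero => simp [lw]
  | succ n ih =>
    rw [lw_succ, ← ih]
    simp only [ascPochhammer_succ_eval, Nat.factorial_succ]
    have h1 : (n:ℂ) + 1 ≠ 0 := by exact_mod_cast Nat.succ_ne_zero n
    have h2 : (1:ℂ) + n ≠ 0 := by rwa [add_comm]
    have h3 : (n.factorial : ℂ) ≠ 0 := by exact_mod_cast Nat.factorial_ne_zero n
    have h4 : (ascPochhammer ℂ n).eval (1:ℂ) ≠ 0 := by
      rw [ascPochhammer_eval_one]; exact h3
    push_cast
    field_simp
    ring

lemma legendreP_eq (ν x : ℂ) : legendreP ν x = lf ν ((1 - x) / 2) := by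
  unfold legendreP lf
  rw [ordinaryHypergeometric_eq_tsum]
  simp only [lw_eq, smul_eq_mul]

lemma lw_bound (R : ℝ) : ∃ C : ℝ, 1 ≤ C ∧ ∀ ν : ℂ, ‖ν‖ ≤ R → ∀ n : ℕ, (n+1) * ‖lw ν n‖ ≤ C := by
  set M := |R| * (|R| + 1) with hM
  have hM0 : 0 ≤ M := by positivity
  refine ⟨2 * ((1 + M) * Real.exp M), ?_, ?_⟩
  · have := Real.one_le_exp hM0
    nlinarith
  intro ν hν
  have hm : ‖ν * (ν + 1)‖ ≤ M := by
    rw [norm_mul, hM]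
    have h1 : ‖ν‖ ≤ |R| := hν.trans (le_abs_self R)
    have h2 : ‖ν + 1‖ ≤ |R| + 1 := (norm_add_le _ _).trans (by simpa using h1)
    gcongr
  have key : ∀ n : ℕ, (n+1 : ℝ) * ‖lw ν (n+1)‖ ≤ M * Real.exp (M * (1 - 1 / (n+1))) := by
    intro n
    induction n with
    | zero =>
      rw [lw_succ, lw_zero]
      simp
      have : ‖ν * (ν+1)‖ = ‖ν‖ * ‖ν + 1‖ := norm_mul _ _
      rw [← this]; exact hm
    | succ n ih =>
      rw [lw_succ ν (n+1), norm_mul]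
      have e1 : ((n+1:ℕ):ℂ) - ν = (n+1 : ℂ) - ν := by push_cast; ring
      have e2 : ‖(((n+1:ℕ):ℂ) - ν) * (((n+1:ℕ):ℂ) + ν + 1)‖ ≤ (n+1)*(n+2) + M := by
        have : (((n+1:ℕ):ℂ) - ν) * (((n+1:ℕ):ℂ) + ν + 1) = (((n+1)*(n+2) : ℝ) : ℂ) - ν*(ν+1) := by
          push_cast; ring
        rw [this]
        refine (norm_sub_le _ _).trans ?_
        gcongr
        rw [Complex.norm_real, Real.norm_of_nonneg (by positivity)]
      have e3 : ‖(((n+1:ℕ):ℂ) + 1)^2‖ = ((n:ℝ)+2)^2 := by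
        have : (((n+1:ℕ):ℂ) + 1)^2 = ((((n:ℝ)+2)^2 : ℝ) : ℂ) := by push_cast; ring
        rw [this, Complex.norm_real, Real.norm_of_nonneg (by positivity)]
      rw [norm_div, e3]
      have hn1 : (0:ℝ) < n + 1 := by positivity
      have hn2 : (0:ℝ) < n + 2 := by positivity
      calc (((n+1:ℕ):ℝ) + 1) * (‖lw ν (n+1)‖ * (‖(((n+1:ℕ):ℂ) - ν) * (((n+1:ℕ):ℂ) + ν + 1)‖ / ((n:ℝ)+2)^2))
          ≤ (((n+1:ℕ):ℝ) + 1) * (‖lw ν (n+1)‖ * (((n+1)*(n+2) + M) / ((n:ℝ)+2)^2)) := by gcongr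
        _ = ((n+1) * ‖lw ν (n+1)‖) * (1 + M / ((n+1)*(n+2))) := by
          push_cast; field_simp; ring
        _ ≤ (M * Real.exp (M * (1 - 1 / (n+1)))) * Real.exp (M / ((n+1)*(n+2))) := by
          gcongr
          have := Real.add_one_le_exp (M / (((n:ℝ)+1)*(n+2)))
          linarith
        _ = M * Real.exp (M * (1 - 1 / (((n+1:ℕ):ℝ)+1))) := by
          rw [mul_assoc, ← Real.exp_add]
          congr 2
          push_cast; field_simp; ring
  intro n
  have hE : (1:ℝ) ≤ Real.exp M := Real.one_le_exp hM0
  cases n with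
  | zero => simp [lw_zero]; nlinarith
  | succ n =>
    have h := key n
    have h5 : Real.exp (M * (1 - 1 / (n+1))) ≤ Real.exp M := by
      apply Real.exp_le_exp.2
      have : (0:ℝ) ≤ 1 / ((n:ℝ)+1) := by positivity
      nlinarith
    have h6 : ‖lw ν (n+1)‖ ≤ (n+1) * ‖lw ν (n+1)‖ := by
      have : (0:ℝ) ≤ n := by positivity
      nlinarith [norm_nonneg (lw ν (n+1))]
    have h7 : M * Real.exp (M * (1 - 1 / (n+1))) ≤ M * Real.exp M := by gcongr
    push_cast
    nlinarith

/-- term-by-term differentiation for power series with bounded coefficients -/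
lemma ps_hasDerivAt (c : ℕ → ℂ) (C : ℝ) (hc : ∀ n, ‖c n‖ ≤ C) (z : ℂ) (hz : ‖z‖ < 1) :
    HasDerivAt (fun z => ∑' n, c n * z ^ n) (∑' n : ℕ, ((n:ℂ)+1) * c (n+1) * z ^ n) z := by
  obtain ⟨r, hr1, hr2⟩ := exists_between hz
  have hr0 : 0 < r := (norm_nonneg z).trans_lt hr1
  have hsum : Summable (fun n : ℕ => C * ((n:ℝ) * r ^ (n-1))) := by
    apply Summable.mul_left
    have h := summable_pow_mul_geometric_of_norm_lt_one 1 (r := r) (by rwa [Real.norm_of_nonneg hr0.le])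
    have h2 := h.mul_left (r⁻¹)
    refine h2.congr ?_
    intro n
    cases n with
    | zero => simp
    | succ n => simp [pow_succ]; field_simp
  have h := hasDerivAt_tsum_of_isPreconnected (𝕜 := ℂ) (g := fun n z => c n * z ^ n)
    (g' := fun n z => c n * ((n:ℂ) * z ^ (n-1))) (u := fun n : ℕ => C * ((n:ℝ) * r ^ (n-1)))
    (t := Metric.ball (0:ℂ) r) (y₀ := 0) (y := z) hsum Metric.isOpen_ball
    (convex_ball _ _).isPreconnected
    (fun n y _ => by simpa using (hasDerivAt_pow n y).const_mul (c n))
    (fun n y hy => by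
      rw [norm_mul, norm_mul, norm_pow, Complex.norm_natCast]
      have : ‖y‖ ≤ r := by simpa using (mem_ball_zero_iff.1 hy).le
      have := hc n
      have := (norm_nonneg (c n)).trans this
      gcongr)
    (by simpa using hr0)
    (by
      apply summable_of_ne_finset_zero (s := {0})
      intro n hn
      have : n ≠ 0 := by simpa using hn
      simp [this])
    (by simpa using hr1)
  refine h.congr_deriv ?_
  have hs2 : Summable (fun n : ℕ => c n * ((n:ℂ) * z ^ (n-1))) := by
    refine Summable.of_norm_bounded hsum ?_
    intro n
    rw [norm_mul, norm_mul, norm_pow, Complex.norm_natCast]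
    have := hc n
    have := (norm_nonneg (c n)).trans this
    gcongr
  rw [hs2.tsum_eq_zero_add]
  simp
  congr 1; ext n; ring

noncomputable def lg (ν z : ℂ) : ℂ := ∑' n : ℕ, (if n = 0 then 0 else -(ν*(ν+1)) * lw ν (n-1) / n) * z ^ n

lemma lw_le {C : ℝ} {ν : ℂ} (h : ∀ n : ℕ, (n+1) * ‖lw ν n‖ ≤ C) (n : ℕ) : ‖lw ν n‖ ≤ C := by
  have := h n
  have h2 : (0:ℝ) ≤ n := by positivity
  nlinarith [norm_nonneg (lw ν n)]

lemma lf_summable (ν z : ℂ) (hz : ‖z‖ < 1) : Summable (fun n => lw ν n * z ^ n) := by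
  obtain ⟨C, hC1, hC⟩ := lw_bound ‖ν‖
  refine Summable.of_norm_bounded ((summable_geometric_of_lt_one (norm_nonneg z) hz).mul_left C) ?_
  intro n
  rw [norm_mul, norm_pow]
  have := lw_le (hC ν le_rfl) n
  gcongr

lemma lg_coeff_bound {C : ℝ} {ν : ℂ} (h : ∀ n : ℕ, (n+1) * ‖lw ν n‖ ≤ C) (n : ℕ) :
    ‖(if n = 0 then 0 else -(ν*(ν+1)) * lw ν (n-1) / n : ℂ)‖ ≤ ‖ν*(ν+1)‖ * C * (1 / (n:ℝ)^2) := by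
  cases n with
  | zero => simp
  | succ n =>
    simp only [Nat.succ_ne_zero, if_false, Nat.add_sub_cancel, norm_div, norm_mul, norm_neg]
    have := h n
    have e : ‖((n+1:ℕ):ℂ)‖ = (n:ℝ)+1 := by rw [Complex.norm_natCast]; push_cast; ring
    rw [e]
    have hn : (0:ℝ) < n + 1 := by positivity
    push_cast
    rw [div_le_iff₀ hn]
    have h2 : ‖ν‖ * ‖ν+1‖ * ((n+1) * ‖lw ν n‖) ≤ ‖ν‖ * ‖ν+1‖ * C := by gcongr
    calc ‖ν‖ * ‖ν+1‖ * ‖lw ν n‖ = ‖ν‖ * ‖ν+1‖ * ((n+1) * ‖lw ν n‖) / (n+1) := by field_simp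
      _ ≤ ‖ν‖ * ‖ν+1‖ * C / (n+1) := by gcongr
      _ = _ := by field_simp

lemma lg_hasDerivAt (ν z : ℂ) (hz : ‖z‖ < 1) : HasDerivAt (lg ν) (-(ν*(ν+1)) * lf ν z) z := by
  obtain ⟨C, hC1, hC⟩ := lw_bound ‖ν‖
  have h := ps_hasDerivAt (fun n : ℕ => (if n = 0 then 0 else -(ν*(ν+1)) * lw ν (n-1) / n : ℂ))
    (‖ν*(ν+1)‖ * C) (fun n => (lg_coeff_bound (hC ν le_rfl) n).trans (by
      have : (1:ℝ) / (n:ℝ)^2 ≤ 1 := by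
        cases n with
        | zero => simp
        | succ n =>
          rw [div_le_one (by positivity)]
          push_cast; nlinarith [(by positivity : (0:ℝ) ≤ n)]
      have h0 : 0 ≤ ‖ν*(ν+1)‖ * C := by positivity
      nlinarith)) z hz
  refine h.congr_deriv ?_
  unfold lf
  rw [← tsum_mul_left]
  congr 1; ext n
  have : (n:ℂ) + 1 ≠ 0 := by exact_mod_cast Nat.succ_ne_zero n
  simp only [Nat.succ_ne_zero, if_false, Nat.add_sub_cancel]
  push_cast
  field_simp

lemma lf_hasDerivAt (ν z : ℂ) (hz : ‖z‖ < 1) (hz0 : z ≠ 0) :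
    HasDerivAt (lf ν) (lg ν z / (z * (1 - z))) z := by
  obtain ⟨C, hC1, hC⟩ := lw_bound ‖ν‖
  have h := ps_hasDerivAt (lw ν) C (lw_le (hC ν le_rfl)) z hz
  have h1z : 1 - z ≠ 0 := by
    intro h0
    have : z = 1 := by linear_combination -h0
    rw [this] at hz; simp at hz
  refine h.congr_deriv ?_
  symm
  rw [div_eq_iff (mul_ne_zero hz0 h1z)]
  have hs : Summable (fun n : ℕ => ((n:ℂ)+1) * lw ν (n+1) * z ^ n) := by
    refine Summable.of_norm_bounded ((summable_geometric_of_lt_one (norm_nonneg z) hz).mul_left C) ?_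
    intro n
    rw [norm_mul, norm_mul, norm_pow]
    gcongr
    have h2 := hC ν le_rfl (n+1)
    have h3 : ‖(n:ℂ)+1‖ = n + 1 := by
      rw [← Nat.cast_succ, Complex.norm_natCast]; push_cast; ring
    rw [h3]
    push_cast at h2
    nlinarith [norm_nonneg (lw ν (n+1))]
  set S := ∑' n : ℕ, ((n:ℂ)+1) * lw ν (n+1) * z ^ n with hS
  have hs1 : HasSum (fun n : ℕ => (n:ℂ) * lw ν n * z ^ n) (S * z) := by
    rw [← hasSum_nat_add_iff' 1]
    have := hs.hasSum.mul_right z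
    rw [← hS] at this
    simp only [Finset.sum_range_one, Nat.cast_zero, zero_mul, sub_zero]
    refine this.congr_fun ?_
    intro n
    push_cast; ring
  have hs2 : HasSum (fun n : ℕ => if n = 0 then 0 else ((n-1:ℕ):ℂ) * lw ν (n-1) * z ^ n) (S * z * z) := by
    rw [← hasSum_nat_add_iff' 1]
    have := hs1.mul_right z
    simp only [Finset.sum_range_one, if_true, sub_zero]
    refine this.congr_fun ?_
    intro n
    simp only [Nat.succ_ne_zero, if_false, Nat.add_sub_cancel]
    ring
  have hs3 := hs1.sub hs2
  have : lg ν z = S * z - S * z * z := by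
    rw [← hs3.tsum_eq]
    unfold lg
    congr 1; ext n
    cases n with
    | zero => simp
    | succ n =>
      have : (n:ℂ) + 1 ≠ 0 := by exact_mod_cast Nat.succ_ne_zero n
      simp only [Nat.succ_ne_zero, if_false, Nat.add_sub_cancel, lw_succ]
      push_cast
      field_simp
      ring
  rw [this]; ring


lemma lf_bound (R : ℝ) : ∃ C : ℝ, 1 ≤ C ∧ ∀ ν : ℂ, ‖ν‖ ≤ R → ∀ δ : ℝ, 0 < δ → ∀ Z : ℝ, 0 ≤ Z → Z < 1 →
    ‖lf ν (Z:ℂ)‖ ≤ C * (1 + 1/δ) * (1 - Z) ^ (-δ) := by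
  obtain ⟨C, hC1, hC⟩ := lw_bound R
  refine ⟨C, hC1, ?_⟩
  intro ν hν δ hδ Z hZ0 hZ1
  have hs := Real.hasSum_pow_div_log_of_abs_lt_one (x := Z) (by rwa [abs_of_nonneg hZ0])
  have hs2 : HasSum (fun n : ℕ => C * (if n = 0 then 1 else Z ^ n / n)) (C * (1 + -Real.log (1 - Z))) := by
    apply HasSum.mul_left
    rw [← hasSum_nat_add_iff' 1]
    simpa using hs
  have h1 : ‖lf ν (Z:ℂ)‖ ≤ C * (1 + -Real.log (1 - Z)) := by
    unfold lf
    refine tsum_of_norm_bounded hs2 ?_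
    intro n
    rw [norm_mul, norm_pow, Complex.norm_real, Real.norm_of_nonneg hZ0]
    cases n with
    | zero => simpa [lw_zero] using hC1
    | succ n =>
      simp only [Nat.succ_ne_zero, if_false]
      have h := hC ν hν (n+1)
      have h0 : (0:ℝ) ≤ Z ^ (n+1) := by positivity
      have h2 : ‖lw ν (n+1)‖ ≤ C / ((n+1:ℕ):ℝ) := by
        rw [le_div_iff₀ (by positivity)]
        push_cast at h ⊢
        nlinarith [norm_nonneg (lw ν (n+1))]
      calc _ ≤ C / ((n+1:ℕ):ℝ) * Z^(n+1) := by gcongr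
        _ = _ := by ring
  have h1Z : 0 < 1 - Z := by linarith
  have h2 : -Real.log (1 - Z) ≤ (1-Z)^(-δ) / δ := by
    rw [← Real.log_inv, Real.rpow_neg h1Z.le, ← Real.inv_rpow h1Z.le]
    exact Real.log_le_rpow_div (by positivity) hδ
  have h3 : 1 ≤ (1-Z)^(-δ) := Real.one_le_rpow_of_pos_of_le_one_of_nonpos h1Z (by linarith) (by linarith)
  calc _ ≤ C * (1 + -Real.log (1 - Z)) := h1
    _ ≤ C * ((1-Z)^(-δ) + (1-Z)^(-δ) / δ) := by gcongr
    _ = _ := by ring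

lemma lg_bound (R : ℝ) : ∃ C : ℝ, 0 ≤ C ∧ ∀ ν : ℂ, ‖ν‖ ≤ R → ∀ z : ℂ, ‖z‖ ≤ 1 → ‖lg ν z‖ ≤ C := by
  obtain ⟨C, hC1, hC⟩ := lw_bound R
  have hS : Summable (fun n : ℕ => 1 / (n:ℝ)^2) := Real.summable_one_div_nat_pow.2 (by norm_num)
  refine ⟨|R| * (|R| + 1) * C * ∑' n : ℕ, 1 / (n:ℝ)^2, by positivity, ?_⟩
  intro ν hν z hz
  unfold lg
  refine tsum_of_norm_bounded (hS.hasSum.mul_left _) ?_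
  intro n
  have hm : ‖ν * (ν + 1)‖ ≤ |R| * (|R|+1) := by
    rw [norm_mul]
    have h1 : ‖ν‖ ≤ |R| := hν.trans (le_abs_self R)
    have h2 : ‖ν + 1‖ ≤ |R| + 1 := (norm_add_le _ _).trans (by simpa using h1)
    gcongr
  have h1 := lg_coeff_bound (hC ν hν) n
  rw [norm_mul, norm_pow]
  have h2 : ‖z‖ ^ n ≤ 1 := pow_le_one₀ (norm_nonneg z) hz
  calc _ ≤ (‖ν * (ν + 1)‖ * C * (1 / (n:ℝ)^2)) * 1 := by gcongr
    _ ≤ _ := by rw [mul_one]; gcongr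

noncomputable def pP (ν : ℂ) (x : ℝ) : ℂ := lf ν (((1 - x)/2 : ℝ) : ℂ)
noncomputable def pR (ν : ℂ) (x : ℝ) : ℂ := -2 * lg ν (((1 - x)/2 : ℝ) : ℂ)

lemma legendreP_pP (ν : ℂ) (x : ℝ) : legendreP ν (x:ℂ) = pP ν x := by
  rw [legendreP_eq, pP]; push_cast; rfl

lemma pP_hasDerivAt (ν : ℂ) (x : ℝ) (h1 : -1 < x) (h2 : x < 1) :
    HasDerivAt (pP ν) (pR ν x / (1 - (x:ℂ)^2)) x := by
  have hn : ‖(((1 - x)/2 : ℝ) : ℂ)‖ < 1 := by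
    rw [Complex.norm_real, Real.norm_of_nonneg (by linarith)]; linarith
  have hz : (((1 - x)/2 : ℝ) : ℂ) ≠ 0 := by
    rw [Ne, Complex.ofReal_eq_zero]; linarith
  have h := lf_hasDerivAt ν _ hn hz
  have h3 : HasDerivAt (fun x : ℝ => (((1 - x)/2 : ℝ) : ℂ)) (((-1/2 : ℝ)) : ℂ) x := by
    apply HasDerivAt.ofReal_comp
    have := ((hasDerivAt_id x).const_sub 1).div_const 2
    simpa using this
  have h4 := h.comp x h3
  refine h4.congr_deriv ?_
  have e : (1:ℂ) - (x:ℂ)^2 = 4 * ((((1 - x)/2 : ℝ) : ℂ) * (1 - (((1 - x)/2 : ℝ) : ℂ))) := by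
    push_cast; ring
  have h5 : 1 - (((1 - x)/2 : ℝ) : ℂ) ≠ 0 := by
    rw [← Complex.ofReal_one, ← Complex.ofReal_sub, Ne, Complex.ofReal_eq_zero]; linarith
  rw [e, pR]
  field_simp
  push_cast; ring

lemma pR_hasDerivAt (ν : ℂ) (x : ℝ) (h1 : -1 < x) (h2 : x < 1) :
    HasDerivAt (pR ν) (-(ν*(ν+1)) * pP ν x) x := by
  have hn : ‖(((1 - x)/2 : ℝ) : ℂ)‖ < 1 := by
    rw [Complex.norm_real, Real.norm_of_nonneg (by linarith)]; linarith
  have h := lg_hasDerivAt ν _ hn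
  have h3 : HasDerivAt (fun x : ℝ => (((1 - x)/2 : ℝ) : ℂ)) (((-1/2 : ℝ)) : ℂ) x := by
    apply HasDerivAt.ofReal_comp
    have := ((hasDerivAt_id x).const_sub 1).div_const 2
    simpa using this
  have h4 := (h.comp x h3).const_mul (-2)
  refine h4.congr_deriv ?_
  rw [pP]
  push_cast; ring

lemma pP_bound (R : ℝ) : ∃ C : ℝ, 1 ≤ C ∧ ∀ ν : ℂ, ‖ν‖ ≤ R → ∀ δ : ℝ, 0 < δ → δ ≤ 1 → ∀ x : ℝ, -1 < x → x < 1 →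
    ‖pP ν x‖ ≤ C * (1/δ) * (1 - x^2) ^ (-δ) := by
  obtain ⟨C, hC1, hC⟩ := lf_bound R
  refine ⟨8 * C, by linarith, ?_⟩
  intro ν hν δ hδ hδ1 x h1 h2
  have h := hC ν hν δ hδ ((1-x)/2) (by linarith) (by linarith)
  have h3 : (1 - (1-x)/2) ^ (-δ) ≤ 4 * (1 - x^2)^(-δ) := by
    have e : (1 - (1-x)/2) = (1 - x^2) * (2 * (1 - x))⁻¹ := by
      have : 1 - x ≠ 0 := by linarith
      field_simp; ring
    have h0 : 0 < 1 - x^2 := by nlinarith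
    have h0' : 0 < 2 * (1 - x) := by linarith
    rw [e, Real.mul_rpow h0.le (by positivity), Real.inv_rpow h0'.le, ← Real.rpow_neg h0'.le, neg_neg]
    have h4 : (2 * (1-x))^δ ≤ 4 := by
      calc (2 * (1-x))^δ ≤ 4 ^ δ := by gcongr; linarith
        _ ≤ 4 ^ (1:ℝ) := by gcongr; norm_num
        _ = 4 := by simp
    have : 0 < (1 - x^2)^(-δ) := by positivity
    nlinarith
  have h5 : 1 + 1/δ ≤ 2 * (1/δ) := by
    have : 1 ≤ 1/δ := by rw [le_div_iff₀ hδ]; linarith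
    linarith
  unfold pP
  calc _ ≤ C * (1 + 1 / δ) * (1 - (1 - x) / 2) ^ (-δ) := h
    _ ≤ C * (2 * (1/δ)) * (4 * (1 - x^2)^(-δ)) := by
      have : 0 ≤ 1 - (1 - x) / 2 := by linarith
      gcongr
    _ = _ := by ring

lemma pR_bound (R : ℝ) : ∃ C : ℝ, 0 ≤ C ∧ ∀ ν : ℂ, ‖ν‖ ≤ R → ∀ x : ℝ, -1 < x → x < 1 →
    ‖pR ν x‖ ≤ C := by
  obtain ⟨C, hC1, hC⟩ := lg_bound R
  refine ⟨2 * C, by linarith, ?_⟩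
  intro ν hν x h1 h2
  unfold pR
  rw [norm_mul]
  have := hC ν hν (((1 - x)/2 : ℝ) : ℂ) (by rw [Complex.norm_real, Real.norm_of_nonneg (by linarith)]; linarith)
  have h : ‖(-2:ℂ)‖ = 2 := by simp
  rw [h]; linarith

lemma integrable_w (e : ℝ) (he : -1 < e) : IntegrableOn (fun x : ℝ => (1 - x^2)^e) (Set.Ioo (-1) 1) := by
  have hi : ∀ e : ℝ, -1 < e → IntervalIntegrable (fun x : ℝ => x ^ e) volume 0 2 := fun e he => intervalIntegral.intervalIntegrable_rpow' he
  set e' := min e 0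
  have he' : -1 < e' := lt_min he (by norm_num)
  have h1 : IntervalIntegrable (fun x : ℝ => (1 - x) ^ e') volume (-1) 1 := by
    have := ((hi e' he').comp_sub_left 1).symm
    norm_num at this; exact this
  have h2 : IntervalIntegrable (fun x : ℝ => (1 + x) ^ e') volume (-1) 1 := by
    have := ((hi e' he').comp_add_left 1)
    norm_num at this; exact this
  have h3 := h1.add h2
  rw [intervalIntegrable_iff_integrableOn_Ioo_of_le (by norm_num)] at h3
  refine Integrable.mono' h3 ?_ ?_
  · apply ContinuousOn.aestronglyMeasurable _ measurableSet_Ioo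
    apply ContinuousOn.rpow_const (by fun_prop)
    intro x hx
    left
    have := hx.1; have := hx.2
    nlinarith
  · rw [ae_restrict_iff' measurableSet_Ioo]
    refine Filter.Eventually.of_forall ?_
    intro x hx
    obtain ⟨hx1, hx2⟩ := hx
    have h0 : 0 < 1 - x^2 := by nlinarith
    rw [Real.norm_of_nonneg (by positivity)]
    have a1 : (1 - x^2)^e ≤ (1-x^2)^e' := Real.rpow_le_rpow_of_exponent_ge h0 (by nlinarith) (min_le_left _ _)
    have p1 : 0 < 1 - x := by linarith
    have p2 : 0 < 1 + x := by linarith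
    have q1 := Real.rpow_pos_of_pos p1 e'
    have q2 := Real.rpow_pos_of_pos p2 e'
    refine a1.trans ?_
    rcases le_total 0 x with hx | hx
    · have : (1-x^2)^e' ≤ (1-x)^e' := Real.rpow_le_rpow_of_nonpos p1 (by nlinarith) (min_le_right _ _)
      linarith
    · have : (1-x^2)^e' ≤ (1+x)^e' := Real.rpow_le_rpow_of_nonpos p2 (by nlinarith) (min_le_right _ _)
      linarith

lemma integrable_of_bound {F : ℝ → ℂ} {C e : ℝ} (he : -1 < e) (hc : ContinuousOn F (Set.Ioo (-1) 1))
    (hb : ∀ x : ℝ, -1 < x → x < 1 → ‖F x‖ ≤ C * (1 - x^2)^e) : IntervalIntegrable F volume (-1) 1 := by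
  rw [intervalIntegrable_iff_integrableOn_Ioo_of_le (by norm_num)]
  refine Integrable.mono' ((integrable_w e he).const_mul C) (hc.aestronglyMeasurable measurableSet_Ioo) ?_
  rw [ae_restrict_iff' measurableSet_Ioo]
  exact Filter.Eventually.of_forall fun x hx => hb x hx.1 hx.2

lemma integral_deriv_zero {F F' : ℝ → ℂ} {C e : ℝ} (he : 0 < e)
    (hd : ∀ x : ℝ, -1 < x → x < 1 → HasDerivAt F (F' x) x)
    (hb : ∀ x : ℝ, -1 < x → x < 1 → ‖F x‖ ≤ C * (1 - x^2)^e)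
    (hi : IntervalIntegrable F' volume (-1) 1) : ∫ x in (-1:ℝ)..1, F' x = 0 := by
  have hc : Continuous (fun x : ℝ => C * (1 - x^2)^e) := by
    apply Continuous.mul continuous_const
    exact Continuous.rpow_const (by fun_prop) (fun _ => Or.inr he.le)
  have h1 : Filter.Tendsto (fun x : ℝ => C * (1 - x^2)^e) (nhds 1) (nhds 0) := by
    have := hc.tendsto 1; simpa [Real.zero_rpow he.ne'] using this
  have h2 : Filter.Tendsto (fun x : ℝ => C * (1 - x^2)^e) (nhds (-1)) (nhds 0) := by
    have := hc.tendsto (-1); simpa [Real.zero_rpow he.ne'] using this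
  have := intervalIntegral.integral_eq_sub_of_hasDerivAt_of_tendsto (f := F) (f' := F') (a := -1) (b := 1) (fa := 0) (fb := 0) (by norm_num)
    (fun x hx => hd x hx.1 hx.2) hi
    (squeeze_zero_norm' (by
      filter_upwards [Ioo_mem_nhdsGT (show (-1:ℝ) < 1 by norm_num)] with x hx
      exact hb x hx.1 hx.2) (h2.mono_left nhdsWithin_le_nhds))
    (squeeze_zero_norm' (by
      filter_upwards [Ioo_mem_nhdsLT (show (-1:ℝ) < 1 by norm_num)] with x hx
      exact hb x hx.1 hx.2) (h1.mono_left nhdsWithin_le_nhds))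
  simpa using this


noncomputable def wt (k : ℂ) (x : ℝ) : ℂ := ((1 - x^2 : ℝ) : ℂ) ^ k

lemma wt_norm (k : ℂ) (x : ℝ) (h1 : -1 < x) (h2 : x < 1) : ‖wt k x‖ = (1 - x^2)^k.re := by
  unfold wt
  exact Complex.norm_cpow_eq_rpow_re_of_pos (by nlinarith) k

lemma wt_succ (k : ℂ) (x : ℝ) (h1 : -1 < x) (h2 : x < 1) : wt k x = (1 - (x:ℂ)^2) * wt (k-1) x := by
  unfold wt
  have h0 : ((1 - x^2 : ℝ) : ℂ) ≠ 0 := by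
    rw [Ne, Complex.ofReal_eq_zero]; nlinarith
  rw [Complex.cpow_sub _ _ h0]
  simp only [Complex.cpow_one]
  field_simp
  push_cast; ring

lemma wt_hasDerivAt (k : ℂ) (x : ℝ) (h1 : -1 < x) (h2 : x < 1) :
    HasDerivAt (wt k) (-2 * k * x * wt (k-1) x) x := by
  have h3 : HasDerivAt (fun x : ℝ => ((1 - x^2 : ℝ) : ℂ)) ((-(2*x) : ℝ) : ℂ) x := by
    apply HasDerivAt.ofReal_comp
    have := ((hasDerivAt_pow 2 x)).const_sub 1
    simpa using this
  have h0 : 0 < 1 - x^2 := by nlinarith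
  have h4 := (HasDerivAt.comp x (h₂ := fun z : ℂ => z ^ k) (h := fun x : ℝ => ((1 - x^2 : ℝ) : ℂ))
    ((hasDerivAt_id _).cpow_const (c := k) (Complex.ofReal_mem_slitPlane.2 h0)) h3)
  refine h4.congr_deriv ?_
  unfold wt
  simp only [id]
  push_cast; ring

noncomputable def jF (ν : ℂ) (a b c : ℕ) (k : ℂ) (x : ℝ) : ℂ :=
  (x:ℂ)^a * pP ν x ^ b * pR ν x ^ c * wt k x

lemma jF_hasDerivAt (ν : ℂ) (a b c : ℕ) (k : ℂ) (x : ℝ) (h1 : -1 < x) (h2 : x < 1) :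
    HasDerivAt (jF ν a b c k) (a * jF ν (a-1) b c k x + b * jF ν a (b-1) (c+1) (k-1) x
      - ν*(ν+1) * c * jF ν a (b+1) (c-1) k x - 2 * k * jF ν (a+1) b c (k-1) x) x := by
  have hx : HasDerivAt (fun x : ℝ => (x:ℂ)) 1 x := by
    simpa using (hasDerivAt_id x).ofReal_comp
  have h := (((hx.pow a).mul ((pP_hasDerivAt ν x h1 h2).pow b)).mul ((pR_hasDerivAt ν x h1 h2).pow c)).mul
    (wt_hasDerivAt k x h1 h2)
  refine h.congr_deriv ?_
  unfold jF
  simp only [Pi.mul_apply, Pi.pow_apply]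
  rw [wt_succ k x h1 h2]
  have h0 : (1:ℂ) - (x:ℂ)^2 ≠ 0 := by
    rw [← Complex.ofReal_one, ← Complex.ofReal_pow, ← Complex.ofReal_sub, Ne, Complex.ofReal_eq_zero]; nlinarith
  field_simp
  ring

lemma jF_bound (ν : ℂ) (a b c : ℕ) (k : ℂ) (e : ℝ) (he : e < k.re) :
    ∃ C : ℝ, ∀ x : ℝ, -1 < x → x < 1 → ‖jF ν a b c k x‖ ≤ C * (1 - x^2)^e := by
  obtain ⟨C1, h11, hC1⟩ := pP_bound ‖ν‖
  obtain ⟨C2, h20, hC2⟩ := pR_bound ‖ν‖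
  obtain ⟨δ, hδ0, hδ1, hδ⟩ : ∃ δ : ℝ, 0 < δ ∧ δ ≤ 1 ∧ e ≤ -δ * b + k.re := by
    refine ⟨min 1 ((k.re - e)/(b+1)), lt_min one_pos (div_pos (by linarith) (by positivity)), min_le_left _ _, ?_⟩
    have h1 : min 1 ((k.re - e)/(b+1)) * b ≤ (k.re - e)/(b+1) * (b+1) := by
      have : min 1 ((k.re - e)/(b+1)) ≤ (k.re - e)/(b+1) := min_le_right _ _
      have h5 : 0 < (k.re - e)/(b+1) := div_pos (by linarith) (by positivity)
      calc _ ≤ (k.re - e)/(b+1) * (b:ℝ) := by gcongr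
        _ ≤ _ := by gcongr; linarith
    rw [div_mul_cancel₀ _ (by positivity)] at h1
    linarith
  refine ⟨(C1 * (1/δ))^b * C2^c, ?_⟩
  intro x h1 h2
  unfold jF
  have h0 : 0 < 1 - x^2 := by nlinarith
  rw [norm_mul, norm_mul, norm_mul, norm_pow, norm_pow, norm_pow, wt_norm k x h1 h2]
  have b1 := hC1 ν le_rfl δ hδ0 hδ1 x h1 h2
  have b2 := hC2 ν le_rfl x h1 h2
  have b3 : ‖(x:ℂ)‖ ^ a ≤ 1 := by
    apply pow_le_one₀ (norm_nonneg _)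
    rw [Complex.norm_real, Real.norm_eq_abs, abs_le]; constructor <;> linarith
  calc _ ≤ 1 * (C1 * (1/δ) * (1 - x^2)^(-δ))^b * C2^c * (1-x^2)^k.re := by gcongr
    _ = (C1 * (1/δ))^b * C2^c * ((1 - x^2)^(-δ * b + k.re)) := by
      rw [mul_pow, Real.rpow_add h0, Real.rpow_mul h0.le, Real.rpow_natCast]; ring
    _ ≤ _ := by
      have := Real.rpow_le_rpow_of_exponent_ge h0 (by nlinarith) hδ
      gcongr

lemma jF_integrable (ν : ℂ) (a b c : ℕ) (k : ℂ) (hk : -1 < k.re) :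
    IntervalIntegrable (jF ν a b c k) volume (-1) 1 := by
  obtain ⟨e, he1, he2⟩ := exists_between hk
  obtain ⟨C, hC⟩ := jF_bound ν a b c k e he2
  refine integrable_of_bound he1 ?_ hC
  intro x hx
  exact (jF_hasDerivAt ν a b c k x hx.1 hx.2).continuousAt.continuousWithinAt

noncomputable def jJ (ν : ℂ) (a b c : ℕ) (k : ℂ) : ℂ := ∫ x in (-1:ℝ)..1, jF ν a b c k x

lemma jJ_ibp (ν : ℂ) (a b c : ℕ) (k : ℂ) (hk : 0 < k.re) :
    a * jJ ν (a-1) b c k + b * jJ ν a (b-1) (c+1) (k-1)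
      - ν*(ν+1) * c * jJ ν a (b+1) (c-1) k - 2 * k * jJ ν (a+1) b c (k-1) = 0 := by
  obtain ⟨e, he1, he2⟩ := exists_between hk
  obtain ⟨C, hC⟩ := jF_bound ν a b c k e he2
  have hk1 : -1 < (k-1).re := by simp; linarith
  have i1 := (jF_integrable ν (a-1) b c k (by linarith)).const_mul (a:ℂ)
  have i2 := (jF_integrable ν a (b-1) (c+1) (k-1) hk1).const_mul (b:ℂ)
  have i3 := (jF_integrable ν a (b+1) (c-1) k (by linarith)).const_mul (ν*(ν+1)*(c:ℂ))
  have i4 := (jF_integrable ν (a+1) b c (k-1) hk1).const_mul (2*k)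
  have h := integral_deriv_zero he1 (jF_hasDerivAt ν a b c k) hC (((i1.add i2).sub i3).sub i4)
  rw [intervalIntegral.integral_sub ((i1.add i2).sub i3) i4, intervalIntegral.integral_sub (i1.add i2) i3,
    intervalIntegral.integral_add i1 i2] at h
  simp only [intervalIntegral.integral_const_mul] at h
  exact h

lemma jJ_x2 (ν : ℂ) (a b c : ℕ) (k : ℂ) (hk : -1 < k.re) :
    jJ ν (a+2) b c k = jJ ν a b c k - jJ ν a b c (k+1) := by
  unfold jJ
  rw [← intervalIntegral.integral_sub (jF_integrable ν a b c k hk) (jF_integrable ν a b c (k+1) (by simp; linarith))]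
  rw [intervalIntegral.integral_of_le (by norm_num), intervalIntegral.integral_of_le (by norm_num),
    integral_Ioc_eq_integral_Ioo, integral_Ioc_eq_integral_Ioo]
  apply setIntegral_congr_fun measurableSet_Ioo
  intro x hx
  simp only [jF]
  rw [wt_succ (k+1) x hx.1 hx.2]
  simp only [add_sub_cancel_right]
  ring

lemma recursion (μ : ℂ) (hμ : 1 < μ.re) :
    (μ-1)^4 * jJ μ 0 3 0 ((μ-3)/2) = -4 * μ * (2*μ^3+3*μ^2+1) * jJ μ 0 3 0 ((μ-1)/2) := by
  have hk : 0 < ((μ-1)/2).re := by simp; linarith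
  have hk1 : 0 < ((μ-1)/2 + 1).re := by rw [Complex.add_re]; simp at hk ⊢; linarith
  have hkm : -1 < ((μ-1)/2 - 1).re := by rw [Complex.sub_re]; simp at hk ⊢; linarith
  set k := (μ-1)/2 with hkd
  have hμk : μ = 2*k+1 := by rw [hkd]; ring
  have e1 := jJ_ibp μ 1 3 0 k hk
  have e1' := jJ_ibp μ 1 3 0 (k+1) hk1
  have e2 := jJ_ibp μ 0 2 1 k hk
  have e2' := jJ_ibp μ 0 2 1 (k+1) hk1
  have e3 := jJ_ibp μ 1 1 2 k hk
  have e4 := jJ_ibp μ 0 0 3 k hk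
  have x1 := jJ_x2 μ 0 3 0 (k-1) hkm
  have x1' := jJ_x2 μ 0 3 0 k (by linarith)
  have x3 := jJ_x2 μ 0 1 2 (k-1) hkm
  have hk3 : (μ-3)/2 = k - 1 := by rw [hkd]; ring
  rw [hk3]
  simp only [add_sub_cancel_right, sub_add_cancel] at x1 x1' x3 e1' e2'
  norm_num at e1 e1' e2 e2' e3 e4 x1 x1' x3
  rw [x1] at e1
  rw [x1'] at e1'
  rw [x3] at e3
  generalize jJ μ 0 3 0 (k-1) = Xm at *
  generalize jJ μ 0 3 0 k = X at *
  generalize jJ μ 0 3 0 (k+1) = Xp at *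
  generalize jJ μ 1 2 1 (k-1) = Ym at *
  generalize jJ μ 1 2 1 k = Y at *
  generalize jJ μ 0 1 2 (k-1) = Zm at *
  generalize jJ μ 0 1 2 k = Z at *
  generalize jJ μ 1 0 3 (k-1) = U at *
  clear_value k
  subst hμk
  linear_combination (-6) * (2*k*e3 + e4 - (2*k*(1+2*k)-3*(2*k+1)*(2*k+2))/2 * e2' + 2*k^2 * e2 + 4*k^3/3 * e1 + ((2*k+1)^2*(2*k+2)) * e1')


lemma holo_integral {F : ℂ → ℝ → ℂ} {μ : Measure ℝ} {U : Set ℂ} (hU : IsOpen U)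
    (hd : ∀ᵐ x ∂μ, DifferentiableOn ℂ (fun ν => F ν x) U)
    (hm : ∀ ν ∈ U, AEStronglyMeasurable (F ν) μ)
    (hb : ∀ ν₀ ∈ U, ∃ ε > 0, ∃ bound : ℝ → ℝ, Integrable bound μ ∧ Metric.ball ν₀ ε ⊆ U ∧
      ∀ᵐ x ∂μ, ∀ ν ∈ Metric.ball ν₀ ε, ‖F ν x‖ ≤ bound x) :
    DifferentiableOn ℂ (fun ν => ∫ x, F ν x ∂μ) U := by
  intro ν₀ h0
  obtain ⟨ε, hε, bound, hbi, hbU, hbb⟩ := hb ν₀ h0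
  have hν0 : ν₀ ∈ Metric.ball ν₀ ε := Metric.mem_ball_self hε
  have key := hasDerivAt_integral_of_dominated_loc_of_deriv_le (𝕜 := ℂ) (μ := μ) (F := F) (x₀ := ν₀)
    (s := Metric.ball ν₀ (ε/2)) (F' := fun ν x => deriv (fun ν => F ν x) ν)
    (bound := fun x => bound x / (ε/4))
    (Metric.ball_mem_nhds _ (by positivity))
    (by filter_upwards [hU.mem_nhds h0] with ν hν using hm ν hν)
    (Integrable.mono' hbi (hm ν₀ h0) (by filter_upwards [hbb] with x hx using hx ν₀ hν0))
    ?_ ?_ (hbi.div_const _) ?_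
  · exact key.2.differentiableAt.differentiableWithinAt
  · have hlim : Filter.Tendsto (fun n : ℕ => ((ε/2/(n+1) : ℝ) : ℂ)) Filter.atTop (nhds 0) := by
      rw [← Complex.ofReal_zero]
      apply (Complex.continuous_ofReal.tendsto 0).comp
      exact tendsto_const_div_atTop_nhds_zero_nat (ε/2) |>.comp (Filter.tendsto_add_atTop_nat 1) |>.congr (by intro n; simp)
    have hne : ∀ n : ℕ, ((ε/2/(n+1) : ℝ) : ℂ) ≠ 0 := by
      intro n
      rw [Ne, Complex.ofReal_eq_zero]; positivity
    refine aestronglyMeasurable_of_tendsto_ae Filter.atTop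
      (f := fun (n:ℕ) x => (((ε/2/(n+1) : ℝ) : ℂ))⁻¹ • (F (ν₀ + ((ε/2/(n+1) : ℝ) : ℂ)) x - F ν₀ x)) ?_ ?_
    · intro n
      have hmem : ν₀ + ((ε/2/(n+1) : ℝ) : ℂ) ∈ Metric.ball ν₀ ε := ?_
      · exact ((hm _ (hbU hmem)).sub (hm _ h0)).const_smul ((((ε/2/(n+1) : ℝ) : ℂ))⁻¹)
      rw [Metric.mem_ball, dist_eq_norm, add_sub_cancel_left, Complex.norm_real, Real.norm_of_nonneg (by positivity)]
      have : ε/2/((n:ℝ)+1) ≤ ε/2 := div_le_self (by positivity) (by linarith [(by positivity : (0:ℝ) ≤ n)])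
      linarith
    · filter_upwards [hd] with x hx
      have h1 : HasDerivAt (fun ν => F ν x) (deriv (fun ν => F ν x) ν₀) ν₀ :=
        (hx.differentiableAt (hU.mem_nhds h0)).hasDerivAt
      have h2 := h1.tendsto_slope_zero
      refine h2.comp (tendsto_nhdsWithin_iff.2 ⟨hlim, Filter.Eventually.of_forall hne⟩)
  · filter_upwards [hd, hbb] with x hx hbx ν hν
    refine Complex.norm_deriv_le_of_forall_mem_sphere_norm_le (by positivity) ?_ ?_
    · refine (hx.mono (subset_trans ?_ hbU)).diffContOnCl_ball (U := Metric.ball ν₀ ε) ?_ |> fun h => h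
      · exact subset_rfl
      · intro y hy
        rw [Metric.mem_closedBall] at hy
        rw [Metric.mem_ball] at hν ⊢
        have := dist_triangle y ν ν₀
        linarith
    · intro y hy
      apply hbx
      rw [Metric.mem_sphere] at hy
      rw [Metric.mem_ball] at hν ⊢
      have := dist_triangle y ν ν₀
      linarith
  · filter_upwards [hd] with x hx ν hν
    refine (hx.differentiableAt (hU.mem_nhds (hbU ?_))).hasDerivAt
    exact Metric.ball_subset_ball (by linarith) hν

lemma lw_differentiable (n : ℕ) : Differentiable ℂ (fun ν => lw ν n) := by
  unfold lw
  fun_prop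

lemma lf_differentiable (z : ℂ) (hz : ‖z‖ < 1) : Differentiable ℂ (fun ν => lf ν z) := by
  intro ν₀
  obtain ⟨C, hC1, hC⟩ := lw_bound (‖ν₀‖ + 1)
  have := differentiableOn_tsum_of_summable_norm (F := fun n ν => lw ν n * z ^ n) (U := Metric.ball ν₀ 1)
    ((summable_geometric_of_lt_one (norm_nonneg z) hz).mul_left C)
    (fun n => ((lw_differentiable n).mul_const _).differentiableOn) Metric.isOpen_ball
    (fun n ν hν => by
      rw [norm_mul, norm_pow]
      have h1 : ‖ν‖ ≤ ‖ν₀‖ + 1 := by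
        rw [mem_ball_iff_norm] at hν
        have := norm_le_norm_add_norm_sub ν₀ ν
        linarith [norm_sub_rev ν ν₀]
      have := lw_le (hC ν h1) n
      gcongr)
  exact this.differentiableAt (Metric.ball_mem_nhds _ one_pos)

noncomputable def A3 (ν : ℂ) : ℂ := jJ ν 0 3 0 ((ν-1)/2)

lemma A3_diff : DifferentiableOn ℂ A3 {ν : ℂ | -1 < ν.re} := by
  have hU : IsOpen {ν : ℂ | -1 < ν.re} := isOpen_lt continuous_const Complex.continuous_re
  have e : A3 = fun ν => ∫ x in Set.Ioo (-1:ℝ) 1, jF ν 0 3 0 ((ν-1)/2) x := by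
    ext ν
    rw [A3, jJ, intervalIntegral.integral_of_le (by norm_num), integral_Ioc_eq_integral_Ioo]
  rw [e]
  apply holo_integral hU
  · rw [ae_restrict_iff' measurableSet_Ioo]
    refine Filter.Eventually.of_forall ?_
    intro x hx
    have h1 : Differentiable ℂ (fun ν => pP ν x) := by
      apply lf_differentiable
      rw [Complex.norm_real, Real.norm_of_nonneg (by linarith [hx.2])]; linarith [hx.1]
    have h2 : Differentiable ℂ (fun ν : ℂ => wt ((ν-1)/2) x) := by
      unfold wt
      have h0 : ((1 - x^2 : ℝ) : ℂ) ≠ 0 := by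
        rw [Ne, Complex.ofReal_eq_zero]; nlinarith [hx.1, hx.2]
      intro ν
      apply DifferentiableAt.const_cpow (by fun_prop) (Or.inl h0)
    unfold jF
    simp only [pow_zero, one_mul, mul_one]
    exact ((h1.pow 3).mul h2).differentiableOn
  · intro ν hν
    apply ContinuousOn.aestronglyMeasurable _ measurableSet_Ioo
    intro x hx
    exact (jF_hasDerivAt ν _ _ _ _ x hx.1 hx.2).continuousAt.continuousWithinAt
  · intro ν₀ h0
    simp only [Set.mem_ofPred_eq] at h0
    set ε := (ν₀.re + 1)/2 with hε
    have hε0 : 0 < ε := by rw [hε]; linarith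
    obtain ⟨C, hC1, hC⟩ := pP_bound (‖ν₀‖ + ε)
    set δ := min 1 (ε/12) with hδ
    have hδ0 : 0 < δ := lt_min one_pos (by positivity)
    have hδ1 : δ ≤ 1 := min_le_left _ _
    have hδ2 : δ ≤ ε/12 := min_le_right _ _
    set e0 := (ν₀.re - ε - 1)/2 with he0
    refine ⟨ε, hε0, fun x => (C * (1/δ))^3 * (1-x^2)^(-δ*3+e0), (integrable_w _ ?_).const_mul _, ?_, ?_⟩
    · rw [he0]; linarith
    · intro ν hν
      rw [mem_ball_iff_norm] at hν
      have := (Complex.abs_re_le_norm (ν - ν₀)).trans_lt hν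
      rw [abs_lt, Complex.sub_re] at this
      simp only [Set.mem_ofPred_eq]
      linarith [this.1]
    · rw [ae_restrict_iff' measurableSet_Ioo]
      refine Filter.Eventually.of_forall ?_
      intro x hx ν hν
      rw [mem_ball_iff_norm] at hν
      have h3 := (Complex.abs_re_le_norm (ν - ν₀)).trans_lt hν
      rw [abs_lt, Complex.sub_re] at h3
      have h4 : ‖ν‖ ≤ ‖ν₀‖ + ε := by
        have := norm_le_norm_add_norm_sub ν₀ ν
        linarith [norm_sub_rev ν ν₀]
      have h5 := hC ν h4 δ hδ0 hδ1 x hx.1 hx.2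
      have hp : 0 < 1 - x^2 := by nlinarith [hx.1, hx.2]
      unfold jF
      simp only [pow_zero, one_mul, mul_one]
      rw [norm_mul, norm_pow, wt_norm _ x hx.1 hx.2]
      have h6 : (1 - x^2)^((ν-1)/2).re ≤ (1-x^2)^e0 := by
        apply Real.rpow_le_rpow_of_exponent_ge hp (by nlinarith)
        rw [he0]; simp; linarith [h3.1]
      calc _ ≤ (C * (1/δ) * (1 - x^2)^(-δ))^3 * (1-x^2)^e0 := by gcongr
        _ = _ := by
          rw [mul_pow, Real.rpow_add hp, Real.rpow_mul hp.le, Real.rpow_ofNat]; ring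

noncomputable def rhs3 (ν : ℂ) : ℂ := ((3 - 2 * Complex.cos (ν * π)) / π) *
        (Complex.cos (ν * π / 2) / 2 ^ ν) ^ 3 *
        (Complex.Gamma ((1 + ν)/2) / Complex.Gamma (1 + ν/2)) ^ 4

lemma rhs3_diff : DifferentiableOn ℂ rhs3 {ν : ℂ | -1 < ν.re} := by
  unfold rhs3
  have h1 : DifferentiableOn ℂ (fun ν : ℂ => Complex.Gamma ((1 + ν)/2)) {ν : ℂ | -1 < ν.re} := by
    intro ν hν
    apply DifferentiableAt.differentiableWithinAt
    apply DifferentiableAt.comp (g := Complex.Gamma) (f := fun ν : ℂ => (1+ν)/2) _ _ (by fun_prop)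
    apply Complex.differentiableAt_Gamma
    intro m hm
    have := congrArg Complex.re hm
    simp at this hν
    have : (0:ℝ) ≤ m := by positivity
    linarith
  have h2 : Differentiable ℂ (fun ν : ℂ => (Complex.Gamma (1 + ν/2))⁻¹) :=
    Complex.differentiable_one_div_Gamma.comp (f := fun ν : ℂ => 1 + ν/2) (by fun_prop)
  have h3 : Differentiable ℂ (fun ν : ℂ => (3 - 2 * Complex.cos (ν * π)) / π) := by fun_prop
  have h4 : Differentiable ℂ (fun ν : ℂ => Complex.cos (ν * π / 2) / 2 ^ ν) := by
    apply Differentiable.div (by fun_prop)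
    · intro ν
      exact DifferentiableAt.const_cpow (by fun_prop) (Or.inl two_ne_zero)
    · intro ν; simp [Complex.cpow_eq_zero_iff]
  simp only [div_eq_mul_inv (Complex.Gamma _)]
  exact (h3.differentiableOn.mul (h4.differentiableOn.pow 3)).mul ((h1.mul h2.differentiableOn).pow 4)

lemma continuation (η : ℝ) (hη : 0 < η) (h : ∀ ν : ℝ, -1/2 - η < ν → ν < -1/2 + η → A3 ν = rhs3 ν) :
    ∀ ν : ℂ, -1 < ν.re → A3 ν = rhs3 ν := by
  have hU : IsOpen {ν : ℂ | -1 < ν.re} := isOpen_lt continuous_const Complex.continuous_re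
  have hc : IsPreconnected {ν : ℂ | -1 < ν.re} := (convex_halfSpace_re_gt (-1)).isPreconnected
  have hfr : ∃ᶠ z in nhdsWithin (((-1/2:ℝ)):ℂ) {(((-1/2:ℝ)):ℂ)}ᶜ, A3 z = rhs3 z := by
    have ht : Filter.Tendsto (fun x : ℝ => (x:ℂ)) (nhdsWithin (-1/2) {-1/2}ᶜ) (nhdsWithin (((-1/2:ℝ)):ℂ) {(((-1/2:ℝ)):ℂ)}ᶜ) := by
      apply tendsto_nhdsWithin_of_tendsto_nhds_of_eventually_within
      · exact (Complex.continuous_ofReal.tendsto _).mono_left nhdsWithin_le_nhds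
      · filter_upwards [self_mem_nhdsWithin] with x hx
        intro h; exact hx (Complex.ofReal_injective h)
    apply ht.frequently
    apply Filter.Eventually.frequently
    filter_upwards [nhdsWithin_le_nhds (Ioo_mem_nhds (show -1/2 - η < -1/2 by linarith) (show -1/2 < -1/2 + η by linarith))] with x hx
    exact h x hx.1 hx.2
  have := (A3_diff.analyticOnNhd hU).eqOn_of_preconnected_of_frequently_eq (rhs3_diff.analyticOnNhd hU) hc
    (z₀ := (((-1/2:ℝ)):ℂ)) (by simp; norm_num) hfr
  intro ν hν
  exact this hν

lemma final_of_A3 (hA : ∀ ν : ℂ, -1 < ν.re → A3 ν = rhs3 ν) (ν : ℂ) (hν : -1 < ν.re) :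
    (∫ x in (-1:ℝ)..1, (legendreP (ν + 2) (x : ℂ)) ^ 3 * ((1 - (x:ℂ) ^ 2) ^ ((ν - 1)/2)))
      = ((3 - 2 * Complex.cos (ν * π)) / π) *
        ((2 * ν ^ 3 + 15 * ν ^ 2 + 36 * ν + 29) / (16 * (ν + 2) ^ 3)) *
        (Complex.cos (ν * π / 2) / 2 ^ ν) ^ 3 *
        (Complex.Gamma ((1 + ν)/2) / Complex.Gamma (1 + ν/2)) ^ 4 := by
  have hr := recursion (ν+2) (by simp; linarith)
  have h2 := hA (ν+2) (by simp; linarith)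
  unfold A3 at h2
  rw [h2] at hr
  have e0 : (∫ x in (-1:ℝ)..1, (legendreP (ν + 2) (x : ℂ)) ^ 3 * ((1 - (x:ℂ) ^ 2) ^ ((ν - 1)/2)))
     = jJ (ν+2) 0 3 0 ((ν+2-3)/2) := by
    unfold jJ
    congr 1; ext x
    rw [legendreP_pP]
    unfold jF wt
    rw [show (ν+2-3)/2 = (ν-1)/2 by ring]
    push_cast; ring
  rw [e0]
  have hν1 : ν + 1 ≠ 0 := by
    intro h; have := congrArg Complex.re h; simp at this; linarith
  have hν2 : ν + 2 ≠ 0 := by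
    intro h; have := congrArg Complex.re h; simp at this; linarith
  have g1 : Complex.Gamma ((1 + (ν+2))/2) = (ν+1)/2 * Complex.Gamma ((1+ν)/2) := by
    rw [show (1 + (ν+2))/2 = (1+ν)/2 + 1 by ring, Complex.Gamma_add_one]
    · ring
    · intro h; apply hν1; linear_combination 2*h
  have g2 : Complex.Gamma (1 + (ν+2)/2) = (ν+2)/2 * Complex.Gamma (1 + ν/2) := by
    rw [show 1 + (ν+2)/2 = (1+ν/2) + 1 by ring, Complex.Gamma_add_one]
    · ring
    · intro h; apply hν2; linear_combination 2*h
  have c1 : Complex.cos ((ν+2) * π) = Complex.cos (ν*π) := by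
    rw [show (ν+2)*π = ν*π + 2*π by ring, Complex.cos_add_two_pi]
  have c2 : Complex.cos ((ν+2) * π / 2) = -Complex.cos (ν*π/2) := by
    rw [show (ν+2)*π/2 = ν*π/2 + π by ring, Complex.cos_add_pi]
  have p2 : (2:ℂ)^(ν+2) = 4 * 2^ν := by
    rw [Complex.cpow_add _ _ two_ne_zero]; norm_num; ring
  unfold rhs3 at hr
  rw [g1, g2, c1, c2, p2] at hr
  have hG : Complex.Gamma (1 + ν/2) ≠ 0 := by
    apply Complex.Gamma_ne_zero_of_re_pos; simp; linarith
  have h2ν : (2:ℂ)^ν ≠ 0 := by simp [Complex.cpow_eq_zero_iff]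
  have hπ : (π:ℂ) ≠ 0 := by simp [Real.pi_ne_zero]
  have h4 : (ν+2-1)^4 ≠ 0 := pow_ne_zero _ (by rw [show ν+2-1 = ν+1 by ring]; exact hν1)
  apply mul_left_cancel₀ h4
  rw [hr]
  field_simp
  ring


noncomputable def poch (x : ℝ) (n : ℕ) : ℝ := ∏ k ∈ Finset.range n, (x + k)

lemma poch_succ (x : ℝ) (n : ℕ) : poch x (n+1) = poch x n * (x + n) := by
  unfold poch; rw [Finset.prod_range_succ]

lemma poch_zero (x : ℝ) : poch x 0 = 1 := by simp [poch]

lemma poch_pos {x : ℝ} (hx : 0 < x) (n : ℕ) : 0 < poch x n := by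
  unfold poch
  exact Finset.prod_pos fun k _ => by positivity

lemma Gamma_add_nat' {x : ℝ} (hx : 0 < x) (n : ℕ) : Real.Gamma (x + n) = Real.Gamma x * poch x n := by
  induction n with
  | zero => simp [poch_zero]
  | succ n ih =>
    rw [poch_succ, Nat.cast_succ, ← add_assoc, Real.Gamma_add_one (by positivity), ih]; ring

lemma poch_one (n : ℕ) : poch 1 n = n.factorial := by
  induction n with
  | zero => simp [poch_zero]
  | succ n ih => rw [poch_succ, ih, Nat.factorial_succ]; push_cast; ring

lemma choose_poch (b : ℝ) (n : ℕ) : Ring.choose (b + n - 1) n = poch b n / n.factorial := by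
  have h3 : (n.factorial : ℝ) ≠ 0 := by exact_mod_cast Nat.factorial_ne_zero n
  rw [eq_div_iff h3, mul_comm, ← nsmul_eq_mul, ← Ring.descPochhammer_eq_factorial_smul_choose,
    Polynomial.descPochhammer_smeval_eq_ascPochhammer, Polynomial.ascPochhammer_smeval_cast, Polynomial.ascPochhammer_smeval_eq_eval,
    show b + n - 1 - n + 1 = b by ring]
  induction n with
  | zero => simp [poch_zero]
  | succ n ih =>
    rw [ascPochhammer_succ_eval, poch_succ, ih (by exact_mod_cast Nat.factorial_ne_zero n)]

lemma binom_hasSum (b y : ℝ) (hy : |y| < 1) :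
    HasSum (fun n : ℕ => poch b n / n.factorial * y ^ n) ((1-y)^(-b)) := by
  have h := (Real.one_div_one_sub_rpow_hasFPowerSeriesOnBall_zero b).hasSum (y := y) (by
    rw [← ENNReal.ofReal_one, Metric.eball_ofReal]; simpa using hy)
  have h1 : 0 ≤ 1 - y := by linarith [(abs_lt.1 hy).2]
  simp only [zero_add, FormalMultilinearSeries.ofScalars_apply_eq] at h
  rw [one_div, ← Real.rpow_neg h1] at h
  refine h.congr_fun ?_
  intro n
  rw [choose_poch]; simp

noncomputable def bt (α β : ℝ) : ℝ := Real.Gamma α * Real.Gamma β / Real.Gamma (α + β)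

lemma bt_pos {α β : ℝ} (hα : 0 < α) (hβ : 0 < β) : 0 < bt α β := ProbabilityTheory.beta_pos hα hβ

lemma bt_shift {α β : ℝ} (hα : 0 < α) (hβ : 0 < β) (n : ℕ) : bt (α + n) β = bt α β * (poch α n / poch (α+β) n) := by
  unfold bt
  rw [show α + n + β = (α + β) + n by ring, Gamma_add_nat' hα, Gamma_add_nat' (by positivity)]
  have := poch_pos (show 0 < α + β by positivity) n
  have := Real.Gamma_pos_of_pos (show 0 < α + β by positivity)
  field_simp

noncomputable def bI (α β : ℝ) (f : ℝ → ENNReal) : ENNReal :=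
  ∫⁻ τ in Set.Ioo (0:ℝ) 1, ENNReal.ofReal (τ^(α-1) * (1-τ)^(β-1)) * f τ

lemma bI_congr {α β : ℝ} {f g : ℝ → ENNReal} (h : ∀ τ, 0 < τ → τ < 1 → f τ = g τ) : bI α β f = bI α β g := by
  unfold bI
  exact setLIntegral_congr_fun measurableSet_Ioo fun τ hτ => by simp only [h τ hτ.1 hτ.2]

lemma bI_one {α β : ℝ} (hα : 0 < α) (hβ : 0 < β) : bI α β (fun _ => 1) = ENNReal.ofReal (bt α β) := by
  have h := ProbabilityTheory.lintegral_betaPDF_eq_one hα hβ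
  rw [ProbabilityTheory.lintegral_betaPDF] at h
  have hb := ProbabilityTheory.beta_pos hα hβ
  have e : bI α β (fun _ => 1) = ∫⁻ (x : ℝ) in Set.Ioo 0 1, ENNReal.ofReal (ProbabilityTheory.beta α β) * ENNReal.ofReal (1 / ProbabilityTheory.beta α β * x ^ (α - 1) * (1 - x) ^ (β - 1)) := by
    unfold bI
    congr 1; ext x
    rw [← ENNReal.ofReal_mul hb.le, mul_one]
    congr 1
    field_simp
  rw [e, lintegral_const_mul' _ _ ENNReal.ofReal_ne_top, h, mul_one]
  rfl

lemma bI_mul_pow (α β γ δ : ℝ) (f : ℝ → ENNReal) :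
    bI α β (fun τ => ENNReal.ofReal (τ^γ * (1-τ)^δ) * f τ) = bI (α+γ) (β+δ) f := by
  unfold bI
  apply setLIntegral_congr_fun measurableSet_Ioo
  intro τ hτ
  have h1 := hτ.1
  have h2 : 0 < 1 - τ := by linarith [hτ.2]
  simp only
  rw [← mul_assoc, ← ENNReal.ofReal_mul (by positivity), show α + γ - 1 = (α-1)+γ by ring,
    show β + δ - 1 = (β-1)+δ by ring, Real.rpow_add h1, Real.rpow_add h2]
  congr 2; ring

lemma bI_pow {α β : ℝ} (hα : 0 < α) (hβ : 0 < β) (n : ℕ) :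
    bI α β (fun τ => ENNReal.ofReal (τ^n)) = ENNReal.ofReal (bt (α+n) β) := by
  rw [← bI_one (by positivity) hβ]
  have := bI_mul_pow α β n 0 (fun _ => 1)
  simp at this
  rw [← this]

lemma bI_const_mul {α β : ℝ} (c : ENNReal) (hc : c ≠ ⊤) (f : ℝ → ENNReal) :
    bI α β (fun τ => c * f τ) = c * bI α β f := by
  unfold bI
  rw [← lintegral_const_mul' _ _ hc]
  congr 1; ext x; ring

lemma bI_tsum {α β : ℝ} (g : ℕ → ℝ → ENNReal) (hg : ∀ n, Measurable (g n)) :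
    bI α β (fun τ => ∑' n, g n τ) = ∑' n, bI α β (g n) := by
  unfold bI
  rw [← lintegral_tsum]
  · congr 1; ext τ
    rw [ENNReal.tsum_mul_left]
  · intro n
    apply Measurable.aemeasurable
    exact (by fun_prop : Measurable fun τ : ℝ => ENNReal.ofReal (τ^(α-1) * (1-τ)^(β-1))).mul (hg n)

lemma bI_symm (α β : ℝ) (f : ℝ → ENNReal) : bI α β f = bI β α (fun τ => f (1-τ)) := by
  unfold bI
  have hmp : MeasurePreserving (fun x : ℝ => 1 - x) volume volume := Measure.measurePreserving_sub_left volume 1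
  have hemb : MeasurableEmbedding (fun x : ℝ => 1 - x) := (MeasurableEquiv.subLeft (1:ℝ)).measurableEmbedding
  rw [← hmp.setLIntegral_comp_preimage_emb hemb]
  have : (fun x : ℝ => 1 - x) ⁻¹' Set.Ioo 0 1 = Set.Ioo 0 1 := by
    ext x; simp [and_comm]
  rw [this]
  congr 1; ext x
  rw [sub_sub_cancel, mul_comm (x^(β-1))]

lemma bI_series {α β : ℝ} (hα : 0 < α) (hβ : 0 < β) (c : ℕ → ℝ) (hc : ∀ n, 0 ≤ c n) (f : ℝ → ENNReal)
    (hf : ∀ τ, 0 < τ → τ < 1 → f τ = ∑' n, ENNReal.ofReal (c n * τ ^ n)) :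
    bI α β f = ∑' n, ENNReal.ofReal (c n * bt (α + n) β) := by
  rw [bI_congr hf, bI_tsum _ (fun n => by fun_prop)]
  congr 1; ext n
  rw [ENNReal.ofReal_mul (hc n), ← bI_pow hα hβ, ← bI_const_mul _ ENNReal.ofReal_ne_top]
  congr 1; ext τ
  rw [ENNReal.ofReal_mul (hc n)]

/-- series in ENNReal of a nonneg real series -/
lemma ofReal_hasSum {c : ℕ → ℝ} (hc : ∀ n, 0 ≤ c n) {s : ℝ} (h : HasSum c s) :
    ENNReal.ofReal s = ∑' n, ENNReal.ofReal (c n) := by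
  rw [← h.tsum_eq, ENNReal.ofReal_tsum_of_nonneg hc h.summable]

lemma bI_binom {α β b z : ℝ} (hα : 0 < α) (hβ : 0 < β) (hb : 0 < b) (hz0 : 0 ≤ z) (hz1 : z ≤ 1) :
    bI α β (fun τ => ENNReal.ofReal ((1 - z*τ)^(-b))) =
      ∑' n : ℕ, ENNReal.ofReal (poch b n / n.factorial * z^n * bt (α + n) β) := by
  have hp : ∀ n : ℕ, 0 ≤ poch b n / n.factorial := fun n => div_nonneg (poch_pos hb n).le (by positivity)
  refine bI_series hα hβ _ (fun n => mul_nonneg (hp n) (by positivity)) _ ?_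
  intro τ h0 h1
  have h3 : z * τ < 1 := by nlinarith
  have h4 : 0 ≤ z * τ := by positivity
  rw [ofReal_hasSum _ (binom_hasSum b (z*τ) (by rw [abs_of_nonneg h4]; exact h3))]
  · congr 1; ext n; congr 1; rw [mul_pow]; ring
  · intro n; exact mul_nonneg (hp n) (by positivity)

/-- (ii) -/
lemma bI_ii {a z : ℝ} (ha : 0 < a) (hz0 : 0 ≤ z) (hz1 : z < 1) :
    bI a a (fun τ => ENNReal.ofReal ((1 - z*τ)^(-(2*a)))) = ENNReal.ofReal (bt a a * (1-z)^(-a)) := by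
  rw [bI_binom ha ha (by positivity) hz0 hz1.le]
  have h := (binom_hasSum a z (by rw [abs_of_nonneg hz0]; exact hz1)).mul_left (bt a a)
  rw [ofReal_hasSum _ h]
  · congr 1; ext n; congr 1
    rw [bt_shift ha ha, ← two_mul]
    have := poch_pos (show 0 < 2*a by positivity) n
    field_simp
  · intro n
    have := poch_pos ha n
    have := bt_pos ha ha
    positivity

/-- (iii) -/
lemma sum_iii {a : ℝ} (ha : 0 < a) (ha2 : a < 1/2) :
    ∑' n : ℕ, ENNReal.ofReal (poch a n * poch (1-2*a) n / n.factorial^2) =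
      ENNReal.ofReal (Real.Gamma a / (Real.Gamma (2*a) * Real.Gamma (1-a))) := by
  have h := bI_binom (α := 1-2*a) (β := 2*a) (b := a) (z := 1) (by linarith) (by linarith) ha zero_le_one le_rfl
  have e1 : bI (1-2*a) (2*a) (fun τ => ENNReal.ofReal ((1 - 1*τ)^(-a))) = ENNReal.ofReal (bt (1-2*a) a) := by
    have := bI_mul_pow (1-2*a) (2*a) 0 (-a) (fun _ => 1)
    simp only [Real.rpow_zero, one_mul, mul_one, add_zero] at this ⊢
    rw [this, show 2*a + -a = a by ring, bI_one (by linarith) ha]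
  rw [e1] at h
  have g1 := Real.Gamma_pos_of_pos (show 0 < 1-2*a by linarith)
  have g2 := Real.Gamma_pos_of_pos (show 0 < 2*a by linarith)
  have g3 := Real.Gamma_pos_of_pos (show 0 < 1-a by linarith)
  have e2 : ∀ n : ℕ, ENNReal.ofReal (poch a n / n.factorial * 1^n * bt (1-2*a + n) (2*a)) =
      ENNReal.ofReal (Real.Gamma (1-2*a) * Real.Gamma (2*a)) * ENNReal.ofReal (poch a n * poch (1-2*a) n / n.factorial^2) := by
    intro n
    rw [← ENNReal.ofReal_mul (by positivity), bt_shift (by linarith) (by linarith)]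
    congr 1
    have h1 : 1 - 2*a + 2*a = 1 := by ring
    rw [h1, poch_one, bt, h1, Real.Gamma_one]
    field_simp
    ring
  simp only [e2] at h
  rw [ENNReal.tsum_mul_left] at h
  have e3 : bt (1-2*a) a = (Real.Gamma (1-2*a) * Real.Gamma (2*a)) * (Real.Gamma a / (Real.Gamma (2*a) * Real.Gamma (1-a))) := by
    unfold bt
    rw [show 1 - 2*a + a = 1 - a by ring]
    field_simp
  rw [e3, ENNReal.ofReal_mul (by positivity)] at h
  have := (ENNReal.mul_right_inj (by simp; positivity) ENNReal.ofReal_ne_top).1 h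
  exact this.symm


lemma bI_swap {α β γ δ : ℝ} (f : ℝ → ℝ → ENNReal) (hf : Measurable (Function.uncurry f)) :
    bI α β (fun σ => bI γ δ (f σ)) = bI γ δ (fun τ => bI α β (fun σ => f σ τ)) := by
  unfold bI
  have h1 : ∀ σ : ℝ, ENNReal.ofReal (σ^(α-1) * (1-σ)^(β-1)) * (∫⁻ τ in Set.Ioo (0:ℝ) 1, ENNReal.ofReal (τ^(γ-1) * (1-τ)^(δ-1)) * f σ τ)
      = ∫⁻ τ in Set.Ioo (0:ℝ) 1, ENNReal.ofReal (σ^(α-1) * (1-σ)^(β-1)) * (ENNReal.ofReal (τ^(γ-1) * (1-τ)^(δ-1)) * f σ τ) := by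
    intro σ; rw [lintegral_const_mul' _ _ ENNReal.ofReal_ne_top]
  have h2 : ∀ τ : ℝ, ENNReal.ofReal (τ^(γ-1) * (1-τ)^(δ-1)) * (∫⁻ σ in Set.Ioo (0:ℝ) 1, ENNReal.ofReal (σ^(α-1) * (1-σ)^(β-1)) * f σ τ)
      = ∫⁻ σ in Set.Ioo (0:ℝ) 1, ENNReal.ofReal (τ^(γ-1) * (1-τ)^(δ-1)) * (ENNReal.ofReal (σ^(α-1) * (1-σ)^(β-1)) * f σ τ) := by
    intro τ; rw [lintegral_const_mul' _ _ ENNReal.ofReal_ne_top]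
  simp only [h1, h2]
  rw [lintegral_lintegral_swap]
  · congr 1; ext τ; congr 1; ext σ; ring
  · apply Measurable.aemeasurable
    unfold Function.uncurry at *
    simp only
    exact (by fun_prop : Measurable fun x : ℝ × ℝ => ENNReal.ofReal (x.1^(α-1) * (1-x.1)^(β-1))).mul
      ((by fun_prop : Measurable fun x : ℝ × ℝ => ENNReal.ofReal (x.2^(γ-1) * (1-x.2)^(δ-1))).mul hf)

lemma bI_weight_integrable {α β : ℝ} (hα : 0 < α) (hβ : 0 < β) :
    IntegrableOn (fun τ : ℝ => τ^(α-1) * (1-τ)^(β-1)) (Set.Ioo 0 1) := by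
  refine ⟨by apply Measurable.aestronglyMeasurable; fun_prop, ?_⟩
  rw [hasFiniteIntegral_iff_ofReal]
  · have := bI_one hα hβ
    unfold bI at this
    simp only [mul_one] at this
    rw [this]; exact ENNReal.ofReal_lt_top
  · rw [Filter.EventuallyLE, ae_restrict_iff' measurableSet_Ioo]
    refine Filter.Eventually.of_forall fun x hx => ?_
    have h1 := hx.1
    have h2 : 0 < 1 - x := by linarith [hx.2]
    simp only [Pi.zero_apply]
    positivity

lemma bI_pow_integrable {α β : ℝ} (hα : 0 < α) (hβ : 0 < β) (n : ℕ) :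
    IntegrableOn (fun τ : ℝ => τ^(α-1) * (1-τ)^(β-1) * τ^n) (Set.Ioo 0 1) ∧
    ∫ τ in Set.Ioo (0:ℝ) 1, τ^(α-1) * (1-τ)^(β-1) * τ^n = bt (α + n) β := by
  have e : Set.EqOn (fun τ : ℝ => τ^(α + n -1) * (1-τ)^(β-1)) (fun τ : ℝ => τ^(α-1) * (1-τ)^(β-1) * τ^n) (Set.Ioo 0 1) := by
    intro τ hτ
    simp only
    rw [show α + n - 1 = (α - 1) + n by ring, Real.rpow_add hτ.1, Real.rpow_natCast]; ring
  have hi := bI_weight_integrable (α := α + n) (by positivity) hβ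
  refine ⟨hi.congr_fun e measurableSet_Ioo, ?_⟩
  rw [← setIntegral_congr_fun measurableSet_Ioo e, integral_eq_lintegral_of_nonneg_ae _ hi.1]
  · have := bI_one (α := α + n) (by positivity) hβ
    unfold bI at this
    simp only [mul_one] at this
    rw [this, ENNReal.toReal_ofReal (bt_pos (by positivity) hβ).le]
  · rw [Filter.EventuallyLE, ae_restrict_iff' measurableSet_Ioo]
    refine Filter.Eventually.of_forall fun x hx => ?_
    have h1 := hx.1
    have h2 : 0 < 1 - x := by linarith [hx.2]
    simp only [Pi.zero_apply]
    positivity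

lemma bI_poly {α β : ℝ} (hα : 0 < α) (hβ : 0 < β) (N : ℕ) (c : ℕ → ℝ)
    (hc : ∀ τ, 0 < τ → τ < 1 → 0 ≤ ∑ j ∈ Finset.range N, c j * τ^j) :
    bI α β (fun τ => ENNReal.ofReal (∑ j ∈ Finset.range N, c j * τ^j)) =
      ENNReal.ofReal (∑ j ∈ Finset.range N, c j * bt (α + j) β) := by
  have e1 : bI α β (fun τ => ENNReal.ofReal (∑ j ∈ Finset.range N, c j * τ^j)) =
      ∫⁻ τ in Set.Ioo (0:ℝ) 1, ENNReal.ofReal (∑ j ∈ Finset.range N, c j * (τ^(α-1) * (1-τ)^(β-1) * τ^j)) := by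
    unfold bI
    apply setLIntegral_congr_fun measurableSet_Ioo
    intro τ hτ
    have h1 := hτ.1
    have h2 : 0 < 1 - τ := by linarith [hτ.2]
    simp only
    rw [← ENNReal.ofReal_mul (by positivity), Finset.mul_sum]
    congr 1
    apply Finset.sum_congr rfl
    intro j _; ring
  rw [e1, ← ofReal_integral_eq_lintegral_ofReal]
  · rw [MeasureTheory.integral_finsetSum]
    · congr 1
      apply Finset.sum_congr rfl
      intro j _
      rw [MeasureTheory.integral_const_mul, (bI_pow_integrable hα hβ j).2]
    · intro j _
      exact (bI_pow_integrable hα hβ j).1.const_mul _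
  · apply integrable_finsetSum
    intro j _
    exact (bI_pow_integrable hα hβ j).1.const_mul _
  · rw [Filter.EventuallyLE, ae_restrict_iff' measurableSet_Ioo]
    refine Filter.Eventually.of_forall fun τ hτ => ?_
    have h1 := hτ.1
    have h2 : 0 < 1 - τ := by linarith [hτ.2]
    have h3 := hc τ hτ.1 hτ.2
    have : ∑ j ∈ Finset.range N, c j * (τ^(α-1) * (1-τ)^(β-1) * τ^j) = (τ^(α-1) * (1-τ)^(β-1)) * ∑ j ∈ Finset.range N, c j * τ^j := by
      rw [Finset.mul_sum]
      apply Finset.sum_congr rfl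
      intro j _; ring
    rw [this]
    simp only [Pi.zero_apply]
    positivity

noncomputable def wr (b : ℝ) (n : ℕ) : ℝ := poch b n * poch (1-b) n / n.factorial^2
noncomputable def fr (b Z : ℝ) : ℝ := ∑' n, wr b n * Z^n

lemma wr_nonneg {b : ℝ} (hb : 0 < b) (hb1 : b < 1) (n : ℕ) : 0 ≤ wr b n := by
  unfold wr
  have := poch_pos hb n
  have := poch_pos (show 0 < 1 - b by linarith) n
  positivity

lemma lw_wr (b : ℝ) (n : ℕ) : lw ((b-1:ℝ):ℂ) n = (wr b n : ℂ) := by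
  induction n with
  | zero => simp [lw_zero, wr, poch_zero]
  | succ n ih =>
    rw [lw_succ, ih, wr, wr, poch_succ, poch_succ, Nat.factorial_succ]
    have h1 : (n:ℂ) + 1 ≠ 0 := by exact_mod_cast Nat.succ_ne_zero n
    have h3 : (n.factorial : ℂ) ≠ 0 := by exact_mod_cast Nat.factorial_ne_zero n
    push_cast
    field_simp
    ring

lemma lf_fr (b Z : ℝ) : lf ((b-1:ℝ):ℂ) (Z:ℂ) = (fr b Z : ℂ) := by
  unfold lf fr
  rw [Complex.ofReal_tsum]
  congr 1; ext n
  rw [lw_wr]; push_cast; ring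

lemma wr_symm (b : ℝ) (n : ℕ) : wr (1-b) n = wr b n := by
  unfold wr; rw [sub_sub_cancel]; ring

lemma fr_symm (b Z : ℝ) : fr (1-b) Z = fr b Z := by
  unfold fr; simp only [wr_symm]

lemma fr_summable (b Z : ℝ) (hZ : |Z| < 1) : Summable (fun n => wr b n * Z^n) := by
  have := lf_summable ((b-1:ℝ):ℂ) (Z:ℂ) (by rwa [Complex.norm_real])
  simp only [lw_wr] at this
  exact_mod_cast this

lemma fr_ofReal {b Z : ℝ} (hb : 0 < b) (hb1 : b < 1) (hZ0 : 0 ≤ Z) (hZ : Z < 1) :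
    ENNReal.ofReal (fr b Z) = ∑' n, ENNReal.ofReal (wr b n * Z^n) :=
  ofReal_hasSum (fun n => mul_nonneg (wr_nonneg hb hb1 n) (by positivity))
    (fr_summable b Z (by rwa [abs_of_nonneg hZ0])).hasSum

lemma fr_ge_one {b Z : ℝ} (hb : 0 < b) (hb1 : b < 1) (hZ0 : 0 ≤ Z) (hZ : Z < 1) : 1 ≤ fr b Z := by
  have h := (fr_summable b Z (by rwa [abs_of_nonneg hZ0])).le_tsum 0 (fun n _ => mul_nonneg (wr_nonneg hb hb1 n) (by positivity))
  unfold fr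
  simpa [wr, poch_zero] using h

lemma euler_lintegral {b Z : ℝ} (hb : 0 < b) (hb1 : b < 1) (hZ0 : 0 ≤ Z) (hZ : Z < 1) :
    bI (1-b) b (fun s => ENNReal.ofReal ((1-Z*s)^(-b))) = ENNReal.ofReal (Real.Gamma b * Real.Gamma (1-b)) * ENNReal.ofReal (fr b Z) := by
  rw [bI_binom (by linarith) hb hb hZ0 hZ.le, fr_ofReal hb hb1 hZ0 hZ, ← ENNReal.tsum_mul_left]
  congr 1; ext n
  have g1 := Real.Gamma_pos_of_pos hb
  have g2 := Real.Gamma_pos_of_pos (show 0 < 1 - b by linarith)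
  rw [← ENNReal.ofReal_mul (by positivity), bt_shift (by linarith) hb]
  congr 1
  rw [bt, show 1 - b + b = 1 by ring, Real.Gamma_one, poch_one, wr]
  field_simp

noncomputable def Sa (a : ℝ) : ℝ := Real.Gamma a / (Real.Gamma (2*a) * Real.Gamma (1-a))

lemma bIbI {a : ℝ} (ha : 0 < a) (ha2 : a < 1/2) :
    bI a a (fun σ => bI a (1-a) (fun τ => ENNReal.ofReal (fr (2*a) (1-σ*τ)))) =
      ENNReal.ofReal (bt a a * bt a (1-a) * Sa a ^ 2) := by
  have g1 := Real.Gamma_pos_of_pos (show 0 < 1-2*a by linarith)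
  have g2 := Real.Gamma_pos_of_pos (show 0 < 2*a by linarith)
  have g3 := Real.Gamma_pos_of_pos (show 0 < 1-a by linarith)
  have g4 := Real.Gamma_pos_of_pos ha
  set K := ENNReal.ofReal (Real.Gamma (2*a) * Real.Gamma (1-2*a)) with hK
  have hK0 : K ≠ 0 := by rw [hK]; simp; positivity
  have hKt : K ≠ ⊤ := ENNReal.ofReal_ne_top
  apply (ENNReal.mul_right_inj hK0 hKt).1
  -- expand
  have s1 : K * bI a a (fun σ => bI a (1-a) (fun τ => ENNReal.ofReal (fr (2*a) (1-σ*τ)))) =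
      bI a a (fun σ => bI a (1-a) (fun τ => bI (1-2*a) (2*a) (fun s => ENNReal.ofReal ((1-s+s*σ*τ)^(-(2*a)))))) := by
    rw [← bI_const_mul _ hKt]
    apply bI_congr; intro σ h0 h1
    rw [← bI_const_mul _ hKt]
    apply bI_congr; intro τ h0' h1'
    rw [hK, ← euler_lintegral (by linarith) (by linarith) (by nlinarith) (by nlinarith [mul_pos h0 h0'])]
    congr 1; ext s; congr 2; ring
  rw [s1]
  have s2 : bI a a (fun σ => bI a (1-a) (fun τ => bI (1-2*a) (2*a) (fun s => ENNReal.ofReal ((1-s+s*σ*τ)^(-(2*a))))))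
      = bI (1-2*a) (2*a) (fun s => bI a (1-a) (fun τ => bI a a (fun σ => ENNReal.ofReal ((1-s+s*σ*τ)^(-(2*a)))))) := by
    have t1 : ∀ σ : ℝ, bI a (1-a) (fun τ => bI (1-2*a) (2*a) (fun s => ENNReal.ofReal ((1-s+s*σ*τ)^(-(2*a)))))
      = bI (1-2*a) (2*a) (fun s => bI a (1-a) (fun τ => ENNReal.ofReal ((1-s+s*σ*τ)^(-(2*a))))) := by
      intro σ
      rw [bI_swap]
      unfold Function.uncurry; fun_prop
    simp only [t1]
    rw [bI_swap]
    · apply bI_congr; intro s _ _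
      rw [bI_swap]
      unfold Function.uncurry; fun_prop
    · unfold Function.uncurry bI
      have hm : Measurable (fun q : (ℝ × ℝ) × ℝ => ENNReal.ofReal (q.2 ^ (a - 1) * (1 - q.2) ^ (1 - a - 1)) * ENNReal.ofReal ((1 - q.1.2 + q.1.2 * q.1.1 * q.2) ^ (-(2*a)))) := by
        fun_prop
      exact hm.lintegral_prod_right'
  rw [s2]
  have s3 : ∀ s, 0 < s → s < 1 → bI a (1-a) (fun τ => bI a a (fun σ => ENNReal.ofReal ((1-s+s*σ*τ)^(-(2*a)))))
      = ENNReal.ofReal (s^(0:ℝ) * (1-s)^(-a)) * (ENNReal.ofReal (bt a a) * bI (1-a) a (fun τ => ENNReal.ofReal ((1-s*τ)^(-a)))) := by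
    intro s hs0 hs1
    have hs : 0 < 1 - s := by linarith
    have hbt := bt_pos ha ha
    rw [bI_symm (1-a) a, ← bI_const_mul _ ENNReal.ofReal_ne_top, ← bI_const_mul _ ENNReal.ofReal_ne_top]
    apply bI_congr; intro τ h0 h1
    have hst : 0 < s * τ := by positivity
    have hD : 0 < 1 - s + s*τ := by linarith
    have hz : s*τ/(1-s+s*τ) < 1 := by rw [div_lt_one hD]; linarith
    have := bI_ii ha (z := s*τ/(1-s+s*τ)) (by positivity) hz
    rw [bI_symm]
    have e : ∀ σ, 0 < σ → σ < 1 → ENNReal.ofReal ((1-s+s*(1-σ)*τ)^(-(2*a))) = ENNReal.ofReal ((1-s+s*τ)^(-(2*a))) * ENNReal.ofReal ((1 - s*τ/(1-s+s*τ)*σ)^(-(2*a))) := by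
      intro σ h2 h3
      have : 0 ≤ 1 - s*τ/(1-s+s*τ)*σ := by nlinarith [div_pos hst hD]
      rw [← ENNReal.ofReal_mul (by positivity), ← Real.mul_rpow hD.le this]
      congr 2
      field_simp
      ring
    rw [bI_congr e, bI_const_mul _ ENNReal.ofReal_ne_top, this]
    rw [← ENNReal.ofReal_mul (by positivity), ← ENNReal.ofReal_mul hbt.le, ← ENNReal.ofReal_mul (by positivity)]
    congr 1
    rw [show 1 - s*τ/(1-s+s*τ) = (1-s)/(1-s+s*τ) by field_simp; ring, show 1 - s*(1-τ) = 1-s+s*τ by ring]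
    rw [Real.div_rpow hs.le hD.le, show -(2*a) = -a + -a by ring, Real.rpow_add hD]
    have := Real.rpow_pos_of_pos hD (-a)
    field_simp
    simp
  rw [bI_congr s3, bI_mul_pow, bI_const_mul _ ENNReal.ofReal_ne_top]
  have s4 := bI_series (α := 1-2*a+0) (β := 2*a+-a) (by linarith) (by linarith)
    (fun n => poch a n / n.factorial * bt (1-a+n) a) (fun n => by
      have := poch_pos ha n
      have := bt_pos (show 0 < 1 - a + n by linarith [(by positivity : (0:ℝ) ≤ n)]) ha
      positivity)
    (fun s => bI (1-a) a (fun τ => ENNReal.ofReal ((1-s*τ)^(-a)))) (by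
      intro s hs0 hs1
      rw [bI_binom (by linarith) ha ha hs0.le hs1.le]
      congr 1; ext n; congr 1; ring)
  rw [s4]
  have s5 : ∀ n : ℕ, ENNReal.ofReal (poch a n / n.factorial * bt (1-a+n) a * bt (1-2*a+0+n) (2*a+-a))
     = ENNReal.ofReal (bt (1-a) a * bt (1-2*a) a) * ENNReal.ofReal (poch a n * poch (1-2*a) n / n.factorial^2) := by
    intro n
    have b1 := bt_pos (show 0 < 1 - a by linarith) ha
    have b2 := bt_pos (show 0 < 1 - 2*a by linarith) ha
    rw [← ENNReal.ofReal_mul (by positivity)]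
    congr 1
    rw [show 1 - 2*a+0 = 1-2*a by ring, show 2*a+-a = a by ring, bt_shift (by linarith) ha, bt_shift (by linarith) ha,
      show 1 - a + a = 1 by ring, show 1 - 2*a + a = 1 - a by ring, poch_one]
    have := poch_pos (show 0 < 1 - a by linarith) n
    field_simp
  simp only [s5]
  have b1 := bt_pos (show 0 < 1 - a by linarith) ha
  have b2 := bt_pos (show 0 < 1 - 2*a by linarith) ha
  have b3 := bt_pos ha ha
  rw [ENNReal.tsum_mul_left, sum_iii ha ha2, hK, ← ENNReal.ofReal_mul (by positivity), ← ENNReal.ofReal_mul (by positivity), ← ENNReal.ofReal_mul (by positivity)]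
  congr 1
  unfold bt Sa
  rw [show 1 - a + a = 1 by ring, show a + (1-a) = 1 by ring, show 1 - 2*a + a = 1 - a by ring]
  simp only [Real.Gamma_one]
  field_simp


lemma lint_poly {μ : Measure ℝ} (w g : ℝ → ℝ) (m c : ℕ → ℝ) (N : ℕ)
    (h : ∀ j, Integrable (fun x => w x * g x ^ j) μ) (hm : ∀ j, ∫ x, w x * g x ^ j ∂μ = m j)
    (hw : ∀ᵐ x ∂μ, 0 ≤ w x) (hc : ∀ᵐ x ∂μ, 0 ≤ ∑ j ∈ Finset.range N, c j * g x ^ j) :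
    (∫⁻ x, ENNReal.ofReal (w x) * ENNReal.ofReal (∑ j ∈ Finset.range N, c j * g x ^ j) ∂μ
      = ENNReal.ofReal (∑ j ∈ Finset.range N, c j * m j)) ∧ 0 ≤ ∑ j ∈ Finset.range N, c j * m j := by
  have e1 : ∀ x, w x * ∑ j ∈ Finset.range N, c j * g x ^ j = ∑ j ∈ Finset.range N, c j * (w x * g x ^ j) := by
    intro x
    rw [Finset.mul_sum]
    apply Finset.sum_congr rfl
    intro j _; ring
  have hi : Integrable (fun x => w x * ∑ j ∈ Finset.range N, c j * g x ^ j) μ := by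
    simp only [e1]
    apply integrable_finsetSum
    intro j _
    exact (h j).const_mul _
  have hv : ∫ x, w x * ∑ j ∈ Finset.range N, c j * g x ^ j ∂μ = ∑ j ∈ Finset.range N, c j * m j := by
    simp only [e1]
    rw [MeasureTheory.integral_finsetSum]
    · apply Finset.sum_congr rfl
      intro j _
      rw [MeasureTheory.integral_const_mul, hm]
    · intro j _
      exact (h j).const_mul _
  have hn : ∀ᵐ x ∂μ, 0 ≤ w x * ∑ j ∈ Finset.range N, c j * g x ^ j := by
    filter_upwards [hw, hc] with x h1 h2 using mul_nonneg h1 h2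
  refine ⟨?_, ?_⟩
  · rw [← hv, ofReal_integral_eq_lintegral_ofReal hi hn]
    apply lintegral_congr_ae
    filter_upwards [hw] with x h1
    rw [ENNReal.ofReal_mul h1]
  · rw [← hv]; exact integral_nonneg_of_ae hn

lemma binom_neg (y : ℝ) (N : ℕ) : (1 - y)^N = ∑ j ∈ Finset.range (N+1), ((N.choose j : ℝ) * (-1)^j) * y^j := by
  rw [sub_eq_add_neg, add_comm, add_pow]
  apply Finset.sum_congr rfl
  intro j _
  rw [neg_pow y]; simp; ring

noncomputable def pr (b x : ℝ) : ℝ := fr b ((1-x)/2)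

lemma pP_pr (b x : ℝ) : pP ((b-1:ℝ):ℂ) x = (pr b x : ℂ) := by
  rw [pP, pr, lf_fr]

lemma pr_ge_one {b x : ℝ} (hb : 0 < b) (hb1 : b < 1) (h1 : -1 < x) (h2 : x < 1) : 1 ≤ pr b x :=
  fr_ge_one hb hb1 (by linarith) (by linarith)

noncomputable def mom (a : ℝ) (n : ℕ) : ℝ := ∫ x in Set.Ioo (-1:ℝ) 1, pr (2*a) x * (1-x^2)^(a-1) * (1-x^2)^n

lemma mom_F (a : ℝ) (n : ℕ) (x : ℝ) (h1 : -1 < x) (h2 : x < 1) :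
    jF ((2*a-1:ℝ):ℂ) 0 1 0 ((a-1+n:ℝ):ℂ) x = ((pr (2*a) x * (1-x^2)^(a-1) * (1-x^2)^n : ℝ):ℂ) := by
  have h : 0 < 1 - x^2 := by nlinarith
  rw [jF, pP_pr, wt, ← Complex.ofReal_cpow h.le, Real.rpow_add h, Real.rpow_natCast]
  push_cast; ring

lemma mom_integrable {a : ℝ} (ha : 0 < a) (n : ℕ) :
    IntegrableOn (fun x => pr (2*a) x * (1-x^2)^(a-1) * (1-x^2)^n) (Set.Ioo (-1) 1) := by
  have h := jF_integrable ((2*a-1:ℝ):ℂ) 0 1 0 ((a-1+n:ℝ):ℂ) (by rw [Complex.ofReal_re]; linarith [(by positivity : (0:ℝ) ≤ n)])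
  rw [intervalIntegrable_iff_integrableOn_Ioo_of_le (by norm_num)] at h
  have h2 : IntegrableOn (fun x => ((pr (2*a) x * (1-x^2)^(a-1) * (1-x^2)^n : ℝ):ℂ)) (Set.Ioo (-1) 1) :=
    h.congr_fun (fun x hx => mom_F a n x hx.1 hx.2) measurableSet_Ioo
  have := h2.re
  simp only [RCLike.re_to_complex, Complex.ofReal_re] at this
  exact this

lemma mom_jJ (a : ℝ) (n : ℕ) : jJ ((2*a-1:ℝ):ℂ) 0 1 0 ((a-1+n:ℝ):ℂ) = (mom a n : ℂ) := by
  rw [jJ, intervalIntegral.integral_of_le (by norm_num), integral_Ioc_eq_integral_Ioo, mom, ← integral_complex_ofReal]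
  exact setIntegral_congr_fun measurableSet_Ioo (fun x hx => mom_F a n x hx.1 hx.2)

lemma mom_rec {a : ℝ} (ha : 0 < a) (n : ℕ) : mom a (n+1) * ((1/2+n)*(2*a+n)) = (a+n)^2 * mom a n := by
  set ν : ℂ := ((2*a-1:ℝ):ℂ) with hν
  set k : ℂ := ((a-1+(n+1:ℕ):ℝ):ℂ) with hk
  have hk0 : 0 < k.re := by rw [hk, Complex.ofReal_re]; push_cast; linarith [(by positivity : (0:ℝ) ≤ n)]
  have h1 := jJ_ibp ν 1 1 0 k hk0
  have h2 := jJ_ibp ν 0 0 1 k hk0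
  have h3 := jJ_x2 ν 0 1 0 (k-1) (by simp; linarith)
  have e1 : k - 1 = ((a-1+n:ℝ):ℂ) := by rw [hk]; push_cast; ring
  simp only [sub_add_cancel, zero_add] at h1 h2 h3
  norm_num at h1 h2 h3
  rw [h3] at h1
  have m1 := mom_jJ a (n+1)
  have m0 := mom_jJ a n
  rw [← hν, ← hk] at m1
  rw [← hν, ← e1] at m0
  rw [m1, m0] at h1
  rw [m1] at h2
  have hkv : k = (a:ℂ) + n := by rw [hk]; push_cast; ring
  have hνv : ν = 2*(a:ℂ)-1 := by rw [hν]; push_cast; ring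
  have : ((mom a (n+1) * ((1/2+n)*(2*a+n)) : ℝ):ℂ) = (((a+n)^2 * mom a n : ℝ) : ℂ) := by
    push_cast
    rw [hkv, hνv] at h1 h2
    linear_combination (2*((a:ℂ)+n) * h1 + h2)/4
  exact_mod_cast this

lemma mom_eq {a : ℝ} (ha : 0 < a) (n : ℕ) : mom a n = mom a 0 * (poch a n ^2 / (poch (1/2) n * poch (2*a) n)) := by
  induction n with
  | zero => simp [poch_zero]
  | succ n ih =>
    have h := mom_rec ha n
    have p1 := poch_pos (show (0:ℝ) < 1/2 by norm_num) n
    have p2 := poch_pos (show (0:ℝ) < 2*a by linarith) n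
    have p3 : (0:ℝ) < 1/2+n := by positivity
    have p4 : (0:ℝ) < 2*a+n := by positivity
    rw [ih] at h
    rw [poch_succ, poch_succ, poch_succ]
    have : mom a (n+1) = (a+n)^2 * (mom a 0 * (poch a n ^2 / (poch (1/2) n * poch (2*a) n))) / ((1/2+n)*(2*a+n)) := by
      rw [← h]; field_simp
    rw [this]; field_simp

lemma cos_mom (n : ℕ) : ∫ φ in Set.Ioo (0:ℝ) π, 1/π * (Real.cos (φ/2)^2)^n = poch (1/2) n / n.factorial := by
  rw [← integral_Ioc_eq_integral_Ioo, ← intervalIntegral.integral_of_le Real.pi_pos.le, intervalIntegral.integral_const_mul]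
  have h1 : ∫ φ in (0:ℝ)..π, (Real.cos (φ/2)^2)^n = 2 * ∫ u in (0:ℝ)..(π/2), Real.cos u ^ (2*n) := by
    have := intervalIntegral.integral_comp_div (a := 0) (b := π) (fun u => Real.cos u ^ (2*n)) (two_ne_zero' ℝ)
    simp only [zero_div, smul_eq_mul] at this
    rw [← this]; simp only [pow_mul]
  rw [h1, EulerSine.integral_cos_pow_eq]
  have : ∀ n : ℕ, poch (1/2) n / n.factorial = ∏ i ∈ Finset.range n, (2 * (i:ℝ) + 1) / (2 * i + 2) := by
    intro n
    induction n with
    | zero => simp [poch_zero]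
    | succ n ih =>
      rw [Finset.prod_range_succ, ← ih, poch_succ, Nat.factorial_succ]
      push_cast; field_simp; ring
  rw [this, integral_sin_pow_even]
  have := Real.pi_pos
  field_simp

lemma lint_affine (F : ℝ → ENNReal) : ∫⁻ x in Set.Ioo (-1:ℝ) 1, F x = 2 * ∫⁻ z in Set.Ioo (0:ℝ) 1, F (1-2*z) := by
  have h := lintegral_image_eq_lintegral_abs_deriv_mul (s := Set.Ioo (0:ℝ) 1) (f := fun z => 1 - 2*z) (f' := fun _ => -2)
    measurableSet_Ioo (fun x _ => by
      have := ((hasDerivAt_id x).const_mul 2).const_sub 1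
      simpa using this.hasDerivWithinAt) (fun x _ y _ h => by simp at h; linarith) F
  have e : (fun z : ℝ => 1 - 2*z) '' Set.Ioo 0 1 = Set.Ioo (-1) 1 := by
    ext x; constructor
    · rintro ⟨z, hz, rfl⟩; constructor <;> linarith [hz.1, hz.2]
    · intro hx; refine ⟨(1-x)/2, ⟨by linarith [hx.2], by linarith [hx.1]⟩, by ring⟩
  rw [e] at h
  rw [h]
  rw [← lintegral_const_mul' _ _ (by norm_num)]
  congr 1; ext z; congr 1; simp

lemma mom_zero {a : ℝ} (ha : 0 < a) (ha2 : a < 1/2) : mom a 0 = 2 * 4^(a-1) * bt a a * Sa a := by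
  have hb := bt_pos ha ha
  have hS : 0 < Sa a := by
    unfold Sa
    have := Real.Gamma_pos_of_pos ha
    have := Real.Gamma_pos_of_pos (show 0 < 1-a by linarith)
    have := Real.Gamma_pos_of_pos (show 0 < 2*a by linarith)
    positivity
  have hn : ∀ᵐ x ∂(volume.restrict (Set.Ioo (-1:ℝ) 1)), 0 ≤ pr (2*a) x * (1-x^2)^(a-1) * (1-x^2)^0 := by
    rw [ae_restrict_iff' measurableSet_Ioo]
    refine Filter.Eventually.of_forall fun x hx => ?_
    have h : 0 < 1 - x^2 := by nlinarith [hx.1, hx.2]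
    have := pr_ge_one (b := 2*a) (by linarith) (by linarith) hx.1 hx.2
    positivity
  have h1 := ofReal_integral_eq_lintegral_ofReal (mom_integrable ha 0) hn
  have hm : 0 ≤ mom a 0 := integral_nonneg_of_ae hn
  change ENNReal.ofReal (mom a 0) = _ at h1
  rw [lint_affine] at h1
  have h2 : (∫⁻ z in Set.Ioo (0:ℝ) 1, ENNReal.ofReal (pr (2*a) (1-2*z) * (1-(1-2*z)^2)^(a-1) * (1-(1-2*z)^2)^0))
     = ENNReal.ofReal (4^(a-1)) * bI a a (fun z => ENNReal.ofReal (fr (2*a) z)) := by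
    rw [← bI_const_mul _ ENNReal.ofReal_ne_top]
    unfold bI
    apply setLIntegral_congr_fun measurableSet_Ioo
    intro z hz
    have h0 := hz.1
    have h1 : 0 < 1 - z := by linarith [hz.2]
    simp only
    rw [← ENNReal.ofReal_mul (by positivity), ← ENNReal.ofReal_mul (by positivity)]
    congr 1
    rw [pr, show (1 - (1-2*z))/2 = z by ring, show 1 - (1-2*z)^2 = 4 * (z*(1-z)) by ring, Real.mul_rpow (by norm_num) (by positivity),
      Real.mul_rpow h0.le h1.le]
    ring
  have h3 := bI_series ha ha (wr (2*a)) (wr_nonneg (by linarith) (by linarith)) (fun z => ENNReal.ofReal (fr (2*a) z))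
    (fun z h0 h1 => fr_ofReal (by linarith) (by linarith) h0.le h1)
  have h4 : ∀ n : ℕ, ENNReal.ofReal (wr (2*a) n * bt (a+n) a) = ENNReal.ofReal (bt a a) * ENNReal.ofReal (poch a n*poch (1-2*a) n/n.factorial^2) := by
    intro n
    rw [← ENNReal.ofReal_mul hb.le, bt_shift ha ha, wr, ← two_mul]
    have := poch_pos (show 0 < 2*a by linarith) n
    congr 1
    field_simp
  rw [h2, h3] at h1
  simp only [h4] at h1
  rw [ENNReal.tsum_mul_left, sum_iii ha ha2] at h1
  change _ = 2 * (_ * (_ * ENNReal.ofReal (Sa a))) at h1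
  rw [← ENNReal.ofReal_mul hb.le, ← ENNReal.ofReal_mul (by positivity), show (2:ENNReal) = ENNReal.ofReal 2 by simp, ← ENNReal.ofReal_mul (by norm_num)] at h1
  rw [ENNReal.ofReal_eq_ofReal_iff hm (by positivity)] at h1
  rw [h1]; ring


noncomputable def Dn (a : ℝ) (N : ℕ) : ℝ := ∑ j ∈ Finset.range (N+1), ((N.choose j : ℝ) * (-1)^j) * (poch a j ^2 / (poch (2*a) j * j.factorial))

lemma phiN (t : ℝ) (ht : 0 ≤ t) (ht1 : t ≤ 1) (N : ℕ) :
    (∫⁻ φ in Set.Ioo (0:ℝ) π, ENNReal.ofReal (1/π) * ENNReal.ofReal ((1-t*Real.cos (φ/2)^2)^N)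
      = ENNReal.ofReal (∑ j ∈ Finset.range (N+1), (((N.choose j : ℝ) * (-1)^j) * (poch (1/2) j / j.factorial)) * t^j))
    ∧ 0 ≤ ∑ j ∈ Finset.range (N+1), (((N.choose j : ℝ) * (-1)^j) * (poch (1/2) j / j.factorial)) * t^j := by
  have e : ∀ φ : ℝ, (1-t*Real.cos (φ/2)^2)^N = ∑ j ∈ Finset.range (N+1), ((N.choose j : ℝ) * (-1)^j * t^j) * (Real.cos (φ/2)^2)^j := by
    intro φ
    rw [binom_neg]
    apply Finset.sum_congr rfl
    intro j _; rw [mul_pow]; ring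
  have e2 : ∑ j ∈ Finset.range (N+1), (((N.choose j : ℝ) * (-1)^j) * (poch (1/2) j / j.factorial)) * t^j
      = ∑ j ∈ Finset.range (N+1), ((N.choose j : ℝ) * (-1)^j * t^j) * (poch (1/2) j / j.factorial) := by
    apply Finset.sum_congr rfl
    intro j _; ring
  rw [e2]
  have h := lint_poly (μ := volume.restrict (Set.Ioo (0:ℝ) π)) (fun _ => 1/π) (fun φ => Real.cos (φ/2)^2)
    (fun j => poch (1/2) j / j.factorial) (fun j => (N.choose j : ℝ) * (-1)^j * t^j) (N+1)
    (fun j => by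
      have : Continuous (fun φ : ℝ => 1/π * (Real.cos (φ/2)^2)^j) := by fun_prop
      exact (this.integrableOn_Icc (a := 0) (b := π)).mono_set Set.Ioo_subset_Icc_self)
    cos_mom (Filter.Eventually.of_forall fun _ => by have := Real.pi_pos; positivity)
    (Filter.Eventually.of_forall fun φ => by
      rw [← e]
      apply pow_nonneg
      nlinarith [Real.cos_sq_le_one (φ/2), sq_nonneg (Real.cos (φ/2))])
  refine ⟨?_, h.2⟩
  rw [← h.1]
  simp only [e]

lemma sideX {a : ℝ} (ha : 0 < a) (ha2 : a < 1/2) (N : ℕ) :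
    (∫⁻ x in Set.Ioo (-1:ℝ) 1, ENNReal.ofReal (pr (2*a) x * (1-x^2)^(a-1)) *
      ENNReal.ofReal (∑ j ∈ Finset.range (N+1), (((N.choose j : ℝ) * (-1)^j) * (poch (1/2) j / j.factorial)) * (1-x^2)^j))
    = ENNReal.ofReal (mom a 0 * Dn a N) := by
  rw [(lint_poly (μ := volume.restrict (Set.Ioo (-1:ℝ) 1)) (fun x => pr (2*a) x * (1-x^2)^(a-1)) (fun x => 1-x^2)
    (mom a) _ (N+1) (mom_integrable ha) (fun j => rfl) ?_ ?_).1]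
  · congr 1
    rw [Dn, Finset.mul_sum]
    apply Finset.sum_congr rfl
    intro j _
    rw [mom_eq ha j]
    have := poch_pos (show (0:ℝ) < 1/2 by norm_num) j
    have := poch_pos (show (0:ℝ) < 2*a by linarith) j
    field_simp
  · rw [ae_restrict_iff' measurableSet_Ioo]
    refine Filter.Eventually.of_forall fun x hx => ?_
    have h : 0 < 1 - x^2 := by nlinarith [hx.1, hx.2]
    have := pr_ge_one (b := 2*a) (by linarith) (by linarith) hx.1 hx.2
    positivity
  · rw [ae_restrict_iff' measurableSet_Ioo]
    refine Filter.Eventually.of_forall fun x hx => ?_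
    exact (phiN (1-x^2) (by nlinarith [hx.1, hx.2]) (by nlinarith) N).2

lemma sideS {a : ℝ} (ha : 0 < a) (ha2 : a < 1/2) (N : ℕ) :
    bI a a (fun σ => bI a (1-a) (fun τ => ENNReal.ofReal ((1-σ*τ)^N))) = ENNReal.ofReal (bt a a * bt a (1-a) * Dn a N) := by
  have hin : ∀ σ : ℝ, 0 < σ → σ < 1 → (bI a (1-a) (fun τ => ENNReal.ofReal ((1-σ*τ)^N))
      = ENNReal.ofReal (∑ j ∈ Finset.range (N+1), ((N.choose j : ℝ) * (-1)^j * bt (a+j) (1-a)) * σ^j)) ∧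
      0 ≤ ∑ j ∈ Finset.range (N+1), ((N.choose j : ℝ) * (-1)^j * bt (a+j) (1-a)) * σ^j := by
    intro σ h0 h1
    have e2 : ∑ j ∈ Finset.range (N+1), ((N.choose j : ℝ) * (-1)^j * bt (a+j) (1-a)) * σ^j
      = ∑ j ∈ Finset.range (N+1), ((N.choose j : ℝ) * (-1)^j * σ^j) * bt (a+j) (1-a) := by
      apply Finset.sum_congr rfl
      intro j _; ring
    have e : ∀ τ : ℝ, (1-σ*τ)^N = ∑ j ∈ Finset.range (N+1), ((N.choose j : ℝ) * (-1)^j * σ^j) * τ^j := by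
      intro φ
      rw [binom_neg]
      apply Finset.sum_congr rfl
      intro j _; rw [mul_pow]; ring
    have h := lint_poly (μ := volume.restrict (Set.Ioo (0:ℝ) 1)) (fun τ => τ^(a-1) * (1-τ)^(1-a-1)) (fun τ => τ)
      (fun j => bt (a+j) (1-a)) (fun j => (N.choose j : ℝ) * (-1)^j * σ^j) (N+1)
      (fun j => (bI_pow_integrable ha (by linarith) j).1) (fun j => (bI_pow_integrable ha (by linarith) j).2)
      (by
        rw [ae_restrict_iff' measurableSet_Ioo]
        refine Filter.Eventually.of_forall fun x hx => ?_
        have h1 := hx.1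
        have h2 : 0 < 1 - x := by linarith [hx.2]
        positivity)
      (by
        rw [ae_restrict_iff' measurableSet_Ioo]
        refine Filter.Eventually.of_forall fun x hx => ?_
        rw [← e]
        apply pow_nonneg
        nlinarith [hx.1, hx.2])
    rw [e2]
    refine ⟨?_, h.2⟩
    rw [← h.1]
    unfold bI
    simp only [e]
  rw [bI_congr (fun σ h0 h1 => (hin σ h0 h1).1), bI_poly ha ha _ _ (fun σ h0 h1 => (hin σ h0 h1).2)]
  congr 1
  rw [Dn, Finset.mul_sum]
  apply Finset.sum_congr rfl
  intro j _
  rw [bt_shift ha ha, bt_shift ha (by linarith), show a + (1-a) = 1 by ring, poch_one, ← two_mul]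
  have := poch_pos (show (0:ℝ) < 2*a by linarith) j
  field_simp

/-- value of B given the product formula -/
lemma LB_value {a : ℝ} (ha : 0 < a) (ha2 : a < 1/2)
    (hprod : ∀ x : ℝ, -1 < x → x < 1 → ENNReal.ofReal (pr (2*a) x * pr (2*a) (-x)) =
      ENNReal.ofReal (1/π) * ∫⁻ φ in Set.Ioo (0:ℝ) π, ENNReal.ofReal (fr (2*a) (1-(1-x^2)*Real.cos (φ/2)^2))) :
    ∫⁻ x in Set.Ioo (-1:ℝ) 1, ENNReal.ofReal (pr (2*a) x ^2 * pr (2*a) (-x) * (1-x^2)^(a-1)) =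
      ENNReal.ofReal (mom a 0 * Sa a ^ 2) := by
  have hb : (0:ℝ) < 2*a := by linarith
  have hb1 : 2*a < 1 := by linarith
  have hwr := fun n => wr_nonneg hb hb1 n
  have hwm : AEMeasurable (fun x => ENNReal.ofReal (pr (2*a) x * (1-x^2)^(a-1))) (volume.restrict (Set.Ioo (-1:ℝ) 1)) := by
    have := (mom_integrable ha 0).1.aemeasurable.ennreal_ofReal
    simpa using this
  have s1 : ∫⁻ x in Set.Ioo (-1:ℝ) 1, ENNReal.ofReal (pr (2*a) x ^2 * pr (2*a) (-x) * (1-x^2)^(a-1)) =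
      ∑' N, ENNReal.ofReal (wr (2*a) N) * ENNReal.ofReal (mom a 0 * Dn a N) := by
    have t1 : ∀ x ∈ Set.Ioo (-1:ℝ) 1, ENNReal.ofReal (pr (2*a) x ^2 * pr (2*a) (-x) * (1-x^2)^(a-1)) =
      ∑' N, ENNReal.ofReal (wr (2*a) N) * (ENNReal.ofReal (pr (2*a) x * (1-x^2)^(a-1)) *
      ENNReal.ofReal (∑ j ∈ Finset.range (N+1), (((N.choose j : ℝ) * (-1)^j) * (poch (1/2) j / j.factorial)) * (1-x^2)^j)) := by
      intro x hx
      have h : 0 < 1 - x^2 := by nlinarith [hx.1, hx.2]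
      have h' : 1 - x^2 ≤ 1 := by nlinarith
      have hp := pr_ge_one (b := 2*a) hb hb1 hx.1 hx.2
      have hq := pr_ge_one (b := 2*a) hb hb1 (x := -x) (by linarith [hx.2]) (by linarith [hx.1])
      rw [show pr (2*a) x ^2 * pr (2*a) (-x) * (1-x^2)^(a-1) = (pr (2*a) x * (1-x^2)^(a-1)) * (pr (2*a) x * pr (2*a) (-x)) by ring,
        ENNReal.ofReal_mul (by positivity), hprod x hx.1 hx.2]
      have t2 : ∀ φ ∈ Set.Ioo (0:ℝ) π, ENNReal.ofReal (fr (2*a) (1-(1-x^2)*Real.cos (φ/2)^2)) =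
          ∑' N, ENNReal.ofReal (wr (2*a) N) * ENNReal.ofReal ((1-(1-x^2)*Real.cos (φ/2)^2)^N) := by
        intro φ hφ
        have hc : 0 < Real.cos (φ/2) := Real.cos_pos_of_mem_Ioo ⟨by linarith [hφ.1, Real.pi_pos], by linarith [hφ.2]⟩
        rw [fr_ofReal hb hb1 (by nlinarith [Real.cos_sq_le_one (φ/2), sq_nonneg (Real.cos (φ/2))]) (by nlinarith [mul_pos h (pow_pos hc 2)])]
        congr 1; ext N
        rw [ENNReal.ofReal_mul (hwr N)]
      rw [setLIntegral_congr_fun measurableSet_Ioo t2, lintegral_tsum (fun N => by apply Measurable.aemeasurable; fun_prop),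
        ← ENNReal.tsum_mul_left, ← ENNReal.tsum_mul_left]
      congr 1; ext N
      rw [lintegral_const_mul' _ _ ENNReal.ofReal_ne_top, ← (phiN (1-x^2) h.le h' N).1, lintegral_const_mul' _ _ ENNReal.ofReal_ne_top]
      ring
    rw [setLIntegral_congr_fun measurableSet_Ioo t1, lintegral_tsum]
    · congr 1; ext N
      rw [lintegral_const_mul' _ _ ENNReal.ofReal_ne_top, sideX ha ha2]
    · intro N
      refine AEMeasurable.const_mul (hwm.mul ?_) _
      apply Measurable.aemeasurable; fun_prop
  have s2 : ENNReal.ofReal (bt a a * bt a (1-a) * Sa a ^ 2) = ∑' N, ENNReal.ofReal (wr (2*a) N) * ENNReal.ofReal (bt a a * bt a (1-a) * Dn a N) := by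
    rw [← bIbI ha ha2]
    have t1 : ∀ σ : ℝ, 0 < σ → σ < 1 → bI a (1-a) (fun τ => ENNReal.ofReal (fr (2*a) (1-σ*τ))) =
        ∑' N, ENNReal.ofReal (wr (2*a) N) * bI a (1-a) (fun τ => ENNReal.ofReal ((1-σ*τ)^N)) := by
      intro σ h0 h1
      have t2 : ∀ τ : ℝ, 0 < τ → τ < 1 → ENNReal.ofReal (fr (2*a) (1-σ*τ)) = ∑' N, ENNReal.ofReal (wr (2*a) N * (1-σ*τ)^N) := by
        intro τ h2 h3
        rw [fr_ofReal hb hb1 (by nlinarith) (by nlinarith [mul_pos h0 h2])]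
      rw [bI_congr t2, bI_tsum _ (fun N => by fun_prop)]
      congr 1; ext N
      rw [← bI_const_mul _ ENNReal.ofReal_ne_top]
      congr 1; ext τ
      rw [ENNReal.ofReal_mul (hwr N)]
    rw [bI_congr t1, bI_tsum]
    · congr 1; ext N
      rw [bI_const_mul _ ENNReal.ofReal_ne_top, sideS ha ha2]
    · intro N
      refine Measurable.const_mul ?_ _
      unfold bI
      have hm : Measurable (fun q : ℝ × ℝ => ENNReal.ofReal (q.2 ^ (a - 1) * (1 - q.2) ^ (1 - a - 1)) * ENNReal.ofReal ((1 - q.1 * q.2) ^ N)) := by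
        fun_prop
      exact hm.lintegral_prod_right'
  have hm0 : 0 < mom a 0 := by
    rw [mom_zero ha ha2, Sa]
    have := Real.Gamma_pos_of_pos ha
    have := Real.Gamma_pos_of_pos (show 0 < 1-a by linarith)
    have := Real.Gamma_pos_of_pos (show 0 < 2*a by linarith)
    have := bt_pos ha ha
    positivity
  have hbb : 0 < bt a a * bt a (1-a) := mul_pos (bt_pos ha ha) (bt_pos ha (by linarith))
  rw [s1]
  have hne : ENNReal.ofReal (bt a a * bt a (1-a)) ≠ 0 := by simp; exact hbb
  apply (ENNReal.mul_right_inj hne ENNReal.ofReal_ne_top).1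
  have e1 : ∀ N, ENNReal.ofReal (mom a 0 * Dn a N) = ENNReal.ofReal (mom a 0) * ENNReal.ofReal (Dn a N) := fun N => ENNReal.ofReal_mul hm0.le
  have e2 : ∀ N, ENNReal.ofReal (bt a a * bt a (1-a) * Dn a N) = ENNReal.ofReal (bt a a * bt a (1-a)) * ENNReal.ofReal (Dn a N) := fun N => ENNReal.ofReal_mul hbb.le
  rw [ENNReal.ofReal_mul hm0.le, mul_left_comm, ← ENNReal.ofReal_mul hbb.le, s2, ← ENNReal.tsum_mul_left, ← ENNReal.tsum_mul_left]
  congr 1; ext N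
  rw [e1, e2]; ring

/-- closed form -/
lemma B_closed {a : ℝ} (ha : 0 < a) (ha2 : a < 1/2) :
    mom a 0 * Sa a ^ 2 = (1/π) * (Real.cos ((2*a-1)*π/2) / 2^(2*a-1))^3 * (Real.Gamma a / Real.Gamma (a+1/2))^4 := by
  have g1 := Real.Gamma_pos_of_pos ha
  have g2 := Real.Gamma_pos_of_pos (show 0 < 1-a by linarith)
  have g3 := Real.Gamma_pos_of_pos (show 0 < 2*a by linarith)
  have g4 := Real.Gamma_pos_of_pos (show 0 < a+1/2 by linarith)
  have hdup := Real.Gamma_mul_Gamma_add_half a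
  have hrefl := Real.Gamma_mul_Gamma_one_sub a
  have hsin : Real.cos ((2*a-1)*π/2) = Real.sin (π*a) := by
    rw [← Real.cos_pi_div_two_sub, ← Real.cos_neg]; congr 1; ring
  have hs : 0 < Real.sin (π*a) := Real.sin_pos_of_pos_of_lt_pi (by positivity) (by nlinarith [Real.pi_pos])
  have hpi := Real.pi_pos
  have hsv : Real.sin (π*a) = π / (Real.Gamma a * Real.Gamma (1-a)) := by rw [hrefl]; field_simp
  have h4 : (4:ℝ)^(a-1) = 2^(2*a-1) / 2 := by
    rw [show (4:ℝ) = 2^(2:ℝ) by norm_num, ← Real.rpow_mul (by norm_num), show 2*(a-1) = (2*a-1) - 1 by ring, Real.rpow_sub_one (by norm_num)]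
  have hP : 0 < (2:ℝ)^(2*a-1) := by positivity
  have hG : Real.Gamma (a+1/2) = Real.Gamma (2*a) * (1/(2:ℝ)^(2*a-1)) * √π / Real.Gamma a := by
    have : (2:ℝ)^(1-2*a) = 1/(2:ℝ)^(2*a-1) := by
      rw [one_div, ← Real.rpow_neg (by norm_num)]; congr 1; ring
    rw [← this, ← hdup]; field_simp
  rw [mom_zero ha ha2, h4, hsin, hsv, hG, bt, Sa, ← two_mul]
  have hsq : √π ^ 4 = π^2 := by
    rw [show (4:ℕ) = 2*2 by rfl, pow_mul, Real.sq_sqrt hpi.le]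
  have hsp : 0 < √π := Real.sqrt_pos.2 hpi
  field_simp
  try rw [hsq]
  try ring


lemma deriv_under {F F' : ℝ → ℝ → ℂ} {T θ : ℝ} (hθ : θ ∈ Set.Ioo (-T) T)
    (hF : ∀ t ∈ Set.Ioo (-T) T, Continuous (F t))
    (hF' : ContinuousOn (Function.uncurry F') (Set.Ioo (-T) T ×ˢ Set.univ))
    (hd : ∀ t ∈ Set.Ioo (-T) T, ∀ φ, HasDerivAt (fun t => F t φ) (F' t φ) t) :
    HasDerivAt (fun t => ∫ φ in (0:ℝ)..π, F t φ) (∫ φ in (0:ℝ)..π, F' θ φ) θ := by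
  obtain ⟨ε, hε, hball⟩ := Metric.nhds_basis_closedBall.mem_iff.1 (isOpen_Ioo.mem_nhds hθ)
  have hK : IsCompact (Metric.closedBall θ ε ×ˢ Set.Icc (0:ℝ) π) := (isCompact_closedBall θ ε).prod isCompact_Icc
  obtain ⟨C, hC⟩ := hK.exists_bound_of_continuousOn (hF'.mono (Set.prod_mono hball (Set.subset_univ _)))
  have hc' : Continuous (F' θ) := by
    rw [← continuousOn_univ]
    have : ContinuousOn (fun φ : ℝ => (θ, φ)) Set.univ := by fun_prop
    exact hF'.comp this (fun φ _ => ⟨hθ, trivial⟩)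
  refine (intervalIntegral.hasDerivAt_integral_of_dominated_loc_of_deriv_le (bound := fun _ => C) (s := Metric.closedBall θ ε)
    (Metric.closedBall_mem_nhds θ hε) ?_ ((hF θ hθ).intervalIntegrable _ _) hc'.aestronglyMeasurable ?_ (by simp) ?_).2
  · filter_upwards [isOpen_Ioo.mem_nhds hθ] with t ht using (hF t ht).aestronglyMeasurable
  · refine Filter.Eventually.of_forall fun φ hφ t ht => ?_
    rw [Set.uIoc_of_le Real.pi_pos.le] at hφ
    exact hC (t, φ) ⟨ht, hφ.1.le, hφ.2⟩
  · refine Filter.Eventually.of_forall fun φ _ t ht => hd t (hball ht) φ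

noncomputable def f1 (ν : ℂ) : ℂ → ℂ := deriv (lf ν)
noncomputable def f2 (ν : ℂ) : ℂ → ℂ := deriv (f1 ν)

lemma lf_diffOn (ν : ℂ) : DifferentiableOn ℂ (lf ν) (Metric.ball 0 1) := by
  intro z hz
  obtain ⟨C, hC1, hC⟩ := lw_bound ‖ν‖
  exact (ps_hasDerivAt (lw ν) C (lw_le (hC ν le_rfl)) z (by simpa using hz)).differentiableAt.differentiableWithinAt

lemma f1_diffOn (ν : ℂ) : DifferentiableOn ℂ (f1 ν) (Metric.ball 0 1) := (lf_diffOn ν).deriv Metric.isOpen_ball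
lemma f2_diffOn (ν : ℂ) : DifferentiableOn ℂ (f2 ν) (Metric.ball 0 1) := (f1_diffOn ν).deriv Metric.isOpen_ball

lemma lf_d (ν z : ℂ) (hz : ‖z‖ < 1) : HasDerivAt (lf ν) (f1 ν z) z :=
  ((lf_diffOn ν).differentiableAt (Metric.isOpen_ball.mem_nhds (by simpa using hz))).hasDerivAt
lemma f1_d (ν z : ℂ) (hz : ‖z‖ < 1) : HasDerivAt (f1 ν) (f2 ν z) z :=
  ((f1_diffOn ν).differentiableAt (Metric.isOpen_ball.mem_nhds (by simpa using hz))).hasDerivAt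

lemma lg_f1 (ν z : ℂ) (hz : ‖z‖ < 1) : lg ν z = z * (1-z) * f1 ν z := by
  by_cases h0 : z = 0
  · subst h0
    simp only [zero_mul]
    unfold lg
    rw [tsum_eq_single 0]
    · simp
    · intro n hn; simp [hn]
  · have h := (lf_hasDerivAt ν z hz h0).unique (lf_d ν z hz)
    have h1 : 1 - z ≠ 0 := by
      intro h; have : z = 1 := by linear_combination -h
      rw [this] at hz; simp at hz
    rw [← h]; field_simp

lemma lf_ode (ν z : ℂ) (hz : ‖z‖ < 1) : z * (1-z) * f2 ν z + (1-2*z) * f1 ν z = -(ν*(ν+1)) * lf ν z := by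
  have h1 := lg_hasDerivAt ν z hz
  have h2 : HasDerivAt (fun z => z*(1-z)*f1 ν z) (-(ν*(ν+1)) * lf ν z) z := by
    refine h1.congr_of_eventuallyEq ?_
    have : Metric.ball (0:ℂ) 1 ∈ nhds z := Metric.isOpen_ball.mem_nhds (by simpa using hz)
    filter_upwards [this] with w hw
    exact (lg_f1 ν w (by simpa using hw)).symm
  have h3 := ((hasDerivAt_id z).mul ((hasDerivAt_id z).const_sub 1)).mul (f1_d ν z hz)
  have := h3.unique h2
  simp at this
  linear_combination this

noncomputable def Zf (y s θ φ : ℝ) : ℝ := (1 - (Real.cos θ * y + Real.sin θ * s * Real.cos φ))/2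
noncomputable def Zt (y s θ φ : ℝ) : ℝ := (Real.sin θ * y - Real.cos θ * s * Real.cos φ)/2
noncomputable def NN (ν : ℂ) (y s θ : ℝ) : ℂ := ∫ φ in (0:ℝ)..π, lf ν (Zf y s θ φ : ℂ)

lemma Zf_d (y s θ φ : ℝ) : HasDerivAt (fun θ => Zf y s θ φ) (Zt y s θ φ) θ := by
  unfold Zf Zt
  have := ((((Real.hasDerivAt_cos θ).mul_const y).add (((Real.hasDerivAt_sin θ).mul_const s).mul_const (Real.cos φ))).const_sub 1).div_const 2
  refine this.congr_deriv ?_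
  ring
lemma Zt_d (y s θ φ : ℝ) : HasDerivAt (fun θ => Zt y s θ φ) (1/2 - Zf y s θ φ) θ := by
  unfold Zf Zt
  have := ((((Real.hasDerivAt_sin θ).mul_const y).sub (((Real.hasDerivAt_cos θ).mul_const s).mul_const (Real.cos φ)))).div_const 2
  refine this.congr_deriv ?_
  ring
lemma Zf_dφ (y s θ φ : ℝ) : HasDerivAt (fun φ => Zf y s θ φ) (Real.sin θ * s * Real.sin φ / 2) φ := by
  unfold Zf
  have := ((((Real.hasDerivAt_cos φ).const_mul (Real.sin θ * s)).const_add (Real.cos θ * y)).const_sub 1).div_const 2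
  refine this.congr_deriv ?_
  ring

lemma N_lemma (ν : ℂ) (y s T : ℝ) (hys : y^2 + s^2 = 1) (hZ : ∀ θ ∈ Set.Ioo (-T) T, ∀ φ, |Zf y s θ φ| < 1) :
    ∃ N1 N2 : ℝ → ℂ, (∀ θ ∈ Set.Ioo (-T) T, HasDerivAt (NN ν y s) (N1 θ) θ ∧ HasDerivAt N1 (N2 θ) θ ∧
      (Real.sin θ : ℂ) * (N2 θ + ν*(ν+1) * NN ν y s θ) + Real.cos θ * N1 θ = 0) ∧ N1 0 = 0 := by
  have hn : ∀ θ ∈ Set.Ioo (-T) T, ∀ φ, ‖(Zf y s θ φ : ℂ)‖ < 1 := fun θ hθ φ => by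
    rw [Complex.norm_real]; exact hZ θ hθ φ
  have hZc : Continuous (fun q : ℝ × ℝ => (Zf y s q.1 q.2 : ℂ)) := by unfold Zf; fun_prop
  have hZtc : Continuous (fun q : ℝ × ℝ => (Zt y s q.1 q.2 : ℂ)) := by unfold Zt; fun_prop
  have hcomp : ∀ g : ℂ → ℂ, DifferentiableOn ℂ g (Metric.ball 0 1) →
      ContinuousOn (fun q : ℝ × ℝ => g (Zf y s q.1 q.2 : ℂ)) (Set.Ioo (-T) T ×ˢ Set.univ) := by
    intro g hg
    exact hg.continuousOn.comp hZc.continuousOn (fun q hq => by simpa using hn q.1 hq.1 q.2)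
  have hsec : ∀ G : ℝ × ℝ → ℂ, ContinuousOn G (Set.Ioo (-T) T ×ˢ Set.univ) → ∀ θ ∈ Set.Ioo (-T) T, Continuous (fun φ => G (θ, φ)) := by
    intro G hG θ hθ
    rw [← continuousOn_univ]
    have : ContinuousOn (fun φ : ℝ => (θ, φ)) Set.univ := by fun_prop
    exact hG.comp this (fun φ _ => ⟨hθ, trivial⟩)
  have c0 := hcomp _ (lf_diffOn ν)
  have c1 := hcomp _ (f1_diffOn ν)
  have c2 := hcomp _ (f2_diffOn ν)
  set F1 : ℝ → ℝ → ℂ := fun θ φ => f1 ν (Zf y s θ φ) * Zt y s θ φ with hF1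
  set F2 : ℝ → ℝ → ℂ := fun θ φ => f2 ν (Zf y s θ φ) * Zt y s θ φ * Zt y s θ φ + f1 ν (Zf y s θ φ) * ((1/2 - Zf y s θ φ : ℝ):ℂ) with hF2
  have cF1 : ContinuousOn (Function.uncurry F1) (Set.Ioo (-T) T ×ˢ Set.univ) := c1.mul hZtc.continuousOn
  have cF2 : ContinuousOn (Function.uncurry F2) (Set.Ioo (-T) T ×ˢ Set.univ) := by
    refine ((c2.mul hZtc.continuousOn).mul hZtc.continuousOn).add (c1.mul ?_)
    have : Continuous (fun q : ℝ × ℝ => ((1/2 - Zf y s q.1 q.2 : ℝ):ℂ)) := by unfold Zf; fun_prop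
    exact this.continuousOn
  have d0 : ∀ t ∈ Set.Ioo (-T) T, ∀ φ, HasDerivAt (fun t => lf ν (Zf y s t φ : ℂ)) (F1 t φ) t := by
    intro t ht φ
    exact (lf_d ν _ (hn t ht φ)).comp t (Zf_d y s t φ).ofReal_comp
  have d1 : ∀ t ∈ Set.Ioo (-T) T, ∀ φ, HasDerivAt (fun t => F1 t φ) (F2 t φ) t := by
    intro t ht φ
    have h1 := (f1_d ν _ (hn t ht φ)).comp t (Zf_d y s t φ).ofReal_comp
    exact h1.mul (Zt_d y s t φ).ofReal_comp
  refine ⟨fun θ => ∫ φ in (0:ℝ)..π, F1 θ φ, fun θ => ∫ φ in (0:ℝ)..π, F2 θ φ, ?_, ?_⟩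
  · intro θ hθ
    refine ⟨?_, ?_, ?_⟩
    · exact deriv_under hθ (fun t ht => hsec _ c0 t ht) cF1 d0
    · exact deriv_under hθ (fun t ht => hsec _ cF1 t ht) cF2 d1
    · have i0 : IntervalIntegrable (fun φ => lf ν (Zf y s θ φ : ℂ)) volume 0 π := (hsec _ c0 θ hθ).intervalIntegrable _ _
      have i1 : IntervalIntegrable (F1 θ) volume 0 π := (hsec _ cF1 θ hθ).intervalIntegrable _ _
      have i2 : IntervalIntegrable (F2 θ) volume 0 π := (hsec _ cF2 θ hθ).intervalIntegrable _ _
      have hcomb : (Real.sin θ : ℂ) * ((∫ φ in (0:ℝ)..π, F2 θ φ) + ν*(ν+1) * NN ν y s θ) + Real.cos θ * (∫ φ in (0:ℝ)..π, F1 θ φ)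
          = ∫ φ in (0:ℝ)..π, ((Real.sin θ : ℂ) * (F2 θ φ + ν*(ν+1) * lf ν (Zf y s θ φ : ℂ)) + Real.cos θ * F1 θ φ) := by
        unfold NN
        rw [intervalIntegral.integral_add (((i2.add (i0.const_mul _))).const_mul _) (i1.const_mul _), intervalIntegral.integral_const_mul,
          intervalIntegral.integral_add i2 (i0.const_mul _), intervalIntegral.integral_const_mul, intervalIntegral.integral_const_mul]
      rw [hcomb]
      have hder : ∀ φ : ℝ, HasDerivAt (fun φ : ℝ => ((-(s * Real.sin φ / 2) : ℝ):ℂ) * f1 ν (Zf y s θ φ : ℂ))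
          ((Real.sin θ : ℂ) * (F2 θ φ + ν*(ν+1) * lf ν (Zf y s θ φ : ℂ)) + Real.cos θ * F1 θ φ) φ := by
        intro φ
        have h1 := (f1_d ν _ (hn θ hθ φ)).comp φ (Zf_dφ y s θ φ).ofReal_comp
        have h2 : HasDerivAt (fun φ : ℝ => -(s * Real.sin φ / 2)) (-(s * Real.cos φ / 2)) φ :=
          (((Real.hasDerivAt_sin φ).const_mul s).div_const 2).neg
        have h3 := h2.ofReal_comp.mul h1
        refine h3.congr_deriv ?_
        have ode := lf_ode ν _ (hn θ hθ φ)
        have e1 : ((Zt y s θ φ:ℝ):ℂ)^2 = (Zf y s θ φ:ℂ) * (1 - Zf y s θ φ) - (s:ℂ)^2 * (Real.sin φ : ℂ)^2/4 := by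
          have : (Zt y s θ φ)^2 = Zf y s θ φ * (1 - Zf y s θ φ) - s^2 * Real.sin φ^2/4 := by
            unfold Zt Zf
            have a1 := Real.sin_sq_add_cos_sq θ
            have a2 := Real.sin_sq_add_cos_sq φ
            linear_combination (1/4)*(y^2+s^2*Real.cos φ^2)*a1 + (1/4)*s^2*a2 + (1/4)*hys
          exact_mod_cast this
        have e2 : (Real.sin θ:ℂ) * (1 - 2*Zf y s θ φ) - 2 * Real.cos θ * Zt y s θ φ = s * Real.cos φ := by
          have : Real.sin θ * (1 - 2*Zf y s θ φ) - 2 * Real.cos θ * Zt y s θ φ = s * Real.cos φ := by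
            unfold Zt Zf
            have a1 := Real.sin_sq_add_cos_sq θ
            linear_combination (s*Real.cos φ) * a1
          exact_mod_cast this
        simp only [hF1, hF2, Function.comp]
        push_cast
        set f0v := lf ν (Zf y s θ φ : ℂ)
        set f1v := f1 ν (Zf y s θ φ : ℂ)
        set f2v := f2 ν (Zf y s θ φ : ℂ)
        set z := (Zf y s θ φ : ℂ)
        set zt := (Zt y s θ φ : ℂ)
        push_cast at e1 e2
        linear_combination (-Complex.sin θ) * ode - Complex.sin θ * f2v * e1 + f1v/2 * e2
      rw [intervalIntegral.integral_eq_sub_of_hasDerivAt (fun φ _ => hder φ)]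
      · simp
      · exact ((i2.add (i0.const_mul _)).const_mul _).add (i1.const_mul _)
  · simp only [hF1, Zf, Zt, Real.cos_zero, Real.sin_zero]
    simp only [zero_mul, add_zero, one_mul, zero_sub]
    rw [intervalIntegral.integral_const_mul, intervalIntegral.integral_ofReal]
    simp

lemma Zf_bound {y s θ φ θ₂ : ℝ} (hy : y = Real.cos θ₂) (hs : s = Real.sin θ₂) (h2 : 0 ≤ θ₂)
    (hθ : θ ∈ Set.Ioo (-(π - θ₂)) (π - θ₂)) : |Zf y s θ φ| < 1 := by
  have hs0 : 0 ≤ s := by rw [hs]; exact Real.sin_nonneg_of_nonneg_of_le_pi h2 (by linarith [hθ.1, hθ.2])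
  have key : ∀ t : ℝ, 0 ≤ t → t < π - θ₂ → -1 < Real.cos t * y - Real.sin t * s := by
    intro t h0 h1
    rw [hy, hs, ← Real.cos_add]
    rw [← Real.cos_pi]
    exact Real.cos_lt_cos_of_nonneg_of_le_pi (by linarith) le_rfl (by linarith)
  have hsin : |Real.sin θ| = Real.sin |θ| := by
    rw [Real.abs_sin_eq_sin_abs_of_abs_le_pi]
    rw [abs_le]; constructor <;> linarith [hθ.1, hθ.2]
  have h3 := key |θ| (abs_nonneg _) (abs_lt.2 hθ)
  rw [Real.cos_abs, ← hsin] at h3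
  have h4 : |Real.sin θ * s * Real.cos φ| ≤ |Real.sin θ| * s := by
    rw [abs_mul, abs_mul, abs_of_nonneg hs0]
    exact mul_le_of_le_one_right (by positivity) (Real.abs_cos_le_one φ)
  have h5 := abs_le.1 h4
  have h6 : Real.cos θ * y + |Real.sin θ| * s ≤ 1 := by
    have : y^2+s^2 = 1 := by rw [hy, hs]; exact Real.cos_sq_add_sin_sq θ₂
    nlinarith [sq_nonneg (Real.cos θ - y), sq_nonneg (|Real.sin θ| - s), sq_abs (Real.sin θ), Real.sin_sq_add_cos_sq θ]
  rw [abs_lt]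
  unfold Zf
  constructor <;> linarith [h5.1, h5.2]


lemma NN_one (ν : ℂ) (θ : ℝ) : NN ν 1 0 θ = π * lf ν (((1 - Real.cos θ)/2 : ℝ):ℂ) := by
  unfold NN Zf; simp

lemma NN_zero (ν : ℂ) (y s : ℝ) : NN ν y s 0 = π * lf ν (((1 - y)/2 : ℝ):ℂ) := by
  unfold NN Zf; simp

lemma lf_at_zero (ν : ℂ) : lf ν 0 = 1 := by
  unfold lf
  rw [tsum_eq_single 0]
  · simp [lw_zero]
  · intro n hn; simp [hn]

lemma NN_prod {b θ₂ : ℝ} (hb : 0 < b) (hb1 : b < 1) (h2 : 0 < θ₂) (θ : ℝ) (hθ0 : 0 ≤ θ) (hθ : θ < π - θ₂) :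
    NN ((b-1:ℝ):ℂ) (Real.cos θ₂) (Real.sin θ₂) θ = π * pr b (Real.cos θ₂) * pr b (Real.cos θ) := by
  set ν := ((b-1:ℝ):ℂ) with hν
  set y := Real.cos θ₂ with hy
  set s := Real.sin θ₂ with hs
  set T := π - θ₂ with hT
  obtain ⟨M1, M2, hM, hM0⟩ := N_lemma ν y s T (by rw [hy, hs]; exact Real.cos_sq_add_sin_sq θ₂) (fun θ hθ φ => Zf_bound hy hs h2.le hθ)
  obtain ⟨Q1, Q2, hQ', hQ0⟩ := N_lemma ν 1 0 π (by norm_num) (fun θ hθ φ => Zf_bound (θ₂ := 0) (by simp) (by simp) le_rfl (by simpa using hθ))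
  have hsub : ∀ θ ∈ Set.Ioo (-T) T, θ ∈ Set.Ioo (-π) π := fun θ h => ⟨by linarith [h.1], by linarith [h.2]⟩
  have hQ := fun θ h => hQ' θ (hsub θ h)
  have hQne : ∀ θ ∈ Set.Ioo (-T) T, NN ν 1 0 θ ≠ 0 := by
    intro θ h
    rw [NN_one, hν, lf_fr]
    have hc : -1 < Real.cos θ := by
      rw [← Real.cos_abs, ← Real.cos_pi]
      have := hsub θ h
      exact Real.cos_lt_cos_of_nonneg_of_le_pi (abs_nonneg _) le_rfl (abs_lt.2 this)
    have := fr_ge_one (Z := (1 - Real.cos θ)/2) hb hb1 (by linarith [Real.cos_le_one θ]) (by linarith)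
    have hpi := Real.pi_pos
    exact_mod_cast (by positivity : π * fr b ((1 - Real.cos θ)/2) ≠ 0)
  have hI : IsPreconnected (Set.Ioo (-T) T) := isPreconnected_Ioo
  have h0 : (0:ℝ) ∈ Set.Ioo (-T) T := ⟨by linarith, by linarith⟩
  have hθ' : θ ∈ Set.Ioo (-T) T := ⟨by linarith, hθ⟩
  set W : ℝ → ℂ := fun t => (Real.sin t : ℂ) * (M1 t * NN ν 1 0 t - NN ν y s t * Q1 t) with hW
  have dW : ∀ t ∈ Set.Ioo (-T) T, HasDerivAt W 0 t := by
    intro t ht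
    obtain ⟨a1, a2, a3⟩ := hM t ht
    obtain ⟨b1, b2, b3⟩ := hQ t ht
    have := (Real.hasDerivAt_sin t).ofReal_comp.mul ((a2.mul b1).sub (a1.mul b2))
    refine this.congr_deriv ?_
    simp only [Pi.sub_apply, Pi.mul_apply]
    linear_combination a3 * NN ν 1 0 t - b3 * NN ν y s t
  have W0 : ∀ t ∈ Set.Ioo (-T) T, W t = 0 := by
    intro t ht
    have := isOpen_Ioo.is_const_of_deriv_eq_zero hI (f := W) (fun t ht => (dW t ht).differentiableAt.differentiableWithinAt)
      (fun t ht => (dW t ht).deriv) ht h0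
    rw [this, hW]; simp
  have V0 : ∀ t ∈ Set.Ioo (-T) T, M1 t * NN ν 1 0 t - NN ν y s t * Q1 t = 0 := by
    intro t ht
    by_cases h : t = 0
    · subst h; rw [hM0, hQ0]; simp
    · have := W0 t ht
      rw [hW] at this
      rcases mul_eq_zero.1 this with h1 | h1
      · exfalso
        have h1 : Real.sin t = 0 := by exact_mod_cast h1
        have := hsub t ht
        rw [Real.sin_eq_zero_iff_of_lt_of_lt this.1 this.2] at h1
        exact h h1
      · exact h1
  have dR : ∀ t ∈ Set.Ioo (-T) T, HasDerivAt (fun t => NN ν y s t / NN ν 1 0 t) 0 t := by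
    intro t ht
    refine ((hM t ht).1.div (hQ t ht).1 (hQne t ht)).congr_deriv ?_
    rw [V0 t ht, zero_div]
  have := isOpen_Ioo.is_const_of_deriv_eq_zero hI (fun t ht => (dR t ht).differentiableAt.differentiableWithinAt)
      (fun t ht => (dR t ht).deriv) hθ' h0
  rw [div_eq_div_iff (hQne θ hθ') (hQne 0 h0), NN_zero, NN_zero, NN_one] at this
  simp only [sub_self, zero_div, Complex.ofReal_zero, lf_at_zero, mul_one] at this
  have hpi : (π:ℂ) ≠ 0 := by exact_mod_cast Real.pi_pos.ne'
  rw [hν, lf_fr, lf_fr, ← hν] at this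
  unfold pr
  apply mul_right_cancel₀ hpi
  rw [this]; ring

lemma hprod {b x : ℝ} (hb : 0 < b) (hb1 : b < 1) (h1 : -1 < x) (h2 : x < 1) :
    ENNReal.ofReal (pr b x * pr b (-x)) =
      ENNReal.ofReal (1/π) * ∫⁻ φ in Set.Ioo (0:ℝ) π, ENNReal.ofReal (fr b (1-(1-x^2)*Real.cos (φ/2)^2)) := by
  set ν := ((b-1:ℝ):ℂ) with hν
  set θ₂ := Real.arccos x with hθ₂
  have hpi := Real.pi_pos
  have hx : Real.cos θ₂ = x := Real.cos_arccos h1.le h2.le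
  have t0 : 0 < θ₂ := Real.arccos_pos.2 h2
  have t1 : θ₂ < π := Real.arccos_lt_pi.2 h1
  set s := Real.sin θ₂ with hs
  have hs0 : 0 < s := Real.sin_pos_of_pos_of_lt_pi t0 t1
  have hs2 : s^2 = 1 - x^2 := by rw [hs, ← hx, Real.sin_sq]
  set T := π - θ₂ with hT
  have hT0 : 0 < T := by linarith
  have hcT : Real.cos T = -x := by rw [hT, Real.cos_pi_sub, hx]
  have hsT : Real.sin T = s := by rw [hT, Real.sin_pi_sub]
  obtain ⟨C, hC1, hC⟩ := lf_bound ‖ν‖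
  set c := s^2/(2*π^2) with hc
  have hc0 : 0 < c := by positivity
  set bd : ℝ → ℝ := fun φ => C * (1 + 1/(1/4)) * (c^(-(1/4):ℝ) * (π - φ)^(-(1/2):ℝ)) with hbd
  have hbdi : IntegrableOn bd (Set.Ioo 0 π) := by
    have : IntervalIntegrable (fun φ : ℝ => (π - φ)^(-(1/2):ℝ)) volume 0 π := by
      have h := (intervalIntegral.intervalIntegrable_rpow' (r := -(1/2)) (by norm_num) (a := 0) (b := π)).comp_sub_left π
      simpa using h.symm
    rw [intervalIntegrable_iff_integrableOn_Ioo_of_le hpi.le] at this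
    exact (this.const_mul _).const_mul _
  -- lower bound for 1 - Z
  have hlow : ∀ φ ∈ Set.Ioo (0:ℝ) π, ∀ θ : ℝ, 0 ≤ θ → θ ≤ T → s/2 ≤ Real.sin θ →
      c * (π - φ)^2 ≤ 1 - Zf x s θ φ ∧ 0 ≤ Zf x s θ φ := by
    intro φ hφ θ hθ0 hθT hsθ
    have e1 : 1 + Real.cos φ ≥ 2/π^2 * (π - φ)^2 := by
      have := Real.cos_le_one_sub_mul_cos_sq (x := π - φ) (by rw [abs_le]; constructor <;> linarith [hφ.1, hφ.2])
      rw [Real.cos_pi_sub] at this; linarith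
    have e2 : -1 ≤ Real.cos θ * x - Real.sin θ * s := by
      have := Real.neg_one_le_cos (θ + θ₂)
      rw [Real.cos_add, hx] at this; exact this
    have e3 : Real.cos θ * x + Real.sin θ * s ≤ 1 := by
      have := Real.cos_le_one (θ - θ₂)
      rw [Real.cos_sub, hx] at this; exact this
    have e4 : 0 ≤ 1 + Real.cos φ := by linarith [Real.neg_one_le_cos φ]
    have e5 : s/2 * s * (1 + Real.cos φ) ≤ Real.sin θ * s * (1 + Real.cos φ) := by gcongr
    have e6 : s/2 * s * (2/π^2 * (π - φ)^2) ≤ s/2 * s * (1 + Real.cos φ) := by gcongr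
    have e7 : s/2 * s * (2/π^2 * (π - φ)^2) = 2 * (c * (π - φ)^2) := by rw [hc]; field_simp
    have e8 : Real.sin θ * s * Real.cos φ ≤ Real.sin θ * s := by
      have : 0 ≤ Real.sin θ * s := by nlinarith
      exact mul_le_of_le_one_right this (Real.cos_le_one φ)
    unfold Zf
    constructor <;> nlinarith
  have hbound : ∀ φ ∈ Set.Ioo (0:ℝ) π, ∀ θ : ℝ, 0 ≤ θ → θ ≤ T → s/2 ≤ Real.sin θ → ‖lf ν (Zf x s θ φ : ℂ)‖ ≤ bd φ := by
    intro φ hφ θ hθ0 hθT hsθ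
    obtain ⟨l1, l2⟩ := hlow φ hφ θ hθ0 hθT hsθ
    have hp : 0 < π - φ := by linarith [hφ.2]
    have hp2 : 0 < c * (π - φ)^2 := by positivity
    refine (hC ν le_rfl (1/4) (by norm_num) _ l2 (by linarith)).trans ?_
    rw [hbd]
    simp only
    have : (1 - Zf x s θ φ)^(-(1/4):ℝ) ≤ c^(-(1/4):ℝ) * (π - φ)^(-(1/2):ℝ) := by
      refine (Real.rpow_le_rpow_of_nonpos hp2 l1 (by norm_num)).trans ?_
      rw [Real.mul_rpow hc0.le (by positivity), ← Real.rpow_natCast (π - φ) 2, ← Real.rpow_mul hp.le]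
      norm_num
    gcongr
  have hZT : ∀ φ, Zf x s T φ = 1 - (1-x^2)*Real.cos (φ/2)^2 := by
    intro φ
    unfold Zf
    rw [hcT, hsT, ← hs2, Real.cos_sq, mul_div_cancel₀ φ (two_ne_zero' ℝ)]
    linear_combination (1/2) * hs2
  have hsinT : ∀ᶠ θ in nhdsWithin T (Set.Iio T), 0 ≤ θ ∧ θ < T ∧ s/2 ≤ Real.sin θ := by
    have : ∀ᶠ θ in nhds T, s/2 < Real.sin θ := Real.continuous_sin.continuousAt.eventually_const_lt (by rw [hsT]; linarith)
    filter_upwards [this.filter_mono nhdsWithin_le_nhds, (lt_mem_nhds hT0).filter_mono nhdsWithin_le_nhds, self_mem_nhdsWithin] with θ q1 q2 q3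
    exact ⟨q2.le, q3, q1.le⟩
  have hZcont : ∀ φ, Continuous (fun θ => Zf x s θ φ) := by intro φ; unfold Zf; fun_prop
  have hZcontφ : ∀ θ, Continuous (fun φ => Zf x s θ φ) := by intro φ; unfold Zf; fun_prop
  have hcomp : ∀ θ, (∀ φ ∈ Set.Ioo (0:ℝ) π, |Zf x s θ φ| < 1) → ContinuousOn (fun φ => lf ν (Zf x s θ φ : ℂ)) (Set.Ioo 0 π) := by
    intro θ h
    refine (lf_diffOn ν).continuousOn.comp (Complex.continuous_ofReal.comp (hZcontφ θ)).continuousOn ?_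
    intro φ hφ
    simp only [Metric.mem_ball, dist_zero_right, Function.comp, Complex.norm_real]
    exact h φ hφ
  have habs : ∀ φ ∈ Set.Ioo (0:ℝ) π, ∀ θ : ℝ, 0 ≤ θ → θ ≤ T → s/2 ≤ Real.sin θ → |Zf x s θ φ| < 1 := by
    intro φ hφ θ q1 q2 q3
    obtain ⟨l1, l2⟩ := hlow φ hφ θ q1 q2 q3
    rw [abs_of_nonneg l2]
    have hp : 0 < π - φ := by linarith [hφ.2]
    have hp2 : 0 < c * (π - φ)^2 := by positivity
    linarith
  have hlim1 : Filter.Tendsto (fun θ => ∫ φ in Set.Ioo (0:ℝ) π, lf ν (Zf x s θ φ : ℂ)) (nhdsWithin T (Set.Iio T))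
      (nhds (∫ φ in Set.Ioo (0:ℝ) π, lf ν (Zf x s T φ : ℂ))) := by
    refine tendsto_integral_filter_of_dominated_convergence bd ?_ ?_ hbdi ?_
    · filter_upwards [hsinT] with θ q
      exact (hcomp θ (fun φ hφ => habs φ hφ θ q.1 q.2.1.le q.2.2)).aestronglyMeasurable measurableSet_Ioo
    · filter_upwards [hsinT] with θ q
      rw [ae_restrict_iff' measurableSet_Ioo]
      exact Filter.Eventually.of_forall fun φ hφ => hbound φ hφ θ q.1 q.2.1.le q.2.2
    · rw [ae_restrict_iff' measurableSet_Ioo]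
      refine Filter.Eventually.of_forall fun φ hφ => ?_
      have hz : ‖(Zf x s T φ : ℂ)‖ < 1 := by
        rw [Complex.norm_real]; exact habs φ hφ T hT0.le le_rfl (by rw [hsT]; linarith)
      exact ((lf_d ν _ hz).continuousAt.tendsto.comp ((Complex.continuous_ofReal.comp (hZcont φ)).tendsto T)).mono_left nhdsWithin_le_nhds
  have hlim2 : Filter.Tendsto (fun θ => ∫ φ in Set.Ioo (0:ℝ) π, lf ν (Zf x s θ φ : ℂ)) (nhdsWithin T (Set.Iio T))
      (nhds (π * pr b x * pr b (-x))) := by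
    have hp : Filter.Tendsto (fun θ => (π:ℂ) * pr b x * pr b (Real.cos θ)) (nhdsWithin T (Set.Iio T)) (nhds (π * pr b x * pr b (-x))) := by
      have h3 := (pP_hasDerivAt ν (-x) (by linarith) (by linarith)).continuousAt
      have h4 : Filter.Tendsto (fun θ => pP ν (Real.cos θ)) (nhds T) (nhds (pP ν (-x))) := by
        rw [← hcT] at h3 ⊢
        exact h3.tendsto.comp (Real.continuous_cos.tendsto T)
      simp only [hν, pP_pr] at h4
      exact (h4.const_mul _).mono_left nhdsWithin_le_nhds
    refine hp.congr' ?_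
    filter_upwards [hsinT] with θ q
    have := NN_prod hb hb1 t0 θ q.1 q.2.1
    rw [hx] at this
    rw [← this, NN, intervalIntegral.integral_of_le hpi.le, integral_Ioc_eq_integral_Ioo]
  have heq := tendsto_nhds_unique hlim1 hlim2
  have hbT : ∀ φ ∈ Set.Ioo (0:ℝ) π, 0 ≤ Zf x s T φ ∧ Zf x s T φ < 1 := by
    intro φ hφ
    have h3 := habs φ hφ T hT0.le le_rfl (by rw [hsT]; linarith)
    exact ⟨(hlow φ hφ T hT0.le le_rfl (by rw [hsT]; linarith)).2, (abs_lt.1 h3).2⟩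
  have hintC : IntegrableOn (fun φ => lf ν (Zf x s T φ : ℂ)) (Set.Ioo 0 π) := by
    refine Integrable.mono' hbdi ((hcomp T (fun φ hφ => habs φ hφ T hT0.le le_rfl (by rw [hsT]; linarith))).aestronglyMeasurable measurableSet_Ioo) ?_
    rw [ae_restrict_iff' measurableSet_Ioo]
    exact Filter.Eventually.of_forall fun φ hφ => hbound φ hφ T hT0.le le_rfl (by rw [hsT]; linarith)
  simp only [hν, lf_fr] at heq hintC
  have hint : IntegrableOn (fun φ => fr b (Zf x s T φ)) (Set.Ioo 0 π) := by
    have := hintC.re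
    simp only [RCLike.re_to_complex, Complex.ofReal_re] at this
    exact this
  rw [integral_complex_ofReal] at heq
  have heq' : ∫ φ in Set.Ioo (0:ℝ) π, fr b (Zf x s T φ) = π * pr b x * pr b (-x) := by exact_mod_cast heq
  have hfin := ofReal_integral_eq_lintegral_ofReal hint (by
    rw [Filter.EventuallyLE, ae_restrict_iff' measurableSet_Ioo]
    refine Filter.Eventually.of_forall fun φ hφ => ?_
    have := hbT φ hφ
    exact (zero_le_one.trans (fr_ge_one hb hb1 this.1 this.2)))
  simp only [hZT] at hfin heq'
  rw [← hfin, ← ENNReal.ofReal_mul (by positivity), heq']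
  congr 1
  field_simp


noncomputable def uh (b x t : ℝ) : ℝ := (1-t^2)^(b-1) * |x-t|^(-b)
noncomputable def kc (b : ℝ) : ℝ := 2^(b-1) * (Real.Gamma b * Real.Gamma (1-b))

lemma kc_pos {b : ℝ} (hb : 0 < b) (hb1 : b < 1) : 0 < kc b := by
  have g1 := Real.Gamma_pos_of_pos hb
  have g2 := Real.Gamma_pos_of_pos (show 0 < 1-b by linarith)
  unfold kc; positivity

lemma uh_meas (b x : ℝ) : Measurable (uh b x) := by unfold uh; fun_prop

lemma uh_nonneg (b x t : ℝ) (h1 : -1 < t) (h2 : t < 1) : 0 ≤ uh b x t := by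
  have : 0 < 1 - t^2 := by nlinarith
  unfold uh; positivity

lemma E_right {b x : ℝ} (hb : 0 < b) (hb1 : b < 1) (h1 : -1 < x) (h2 : x < 1) :
    ∫⁻ t in Set.Ioo x 1, ENNReal.ofReal (uh b x t) = ENNReal.ofReal (kc b * pr b x) := by
  have h := lintegral_image_eq_lintegral_abs_deriv_mul (s := Set.Ioo (0:ℝ) 1) (f := fun z => 1 - (1-x)*z) (f' := fun _ => -(1-x))
    measurableSet_Ioo (fun y _ => by
      have := ((hasDerivAt_id y).const_mul (1-x)).const_sub 1
      simpa using this.hasDerivWithinAt) (fun y _ z _ h => by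
        have : (1-x)*y = (1-x)*z := by simpa using h
        exact mul_left_cancel₀ (by linarith) this) (fun t => ENNReal.ofReal (uh b x t))
  have him : (fun z => 1 - (1-x)*z) '' Set.Ioo (0:ℝ) 1 = Set.Ioo x 1 := by
    ext t; constructor
    · rintro ⟨z, hz, rfl⟩
      constructor <;> simp only <;> nlinarith [hz.1, hz.2]
    · intro ht
      have : 1 - x ≠ 0 := by linarith
      refine ⟨(1-t)/(1-x), ⟨div_pos (by linarith [ht.2]) (by linarith), ?_⟩, by field_simp; ring⟩
      rw [div_lt_one (by linarith)]; linarith [ht.1]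
  rw [him] at h
  rw [h]
  have e := euler_lintegral (b := 1-b) (Z := (1-x)/2) (by linarith) (by linarith) (by linarith) (by linarith)
  rw [fr_symm] at e
  simp only [sub_sub_cancel] at e
  have g1 := Real.Gamma_pos_of_pos hb
  have g2 := Real.Gamma_pos_of_pos (show 0 < 1-b by linarith)
  have e2 : ENNReal.ofReal (kc b * pr b x) = ENNReal.ofReal (2^(b-1)) * (ENNReal.ofReal (Real.Gamma (1 - b) * Real.Gamma b) * ENNReal.ofReal (fr b ((1-x)/2))) := by
    rw [← ENNReal.ofReal_mul (by positivity), ← ENNReal.ofReal_mul (by positivity)]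
    unfold kc pr; congr 1; ring
  rw [e2, ← e, ← bI_const_mul _ ENNReal.ofReal_ne_top]
  unfold bI
  apply setLIntegral_congr_fun measurableSet_Ioo
  intro v hv
  obtain ⟨hv0, hv1⟩ := hv
  have p1 : 0 < 1 - x := by linarith
  have p2 : 0 < 1 - v := by linarith
  have p3 : 0 < 1 - (1-x)/2*v := by nlinarith
  simp only
  rw [← ENNReal.ofReal_mul (abs_nonneg _), ← ENNReal.ofReal_mul (by positivity), ← ENNReal.ofReal_mul (by positivity)]
  congr 1
  unfold uh
  rw [show 1 - (1-(1-x)*v)^2 = (1-x)*v*(2*(1-(1-x)/2*v)) by ring, show x - (1-(1-x)*v) = -((1-x)*(1-v)) by ring,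
    abs_neg, abs_neg, abs_of_pos p1, abs_of_pos (by positivity), Real.mul_rpow (by positivity) (by positivity), Real.mul_rpow (by positivity) (by positivity),
    Real.mul_rpow (by positivity) (by positivity), Real.mul_rpow (by positivity) (by positivity)]
  have q : (1-x) * ((1-x)^(b-1) * (1-x)^(-b)) = 1 := by
    rw [← Real.rpow_add p1, show b - 1 + -b = -1 by ring, Real.rpow_neg_one]; field_simp
  rw [show 1 - b - 1 = -b by ring, show -(1-b) = b-1 by ring]
  calc _ = ((1-x) * ((1-x)^(b-1) * (1-x)^(-b))) * (v^(b-1) * (2^(b-1) * (1-(1-x)/2*v)^(b-1)) * (1-v)^(-b)) := by ring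
    _ = _ := by rw [q]; ring

lemma uh_neg (b x t : ℝ) : uh b x (-t) = uh b (-x) t := by
  unfold uh
  rw [show x - -t = -(-x - t) by ring, abs_neg]; ring_nf

lemma E_left {b x : ℝ} (hb : 0 < b) (hb1 : b < 1) (h1 : -1 < x) (h2 : x < 1) :
    ∫⁻ t in Set.Ioo (-1) x, ENNReal.ofReal (uh b x t) = ENNReal.ofReal (kc b * pr b (-x)) := by
  rw [← E_right hb hb1 (by linarith) (by linarith)]
  have hmp : MeasurePreserving (fun x : ℝ => - x) volume volume := Measure.measurePreserving_neg volume
  have hemb : MeasurableEmbedding (fun x : ℝ => - x) := (MeasurableEquiv.neg ℝ).measurableEmbedding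
  rw [← hmp.setLIntegral_comp_preimage_emb hemb]
  have : (fun x : ℝ => -x) ⁻¹' Set.Ioo (-1) x = Set.Ioo (-x) 1 := by
    ext t; simp only [Set.mem_preimage, Set.mem_Ioo]; constructor <;> rintro ⟨a, b⟩ <;> constructor <;> linarith
  rw [this]
  simp only [uh_neg]

lemma int_of_lint {f : ℝ → ℝ} {s : Set ℝ} (hs : MeasurableSet s) (hf : Measurable f) (h0 : ∀ t ∈ s, 0 ≤ f t) {c : ℝ} (hc : 0 ≤ c)
    (h : ∫⁻ t in s, ENNReal.ofReal (f t) = ENNReal.ofReal c) : IntegrableOn f s ∧ ∫ t in s, f t = c := by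
  have h0' : 0 ≤ᵐ[volume.restrict s] f := by
    rw [Filter.EventuallyLE, ae_restrict_iff' hs]; exact Filter.Eventually.of_forall h0
  constructor
  · refine ⟨hf.aestronglyMeasurable, ?_⟩
    rw [hasFiniteIntegral_iff_ofReal h0', h]; exact ENNReal.ofReal_lt_top
  · rw [integral_eq_lintegral_of_nonneg_ae h0' hf.aestronglyMeasurable, h, ENNReal.toReal_ofReal hc]

lemma uh_right {b x : ℝ} (hb : 0 < b) (hb1 : b < 1) (h1 : -1 < x) (h2 : x < 1) :
    IntegrableOn (uh b x) (Set.Ioo x 1) ∧ ∫ t in Set.Ioo x 1, uh b x t = kc b * pr b x :=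
  int_of_lint measurableSet_Ioo (uh_meas b x) (fun t ht => uh_nonneg b x t (by linarith [ht.1]) ht.2)
    (mul_nonneg (kc_pos hb hb1).le (by linarith [pr_ge_one hb hb1 h1 h2])) (E_right hb hb1 h1 h2)

lemma uh_left {b x : ℝ} (hb : 0 < b) (hb1 : b < 1) (h1 : -1 < x) (h2 : x < 1) :
    IntegrableOn (uh b x) (Set.Ioo (-1) x) ∧ ∫ t in Set.Ioo (-1) x, uh b x t = kc b * pr b (-x) :=
  int_of_lint measurableSet_Ioo (uh_meas b x) (fun t ht => uh_nonneg b x t ht.1 (by linarith [ht.2]))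
    (mul_nonneg (kc_pos hb hb1).le (by linarith [pr_ge_one hb hb1 (show -1 < -x by linarith) (by linarith)])) (E_left hb hb1 h1 h2)

lemma ioo_split {x : ℝ} (h1 : -1 < x) (h2 : x < 1) : Set.Ioo (-1:ℝ) 1 =ᵐ[volume] (Set.Ioo (-1) x ∪ Set.Ioo x 1 : Set ℝ) := by
  have : Set.Ioo (-1:ℝ) 1 = Set.Ioc (-1) x ∪ Set.Ioo x 1 := (Set.Ioc_union_Ioo_eq_Ioo h1.le h2).symm
  rw [this]
  exact (Ioo_ae_eq_Ioc.symm).union (Filter.EventuallyEq.refl _ _)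

lemma ioo_disj (x : ℝ) : Disjoint (Set.Ioo (-1:ℝ) x) (Set.Ioo x 1) := by
  rw [Set.disjoint_left]; intro t h1 h2; linarith [h1.2, h2.1]

lemma uh_all {b x : ℝ} (hb : 0 < b) (hb1 : b < 1) (h1 : -1 < x) (h2 : x < 1) :
    IntegrableOn (uh b x) (Set.Ioo (-1) 1) ∧ ∫ t in Set.Ioo (-1:ℝ) 1, uh b x t = kc b * (pr b (-x) + pr b x) := by
  obtain ⟨a1, a2⟩ := uh_right hb hb1 h1 h2
  obtain ⟨b1, b2⟩ := uh_left hb hb1 h1 h2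
  constructor
  · rw [integrableOn_congr_set_ae (ioo_split h1 h2)]; exact b1.union a1
  · rw [setIntegral_congr_set (ioo_split h1 h2), setIntegral_union (ioo_disj x) measurableSet_Ioo b1 a1, a2, b2]; ring

/-- bound inside -/
lemma uh_in {b δ : ℝ} (hb : 0 < b) (hb1 : b < 1) (hδ : 0 < δ) (hδ1 : δ ≤ 1) : ∃ C : ℝ, 0 ≤ C ∧ ∀ x, -1 < x → x < 1 →
    ∫ t in Set.Ioo (-1:ℝ) 1, uh b x t ≤ C * (1-x^2)^(-δ) := by
  obtain ⟨C, hC1, hC⟩ := pP_bound ‖((b-1:ℝ):ℂ)‖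
  have hp : ∀ x, -1 < x → x < 1 → pr b x ≤ C * (1/δ) * (1-x^2)^(-δ) := by
    intro x h1 h2
    have := hC _ le_rfl δ hδ hδ1 x h1 h2
    rw [pP_pr, Complex.norm_real] at this
    exact (le_abs_self _).trans this
  refine ⟨kc b * (2 * (C * (1/δ))), by have := kc_pos hb hb1; positivity, ?_⟩
  intro x h1 h2
  rw [(uh_all hb hb1 h1 h2).2]
  have a1 := hp x h1 h2
  have a2 := hp (-x) (by linarith) (by linarith)
  rw [neg_sq] at a2
  calc _ ≤ kc b * (C * (1/δ) * (1-x^2)^(-δ) + C * (1/δ) * (1-x^2)^(-δ)) := by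
        have := kc_pos hb hb1
        gcongr
    _ = _ := by ring

/-- bound outside -/
lemma uh_out {b δ : ℝ} (hb : 0 < b) (hδ : 0 < δ) (hδ1 : δ ≤ b) : ∃ C : ℝ, 0 ≤ C ∧ ∀ x, 1 < |x| →
    IntegrableOn (uh b x) (Set.Ioo (-1) 1) ∧ ∫ t in Set.Ioo (-1:ℝ) 1, uh b x t ≤ C * (|x|-1)^(-δ) := by
  have hi := (integrable_w (δ-1) (by linarith)).const_mul (2^(b-δ))
  refine ⟨∫ t in Set.Ioo (-1:ℝ) 1, 2^(b-δ) * (1-t^2)^(δ-1), ?_, ?_⟩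
  · apply setIntegral_nonneg measurableSet_Ioo
    intro t ht
    have : 0 < 1 - t^2 := by nlinarith [ht.1, ht.2]
    positivity
  intro x hx
  have hb2 : ∀ t ∈ Set.Ioo (-1:ℝ) 1, uh b x t ≤ (2^(b-δ) * (1-t^2)^(δ-1)) * (|x|-1)^(-δ) := by
    intro t ht
    have q : 0 < 1 - t^2 := by nlinarith [ht.1, ht.2]
    have at1 : |t| < 1 := abs_lt.2 ht
    have a0 : |x| - |t| ≤ |x-t| := abs_sub_abs_le_abs_sub x t
    have a1 : |x| - 1 ≤ |x-t| := by linarith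
    have a2 : (1-t^2)/2 ≤ |x-t| := by
      have : t^2 = |t|^2 := (sq_abs t).symm
      nlinarith [abs_nonneg t]
    have px : 0 < |x| - 1 := by linarith
    have pt : 0 < |x-t| := by linarith
    unfold uh
    have e1 : |x-t|^(-b) = |x-t|^(-δ) * |x-t|^(-(b-δ)) := by rw [← Real.rpow_add pt]; congr 1; ring
    have e2 : |x-t|^(-δ) ≤ (|x|-1)^(-δ) := Real.rpow_le_rpow_of_nonpos px a1 (by linarith)
    have e3 : |x-t|^(-(b-δ)) ≤ ((1-t^2)/2)^(-(b-δ)) := Real.rpow_le_rpow_of_nonpos (by positivity) a2 (by linarith)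
    have e4 : ((1-t^2)/2)^(-(b-δ)) = (1-t^2)^(-(b-δ)) * 2^(b-δ) := by
      rw [Real.div_rpow q.le (by norm_num), Real.rpow_neg (by norm_num : (0:ℝ) ≤ 2), div_inv_eq_mul]
    have e5 : (1-t^2)^(δ-1) = (1-t^2)^(b-1) * (1-t^2)^(-(b-δ)) := by rw [← Real.rpow_add q]; congr 1; ring
    calc _ = (1-t^2)^(b-1) * (|x-t|^(-δ) * |x-t|^(-(b-δ))) := by rw [e1]
      _ ≤ (1-t^2)^(b-1) * ((|x|-1)^(-δ) * ((1-t^2)^(-(b-δ)) * 2^(b-δ))) := by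
          rw [← e4]; gcongr
      _ = _ := by rw [e5]; ring
  have hI : IntegrableOn (uh b x) (Set.Ioo (-1) 1) := by
    refine Integrable.mono' (hi.mul_const ((|x|-1)^(-δ))) (uh_meas b x).aestronglyMeasurable ?_
    rw [ae_restrict_iff' measurableSet_Ioo]
    refine Filter.Eventually.of_forall fun t ht => ?_
    rw [Real.norm_of_nonneg (uh_nonneg b x t ht.1 ht.2)]; exact hb2 t ht
  refine ⟨hI, ?_⟩
  rw [← MeasureTheory.integral_mul_const]
  exact setIntegral_mono_on hI (hi.mul_const _) measurableSet_Ioo hb2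


noncomputable def uf (b : ℝ) (z : ℂ) (t : ℝ) : ℂ := (((1-t^2)^(b-1) : ℝ) : ℂ) * (z - (t:ℂ))^(((-b:ℝ)):ℂ)
noncomputable def Uq (b : ℝ) (z : ℂ) : ℂ := ∫ t in Set.Ioo (-1:ℝ) 1, uf b z t
noncomputable def ph (b : ℝ) : ℂ := Complex.exp (-(π * b : ℝ) * I)

lemma uf_meas (b : ℝ) (z : ℂ) : Measurable (uf b z) := by
  unfold uf
  apply Measurable.mul (by fun_prop)
  exact Measurable.pow_const (by fun_prop) _

lemma uf_norm (b : ℝ) (z : ℂ) (t : ℝ) (ht : t ∈ Set.Ioo (-1:ℝ) 1) : ‖uf b z t‖ = (1-t^2)^(b-1) * ‖z - (t:ℂ)‖^(-b) := by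
  have q : 0 < 1 - t^2 := by nlinarith [ht.1, ht.2]
  unfold uf
  rw [norm_mul, Complex.norm_cpow_real, Complex.norm_real, Real.norm_of_nonneg (by positivity)]

lemma uf_le {b : ℝ} (hb : 0 < b) (z : ℂ) : ∀ᵐ t ∂(volume.restrict (Set.Ioo (-1:ℝ) 1)), ‖uf b z t‖ ≤ uh b z.re t := by
  rw [ae_restrict_iff' measurableSet_Ioo]
  have : ∀ᵐ t : ℝ, t ≠ z.re := by simp [ae_iff]
  filter_upwards [this] with t ht hm
  have q : 0 < 1 - t^2 := by nlinarith [hm.1, hm.2]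
  rw [uf_norm b z t hm]
  unfold uh
  have h1 : 0 < |z.re - t| := abs_pos.2 (sub_ne_zero.2 ht.symm)
  have h2 : |z.re - t| ≤ ‖z - (t:ℂ)‖ := by
    have := Complex.abs_re_le_norm (z - (t:ℂ)); simpa using this
  have := Real.rpow_le_rpow_of_nonpos h1 h2 (show -b ≤ 0 by linarith)
  gcongr

lemma Uq_le {b : ℝ} (hb : 0 < b) (z : ℂ) (hi : IntegrableOn (uh b z.re) (Set.Ioo (-1) 1)) :
    ‖Uq b z‖ ≤ ∫ t in Set.Ioo (-1:ℝ) 1, uh b z.re t :=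
  norm_integral_le_of_norm_le hi (uf_le hb z)

lemma Uq_far {b : ℝ} (hb : 0 < b) : ∃ C : ℝ, 0 ≤ C ∧ ∀ z : ℂ, 2 ≤ ‖z‖ → ‖Uq b z‖ ≤ C * ‖z‖^(-b) := by
  refine ⟨(∫ t in Set.Ioo (-1:ℝ) 1, (1-t^2)^(b-1)) * 2^b, ?_, ?_⟩
  · apply mul_nonneg _ (by positivity)
    apply setIntegral_nonneg measurableSet_Ioo
    intro t ht
    have : 0 < 1 - t^2 := by nlinarith [ht.1, ht.2]
    positivity
  intro z hz
  rw [mul_assoc, ← MeasureTheory.integral_mul_const]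
  refine norm_integral_le_of_norm_le ((integrable_w (b-1) (by linarith)).mul_const _) ?_
  rw [ae_restrict_iff' measurableSet_Ioo]
  refine Filter.Eventually.of_forall fun t ht => ?_
  have q : 0 < 1 - t^2 := by nlinarith [ht.1, ht.2]
  rw [uf_norm b z t ht]
  have h1 : ‖z‖/2 ≤ ‖z - (t:ℂ)‖ := by
    have := norm_sub_norm_le z (t:ℂ)
    have h2 : ‖(t:ℂ)‖ < 1 := by rw [Complex.norm_real]; exact abs_lt.2 ht
    linarith
  have h2 := Real.rpow_le_rpow_of_nonpos (by linarith) h1 (show -b ≤ 0 by linarith)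
  have h3 : (‖z‖/2)^(-b) = 2^b * ‖z‖^(-b) := by
    rw [Real.div_rpow (by positivity) (by norm_num), Real.rpow_neg (by norm_num : (0:ℝ) ≤ 2), div_inv_eq_mul, mul_comm]
  rw [← h3]; gcongr

lemma Uq_diff {b : ℝ} (hb : 0 < b) : DifferentiableOn ℂ (Uq b) {z : ℂ | 0 < z.im} := by
  unfold Uq
  refine holo_integral (F := fun z t => uf b z t) (isOpen_lt continuous_const Complex.continuous_im) ?_ (fun z _ => (uf_meas b z).aestronglyMeasurable) ?_
  · refine Filter.Eventually.of_forall fun t => ?_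
    intro z hz
    unfold uf
    apply DifferentiableAt.differentiableWithinAt
    refine DifferentiableAt.mul (by fun_prop) ?_
    refine DifferentiableAt.cpow_const (by fun_prop) ?_
    rw [Complex.mem_slitPlane_iff]; right; simp; exact (ne_of_gt hz)
  · intro z₀ hz₀
    simp only [Set.mem_ofPred_eq] at hz₀
    have him : ∀ z ∈ Metric.ball z₀ (z₀.im/2), z₀.im/2 < z.im := by
      intro z hz
      rw [Metric.mem_ball, dist_comm, Complex.dist_eq] at hz
      have := (Complex.abs_im_le_norm (z₀ - z)).trans_lt hz
      rw [Complex.sub_im] at this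
      linarith [(abs_lt.1 this).2]
    refine ⟨z₀.im/2, by positivity, fun t => (1-t^2)^(b-1) * (z₀.im/2)^(-b), (integrable_w (b-1) (by linarith)).mul_const _, ?_, ?_⟩
    · intro z hz
      simp only [Set.mem_ofPred_eq]; linarith [him z hz]
    · rw [ae_restrict_iff' measurableSet_Ioo]
      refine Filter.Eventually.of_forall fun t ht z hz => ?_
      have q : 0 < 1 - t^2 := by nlinarith [ht.1, ht.2]
      rw [uf_norm b z t ht]
      have h1 : z₀.im/2 ≤ ‖z - (t:ℂ)‖ := by
        have := (le_abs_self _).trans (Complex.abs_im_le_norm (z - (t:ℂ)))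
        simp at this; linarith [him z hz]
      have h2 := Real.rpow_le_rpow_of_nonpos (by linarith) h1 (show -b ≤ 0 by linarith)
      exact mul_le_mul_of_nonneg_left h2 (by positivity)

lemma cpow_lim {y : ℝ} (c : ℝ) (hy : y ≠ 0) (e : ℕ → ℝ) (he : Filter.Tendsto e Filter.atTop (nhds 0)) (he0 : ∀ n, 0 ≤ e n) :
    Filter.Tendsto (fun n => ((y:ℂ) + (e n : ℂ) * I)^(c:ℂ)) Filter.atTop (nhds ((y:ℂ)^(c:ℂ))) := by
  have h0 : Filter.Tendsto (fun n => (y:ℂ) + (e n : ℂ) * I) Filter.atTop (nhds (y:ℂ)) := by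
    have h1 : Filter.Tendsto (fun n => ((e n : ℝ) : ℂ)) Filter.atTop (nhds ((0:ℝ):ℂ)) := (Complex.continuous_ofReal.tendsto 0).comp he
    have := (h1.mul_const I).const_add (y:ℂ)
    simpa using this
  have hlog : Filter.Tendsto (fun n => Complex.log ((y:ℂ) + (e n : ℂ) * I)) Filter.atTop (nhds (Complex.log (y:ℂ))) := by
    rcases lt_or_gt_of_ne hy with h | h
    · have := Complex.continuousWithinAt_log_of_re_neg_of_im_zero (z := (y:ℂ)) (by simpa using h) (by simp)
      refine this.tendsto.comp (tendsto_nhdsWithin_iff.2 ⟨h0, Filter.Eventually.of_forall fun n => ?_⟩)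
      simp [he0 n]
    · exact ((continuousAt_clog (by rw [Complex.mem_slitPlane_iff]; left; simpa using h)).tendsto).comp h0
  have hne : ∀ n, (y:ℂ) + (e n : ℂ) * I ≠ 0 := by
    intro n h
    have := congrArg Complex.re h
    simp at this; exact hy this
  have hy' : (y:ℂ) ≠ 0 := by exact_mod_cast hy
  simp only [Complex.cpow_def_of_ne_zero (hne _), Complex.cpow_def_of_ne_zero hy']
  exact (Complex.continuous_exp.tendsto _).comp (hlog.mul_const _)

lemma Uq_lim {b x : ℝ} (hb : 0 < b) (hi : IntegrableOn (uh b x) (Set.Ioo (-1) 1)) (e : ℕ → ℝ)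
    (he : Filter.Tendsto e Filter.atTop (nhds 0)) (he0 : ∀ n, 0 ≤ e n) :
    Filter.Tendsto (fun n => Uq b ((x:ℂ) + (e n : ℂ) * I)) Filter.atTop (nhds (Uq b (x:ℂ))) := by
  unfold Uq
  refine tendsto_integral_of_dominated_convergence (uh b x) (fun n => (uf_meas b _).aestronglyMeasurable) hi ?_ ?_
  · intro n
    have := uf_le hb ((x:ℂ) + (e n : ℂ) * I)
    simpa using this
  · have : ∀ᵐ t : ℝ ∂(volume.restrict (Set.Ioo (-1:ℝ) 1)), t ≠ x := by
      apply ae_restrict_of_ae; simp [ae_iff]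
    filter_upwards [this] with t ht
    unfold uf
    have := (cpow_lim (-b) (sub_ne_zero.2 ht.symm) e he he0).const_mul (((1-t^2)^(b-1) : ℝ) : ℂ)
    push_cast at this ⊢
    refine this.congr fun n => ?_
    congr 2; ring

lemma uf_pos (b x t : ℝ) (h : t < x) : uf b (x:ℂ) t = (uh b x t : ℂ) := by
  unfold uf uh
  have : 0 < x - t := by linarith
  rw [← Complex.ofReal_sub, ← Complex.ofReal_cpow this.le, abs_of_pos this]; push_cast; rfl

lemma uf_negv (b x t : ℝ) (h : x < t) : uf b (x:ℂ) t = ph b * (uh b x t : ℂ) := by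
  unfold uf uh ph
  have h0 : x - t < 0 := by linarith
  rw [← Complex.ofReal_sub, Complex.ofReal_cpow_of_nonpos h0.le, abs_of_neg h0, ← Complex.ofReal_neg, ← Complex.ofReal_cpow (by linarith)]
  push_cast
  rw [show (π:ℂ) * I * -(b:ℂ) = -(π*b)*I by ring]; ring

lemma Uq_in {b x : ℝ} (hb : 0 < b) (hb1 : b < 1) (h1 : -1 < x) (h2 : x < 1) :
    Uq b (x:ℂ) = (kc b : ℂ) * (pr b (-x) + ph b * pr b x) := by
  obtain ⟨a1, a2⟩ := uh_right hb hb1 h1 h2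
  obtain ⟨b1, b2⟩ := uh_left hb hb1 h1 h2
  have c1 : Set.EqOn (uf b (x:ℂ)) (fun t => (uh b x t : ℂ)) (Set.Ioo (-1) x) := fun t ht => uf_pos b x t ht.2
  have c2 : Set.EqOn (uf b (x:ℂ)) (fun t => ph b * (uh b x t : ℂ)) (Set.Ioo x 1) := fun t ht => uf_negv b x t ht.1
  unfold Uq
  rw [setIntegral_congr_set (ioo_split h1 h2), setIntegral_union (ioo_disj x) measurableSet_Ioo
    ((integrableOn_congr_fun c1 measurableSet_Ioo).2 b1.ofReal)
    ((integrableOn_congr_fun c2 measurableSet_Ioo).2 (a1.ofReal.const_mul _)),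
    setIntegral_congr_fun measurableSet_Ioo c1, setIntegral_congr_fun measurableSet_Ioo c2,
    MeasureTheory.integral_const_mul, integral_complex_ofReal, integral_complex_ofReal, a2, b2]
  push_cast; ring

lemma Uq_gt {b x : ℝ} (h1 : 1 ≤ x) :
    Uq b (x:ℂ) = ((∫ t in Set.Ioo (-1:ℝ) 1, uh b x t : ℝ) : ℂ) := by
  unfold Uq
  rw [setIntegral_congr_fun measurableSet_Ioo (g := fun t => (uh b x t : ℂ)) (fun t ht => uf_pos b x t (by linarith [ht.2])), integral_complex_ofReal]

lemma Uq_lt {b x : ℝ} (h1 : x ≤ -1) :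
    Uq b (x:ℂ) = ph b * ((∫ t in Set.Ioo (-1:ℝ) 1, uh b x t : ℝ) : ℂ) := by
  unfold Uq
  rw [setIntegral_congr_fun measurableSet_Ioo (g := fun t => ph b * (uh b x t : ℂ)) (fun t ht => uf_negv b x t (by linarith [ht.1])), MeasureTheory.integral_const_mul, integral_complex_ofReal]


noncomputable def wq (b : ℝ) (z : ℂ) : ℂ := (z-1)^(((b/2-1:ℝ)):ℂ) * (z+1)^(((b/2-1:ℝ)):ℂ)
noncomputable def Gq (b : ℝ) (z : ℂ) : ℂ := Uq b z^2 * Uq (1-b) z * wq b z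

lemma wq_norm (b : ℝ) (z : ℂ) : ‖wq b z‖ = ‖z-1‖^(b/2-1) * ‖z+1‖^(b/2-1) := by
  unfold wq; rw [norm_mul, Complex.norm_cpow_real, Complex.norm_cpow_real]

lemma Gq_diff {b : ℝ} (hb : 0 < b) (hb1 : b < 1) : DifferentiableOn ℂ (Gq b) {z : ℂ | 0 < z.im} := by
  unfold Gq
  refine (((Uq_diff hb).pow 2).mul (Uq_diff (by linarith))).mul ?_
  intro z hz
  apply DifferentiableAt.differentiableWithinAt
  unfold wq
  refine DifferentiableAt.mul ?_ ?_
  · refine DifferentiableAt.cpow_const (by fun_prop) ?_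
    rw [Complex.mem_slitPlane_iff]; right; simp; exact (ne_of_gt hz)
  · refine DifferentiableAt.cpow_const (by fun_prop) ?_
    rw [Complex.mem_slitPlane_iff]; right; simp; exact (ne_of_gt hz)

lemma Gq_far {b : ℝ} (hb : 0 < b) (hb1 : b < 1) : ∃ C : ℝ, 0 ≤ C ∧ ∀ z : ℂ, 2 ≤ ‖z‖ → ‖Gq b z‖ ≤ C * (‖z‖^3)⁻¹ := by
  obtain ⟨C1, p1, h1⟩ := Uq_far hb
  obtain ⟨C2, p2, h2⟩ := Uq_far (show 0 < 1-b by linarith)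
  refine ⟨C1^2*C2*(2^(-(b/2-1)))^2, by positivity, ?_⟩
  intro z hz
  have hz0 : 0 < ‖z‖ := by linarith
  have e : (‖z‖/2)^(b/2-1) = 2^(-(b/2-1)) * ‖z‖^(b/2-1) := by
    rw [Real.div_rpow (by positivity) (by norm_num), Real.rpow_neg (by norm_num : (0:ℝ) ≤ 2), div_eq_mul_inv, mul_comm]
  have w1 : ‖z-1‖^(b/2-1) ≤ 2^(-(b/2-1)) * ‖z‖^(b/2-1) := by
    rw [← e]
    refine Real.rpow_le_rpow_of_nonpos (by linarith) ?_ (by linarith)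
    have := norm_sub_norm_le z 1
    rw [norm_one] at this; linarith
  have w2 : ‖z+1‖^(b/2-1) ≤ 2^(-(b/2-1)) * ‖z‖^(b/2-1) := by
    rw [← e]
    refine Real.rpow_le_rpow_of_nonpos (by linarith) ?_ (by linarith)
    have := norm_sub_norm_le z (-1)
    rw [norm_neg, norm_one, sub_neg_eq_add] at this; linarith
  have k1 := h1 z hz
  have k2 := h2 z hz
  unfold Gq
  rw [norm_mul, norm_mul, norm_pow, wq_norm]
  calc _ ≤ (C1 * ‖z‖^(-b))^2 * (C2 * ‖z‖^(-(1-b))) * ((2^(-(b/2-1)) * ‖z‖^(b/2-1)) * (2^(-(b/2-1)) * ‖z‖^(b/2-1))) := by gcongr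
    _ = C1^2*C2*(2^(-(b/2-1)))^2 * (‖z‖^(-b) * ‖z‖^(-b) * ‖z‖^(-(1-b)) * ‖z‖^(b/2-1) * ‖z‖^(b/2-1)) := by ring
    _ = _ := by
      rw [← Real.rpow_add hz0, ← Real.rpow_add hz0, ← Real.rpow_add hz0, ← Real.rpow_add hz0, show -b + -b + -(1-b) + (b/2-1) + (b/2-1) = -3 by ring,
        Real.rpow_neg hz0.le]
      norm_num

lemma Uq_near {b δ : ℝ} (hb : 0 < b) (hb1 : b < 1) (hδ : 0 < δ) (hδ1 : δ ≤ b) : ∃ C : ℝ, 0 ≤ C ∧ ∀ z : ℂ, |z.re| ≠ 1 →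
    ‖Uq b z‖ ≤ C * |(|z.re| - 1)|^(-δ) := by
  obtain ⟨C1, p1, h1⟩ := uh_in hb hb1 hδ (by linarith)
  obtain ⟨C2, p2, h2⟩ := uh_out hb hδ hδ1
  refine ⟨C1 + C2, by positivity, ?_⟩
  intro z hz
  rcases lt_or_gt_of_ne hz with h | h
  · obtain ⟨a1, a2⟩ := abs_lt.1 h
    refine (Uq_le hb z (uh_all hb hb1 a1 a2).1).trans ((h1 _ a1 a2).trans ?_)
    have q : (1 - z.re^2)^(-δ) ≤ |(|z.re| - 1)|^(-δ) := by
      have : z.re^2 = |z.re|^2 := (sq_abs _).symm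
      refine Real.rpow_le_rpow_of_nonpos (abs_pos.2 (by linarith)) ?_ (by linarith)
      rw [abs_of_neg (by linarith), this]; nlinarith [abs_nonneg z.re]
    calc _ ≤ C1 * |(|z.re| - 1)|^(-δ) := by gcongr
      _ ≤ _ := by gcongr; linarith
  · refine (Uq_le hb z (h2 _ h).1).trans ((h2 _ h).2.trans ?_)
    rw [abs_of_pos (show 0 < |z.re| - 1 by linarith)]
    have : 0 < |z.re| - 1 := by linarith
    gcongr; linarith

lemma wq_near {b : ℝ} (hb1 : b < 1) (z : ℂ) (hz : |z.re| ≠ 1) : ‖wq b z‖ ≤ |(|z.re| - 1)|^(b/2-1) := by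
  rw [wq_norm, ← Real.mul_rpow (norm_nonneg _) (norm_nonneg _)]
  refine Real.rpow_le_rpow_of_nonpos (abs_pos.2 (sub_ne_zero.2 hz)) ?_ (by linarith)
  have a1 : |z.re - 1| ≤ ‖z-1‖ := by simpa using Complex.abs_re_le_norm (z-1)
  have a2 : |z.re + 1| ≤ ‖z+1‖ := by simpa using Complex.abs_re_le_norm (z+1)
  calc |(|z.re| - 1)| ≤ |(|z.re| - 1)| * (|z.re| + 1) := by nlinarith [abs_nonneg z.re, abs_nonneg (|z.re| - 1)]
    _ = |z.re - 1| * |z.re + 1| := by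
      rw [← abs_mul, ← abs_of_nonneg (show 0 ≤ |z.re| + 1 by positivity), ← abs_mul]
      congr 1
      have := sq_abs z.re; nlinarith
    _ ≤ _ := by gcongr

lemma Gq_near {b : ℝ} (hb : 0 < b) (hb1 : b < 1) : ∃ C s : ℝ, 0 ≤ C ∧ -1 < s ∧ ∀ z : ℂ, |z.re| ≠ 1 →
    ‖Gq b z‖ ≤ C * |(|z.re| - 1)|^s := by
  set δ := min b (1-b)/8 with hδ
  have m1 : min b (1-b) ≤ b := min_le_left _ _
  have m2 : min b (1-b) ≤ 1-b := min_le_right _ _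
  have m3 : 0 < min b (1-b) := lt_min hb (by linarith)
  obtain ⟨C1, p1, h1⟩ := Uq_near (δ := δ) hb hb1 (by positivity) (by linarith)
  obtain ⟨C2, p2, h2⟩ := Uq_near (b := 1-b) (δ := δ) (by linarith) (by linarith) (by positivity) (by linarith)
  refine ⟨C1^2*C2, -δ + -δ + -δ + (b/2-1), by positivity, by linarith, ?_⟩
  intro z hz
  have k1 := h1 z hz
  have k2 := h2 z hz
  have k3 := wq_near hb1 z hz
  have hp : 0 < |(|z.re| - 1)| := abs_pos.2 (sub_ne_zero.2 hz)
  unfold Gq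
  rw [norm_mul, norm_mul, norm_pow, Real.rpow_add hp, Real.rpow_add hp, Real.rpow_add hp]
  calc _ ≤ (C1 * |(|z.re| - 1)|^(-δ))^2 * (C2 * |(|z.re| - 1)|^(-δ)) * |(|z.re| - 1)|^(b/2-1) := by gcongr
    _ = _ := by ring

lemma abs_rpow_int (s c : ℝ) (hs : -1 < s) : IntegrableOn (fun x : ℝ => |x - c|^s) (Set.Ioc (-2) 2) := by
  have h := (intervalIntegral.intervalIntegrable_cpow' (a := -2 - c) (b := 2 - c) (r := (s:ℂ)) (by simpa using hs)).norm
  simp only [Complex.norm_cpow_real, Complex.norm_real, Real.norm_eq_abs] at h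
  have h2 := h.comp_sub_right c
  simp only [sub_add_cancel] at h2
  exact (intervalIntegrable_iff_integrableOn_Ioc_of_le (by norm_num)).1 h2

noncomputable def gbd (C C' s x : ℝ) : ℝ :=
  Set.indicator (Set.Ioc (-2:ℝ) 2) (fun x => C * (|x - 1|^s + |x - (-1)|^s)) x + C' * (1+x^2)⁻¹

lemma gbd_int (C C' s : ℝ) (hs : -1 < s) : Integrable (gbd C C' s) := by
  unfold gbd
  refine Integrable.add ?_ (integrable_inv_one_add_sq.const_mul C')
  rw [integrable_indicator_iff measurableSet_Ioc]
  exact ((abs_rpow_int s 1 hs).add (abs_rpow_int s (-1) hs)).const_mul C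

lemma Gq_bd {b : ℝ} (hb : 0 < b) (hb1 : b < 1) : ∃ g : ℝ → ℝ, Integrable g ∧ ∀ z : ℂ, |z.re| ≠ 1 → ‖Gq b z‖ ≤ g z.re := by
  obtain ⟨C, s, p, hs, h⟩ := Gq_near hb hb1
  obtain ⟨C', p', h'⟩ := Gq_far hb hb1
  refine ⟨gbd C C' s, gbd_int C C' s hs, ?_⟩
  intro z hz
  by_cases hx : z.re ∈ Set.Ioc (-2:ℝ) 2
  · refine (h z hz).trans ?_
    unfold gbd
    rw [Set.indicator_of_mem hx]
    have : |(|z.re| - 1)|^s ≤ |z.re - 1|^s + |z.re - (-1)|^s := by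
      have a1 : 0 ≤ |z.re - 1|^s := by positivity
      have a2 : 0 ≤ |z.re - (-1)|^s := by positivity
      rcases le_total 0 z.re with h0 | h0
      · rw [abs_of_nonneg h0]; linarith
      · rw [abs_of_nonpos h0, show -z.re - 1 = -(z.re - (-1)) by ring, abs_neg]; linarith
    have q : 0 ≤ C' * (1+z.re^2)⁻¹ := by positivity
    have := mul_le_mul_of_nonneg_left this p
    linarith
  · unfold gbd
    rw [Set.indicator_of_notMem hx, zero_add]
    have h2 : 2 ≤ |z.re| := by
      rw [Set.mem_Ioc, not_and_or] at hx
      rcases hx with h | h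
      · rw [abs_of_nonpos (by linarith)]; linarith
      · rw [abs_of_nonneg (by linarith)]; linarith
    have h3 := Complex.abs_re_le_norm z
    refine (h' z (by linarith)).trans ?_
    gcongr
    have h4 : z.re^2 = |z.re|^2 := (sq_abs _).symm
    have h5 : |z.re|^3 ≤ ‖z‖^3 := by gcongr
    rw [h4]; nlinarith [mul_nonneg (sq_nonneg |z.re|) (sub_nonneg.2 h2)]

lemma Gq_lim {b x : ℝ} (hb : 0 < b) (hb1 : b < 1) (hx : |x| ≠ 1) (e : ℕ → ℝ)
    (he : Filter.Tendsto e Filter.atTop (nhds 0)) (he0 : ∀ n, 0 ≤ e n) :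
    Filter.Tendsto (fun n => Gq b ((x:ℂ) + (e n : ℂ) * I)) Filter.atTop (nhds (Gq b (x:ℂ))) := by
  have hi : ∀ b : ℝ, 0 < b → b < 1 → IntegrableOn (uh b x) (Set.Ioo (-1) 1) := by
    intro b hb hb1
    rcases lt_or_gt_of_ne hx with h | h
    · exact (uh_all hb hb1 (abs_lt.1 h).1 (abs_lt.1 h).2).1
    · obtain ⟨_, _, h'⟩ := uh_out hb hb le_rfl
      exact (h' x h).1
  have n1 : x - 1 ≠ 0 := by rintro h; apply hx; rw [show x = 1 by linarith]; simp
  have n2 : x + 1 ≠ 0 := by rintro h; apply hx; rw [show x = -1 by linarith]; simp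
  have l1 := Uq_lim hb (hi b hb hb1) e he he0
  have l2 := Uq_lim (b := 1-b) (by linarith) (hi _ (by linarith) (by linarith)) e he he0
  have l3 := cpow_lim (b/2-1) n1 e he he0
  have l4 := cpow_lim (b/2-1) n2 e he he0
  have := ((l1.pow 2).mul l2).mul (l3.mul l4)
  unfold Gq wq
  push_cast at this ⊢
  refine this.congr fun n => ?_
  rw [show (x:ℂ) + e n * I - 1 = x - 1 + e n * I by ring, show (x:ℂ) + e n * I + 1 = x + 1 + e n * I by ring]


lemma Gq_rect {b C : ℝ} (hb : 0 < b) (hb1 : b < 1) (hC : ∀ z : ℂ, 2 ≤ ‖z‖ → ‖Gq b z‖ ≤ C * (‖z‖^3)⁻¹) (N : ℝ) (hN : 2 ≤ N) (hC0 : 0 ≤ C) :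
    ‖∫ x in (-N)..N, Gq b ((x:ℂ) + ((N⁻¹:ℝ):ℂ) * I)‖ ≤ 4 * C * (N^2)⁻¹ := by
  have hN0 : 0 < N := by linarith
  have hNi : 0 < N⁻¹ := by positivity
  have hNi1 : N⁻¹ ≤ 1 := inv_le_one_of_one_le₀ (by linarith)
  have h := Complex.integral_boundary_rect_eq_zero_of_differentiableOn (Gq b) ⟨-N, N⁻¹⟩ ⟨N, N⟩ (by
    apply (Gq_diff hb hb1).mono
    intro z hz
    rw [Complex.mem_reProdIm] at hz
    have := hz.2
    simp only at this
    rw [Set.uIcc_of_le (by linarith)] at this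
    exact lt_of_lt_of_le hNi this.1)
  simp only at h
  have key : ∀ z : ℂ, N ≤ ‖z‖ → ‖Gq b z‖ ≤ C * (N^3)⁻¹ := by
    intro z hz
    refine (hC z (by linarith)).trans ?_
    gcongr
  have t1 : ‖∫ x in (-N)..N, Gq b ((x:ℂ) + ((N:ℝ):ℂ) * I)‖ ≤ C * (N^3)⁻¹ * |N - (-N)| := by
    apply intervalIntegral.norm_integral_le_of_norm_le_const
    intro x _
    apply key
    have := (le_abs_self _).trans (Complex.abs_im_le_norm ((x:ℂ) + ((N:ℝ):ℂ) * I))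
    simpa using this
  have t2 : ‖∫ y in (N⁻¹)..N, Gq b ((N:ℂ) + (y:ℂ) * I)‖ ≤ C * (N^3)⁻¹ * |N - N⁻¹| := by
    apply intervalIntegral.norm_integral_le_of_norm_le_const
    intro x _
    apply key
    have := (le_abs_self _).trans (Complex.abs_re_le_norm ((N:ℂ) + (x:ℂ) * I))
    simpa using this
  have t3 : ‖∫ y in (N⁻¹)..N, Gq b (((-N:ℝ):ℂ) + (y:ℂ) * I)‖ ≤ C * (N^3)⁻¹ * |N - N⁻¹| := by
    apply intervalIntegral.norm_integral_le_of_norm_le_const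
    intro x _
    apply key
    have := (neg_le_abs _).trans (Complex.abs_re_le_norm (((-N:ℝ):ℂ) + (x:ℂ) * I))
    simpa using this
  set B := ∫ x in (-N)..N, Gq b ((x:ℂ) + ((N⁻¹:ℝ):ℂ) * I)
  set T := ∫ x in (-N)..N, Gq b ((x:ℂ) + ((N:ℝ):ℂ) * I)
  set R := ∫ y in (N⁻¹)..N, Gq b ((N:ℂ) + (y:ℂ) * I)
  set L := ∫ y in (N⁻¹)..N, Gq b (((-N:ℝ):ℂ) + (y:ℂ) * I)
  have hB : B = T - I • R + I • L := by linear_combination h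
  rw [hB]
  have n1 := norm_add_le (T - I • R) (I • L)
  have n2 := norm_sub_le T (I • R)
  rw [norm_smul, Complex.norm_I, one_mul] at n1 n2
  have a1 : |N - (-N)| = 2*N := by rw [abs_of_pos (by linarith)]; ring
  have a2 : |N - N⁻¹| ≤ N := by rw [abs_of_nonneg (by linarith)]; linarith
  rw [a1] at t1
  have q : 0 ≤ C * (N^3)⁻¹ := by positivity
  have q2 := mul_le_mul_of_nonneg_left a2 q
  calc _ ≤ C * (N^3)⁻¹ * (4*N) := by nlinarith
    _ = _ := by field_simp

lemma ae_abs_ne : ∀ᵐ x : ℝ, |x| ≠ 1 := by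
  have : ∀ᵐ x : ℝ, x ≠ 1 := by simp [ae_iff]
  have h2 : ∀ᵐ x : ℝ, x ≠ -1 := by simp [ae_iff]
  filter_upwards [this, h2] with x h1 h2 h
  rcases eq_or_eq_neg_of_abs_eq h with h | h <;> contradiction

lemma Gq_main {b : ℝ} (hb : 0 < b) (hb1 : b < 1) : Integrable (fun x : ℝ => Gq b (x:ℂ)) ∧ ∫ x : ℝ, Gq b (x:ℂ) = 0 := by
  obtain ⟨C, p, hC⟩ := Gq_far hb hb1
  obtain ⟨g, gi, hg⟩ := Gq_bd hb hb1
  set N : ℕ → ℝ := fun n => (n:ℝ) + 2 with hNdef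
  have hN : ∀ n, 2 ≤ N n := fun n => by simp [hNdef]
  have hNt : Filter.Tendsto N Filter.atTop Filter.atTop := tendsto_natCast_atTop_atTop.atTop_add tendsto_const_nhds
  have he : Filter.Tendsto (fun n => (N n)⁻¹) Filter.atTop (nhds 0) := tendsto_inv_atTop_zero.comp hNt
  have he0 : ∀ n, 0 < (N n)⁻¹ := fun n => by have := hN n; positivity
  set F : ℕ → ℝ → ℂ := fun n => Set.indicator (Set.Ioc (-(N n)) (N n)) (fun x => Gq b ((x:ℂ) + (((N n)⁻¹:ℝ):ℂ) * I)) with hF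
  have hm : ∀ n, AEStronglyMeasurable (F n) volume := by
    intro n
    apply AEStronglyMeasurable.indicator _ measurableSet_Ioc
    apply Continuous.aestronglyMeasurable
    have := (Gq_diff hb hb1).continuousOn
    refine this.comp_continuous (by fun_prop) ?_
    intro x
    simpa using lt_of_lt_of_le (by norm_num) (hN n)
  have hbd : ∀ n, ∀ᵐ x : ℝ, ‖F n x‖ ≤ g x := by
    intro n
    filter_upwards [ae_abs_ne] with x hx
    have := hg ((x:ℂ) + (((N n)⁻¹:ℝ):ℂ) * I) (by simpa using hx)
    have hre : ((x:ℂ) + (((N n)⁻¹:ℝ):ℂ) * I).re = x := by simp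
    rw [hre] at this
    refine le_trans ?_ this
    exact norm_indicator_le_norm_self _ _
  have hlim : ∀ᵐ x : ℝ, Filter.Tendsto (fun n => F n x) Filter.atTop (nhds (Gq b (x:ℂ))) := by
    filter_upwards [ae_abs_ne] with x hx
    refine (Gq_lim hb hb1 hx _ he (fun n => (he0 n).le)).congr' ?_
    filter_upwards [hNt.eventually_gt_atTop |x|] with n hn
    simp only [hF]
    rw [Set.indicator_of_mem]
    exact ⟨(abs_lt.1 hn).1, (abs_lt.1 hn).2.le⟩
  constructor
  · refine Integrable.mono' gi (aestronglyMeasurable_of_tendsto_ae _ hm hlim) ?_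
    filter_upwards [ae_abs_ne] with x hx
    simpa using hg (x:ℂ) (by simpa using hx)
  have t1 := tendsto_integral_of_dominated_convergence g hm gi hbd hlim
  have t2 : Filter.Tendsto (fun n => ∫ x, F n x) Filter.atTop (nhds 0) := by
    have hz : Filter.Tendsto (fun n => 4 * C * ((N n)^2)⁻¹) Filter.atTop (nhds 0) := by
      have := (he.pow 2).const_mul (4*C)
      simpa using this
    refine squeeze_zero_norm (fun n => ?_) hz
    simp only [hF]
    rw [MeasureTheory.integral_indicator measurableSet_Ioc, ← intervalIntegral.integral_of_le (by linarith [hN n])]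
    exact Gq_rect hb hb1 hC (N n) (hN n) p
  exact tendsto_nhds_unique t1 t2


noncomputable def pq (b : ℝ) (i j : ℕ) (x : ℝ) : ℝ := pr b x ^ i * pr b (-x) ^ j * (1-x^2)^(b/2-1)

lemma pr_cont (b : ℝ) : ContinuousOn (pr b) (Set.Ioo (-1) 1) := by
  have h : ContinuousOn (pP ((b-1:ℝ):ℂ)) (Set.Ioo (-1) 1) := fun x hx => (pP_hasDerivAt _ x hx.1 hx.2).continuousAt.continuousWithinAt
  have h2 := Complex.continuous_re.comp_continuousOn h
  refine h2.congr fun x hx => ?_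
  rw [Function.comp_apply, pP_pr, Complex.ofReal_re]

lemma pq_int {b : ℝ} (hb : 0 < b) (hb1 : b < 1) (i j : ℕ) (hij : i + j ≤ 3) : IntegrableOn (pq b i j) (Set.Ioo (-1) 1) := by
  obtain ⟨C, hC1, hC⟩ := pP_bound ‖((b-1:ℝ):ℂ)‖
  set δ := b/8 with hδ
  have hp : ∀ x, -1 < x → x < 1 → pr b x ≤ C * (1/δ) * (1-x^2)^(-δ) := by
    intro x h1 h2
    have := hC _ le_rfl δ (by positivity) (by linarith) x h1 h2
    rw [pP_pr, Complex.norm_real] at this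
    exact (le_abs_self _).trans this
  have hneg : ∀ x ∈ Set.Ioo (-1:ℝ) 1, -x ∈ Set.Ioo (-1:ℝ) 1 := fun x hx => ⟨by linarith [hx.2], by linarith [hx.1]⟩
  have hm : ContinuousOn (pq b i j) (Set.Ioo (-1) 1) := by
    unfold pq
    refine (((pr_cont b).pow i).mul (((pr_cont b).comp continuousOn_neg hneg).pow j)).mul ?_
    refine ContinuousOn.rpow_const (by fun_prop) fun x hx => Or.inl ?_
    have : 0 < 1 - x^2 := by nlinarith [hx.1, hx.2]
    exact this.ne'
  refine Integrable.mono' ((integrable_w (-δ * (i+j) + (b/2-1)) ?_).const_mul ((C * (1/δ))^(i+j))) (hm.aestronglyMeasurable measurableSet_Ioo) ?_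
  · have : (i:ℝ) + j ≤ 3 := by exact_mod_cast hij
    nlinarith
  · rw [ae_restrict_iff' measurableSet_Ioo]
    refine Filter.Eventually.of_forall fun x hx => ?_
    have q : 0 < 1 - x^2 := by nlinarith [hx.1, hx.2]
    have a1 := pr_ge_one hb hb1 hx.1 hx.2
    have a2 := pr_ge_one hb hb1 (hneg x hx).1 (hneg x hx).2
    have b1 := hp x hx.1 hx.2
    have b2 := hp (-x) (hneg x hx).1 (hneg x hx).2
    rw [neg_sq] at b2
    unfold pq
    rw [Real.norm_of_nonneg (by positivity)]
    calc _ ≤ (C * (1/δ) * (1-x^2)^(-δ))^i * (C * (1/δ) * (1-x^2)^(-δ))^j * (1-x^2)^(b/2-1) := by gcongr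
      _ = _ := by
        rw [Real.rpow_add q, Real.rpow_mul q.le, ← pow_add, mul_pow, ← Nat.cast_add, Real.rpow_natCast]; ring

lemma pq_symm (b : ℝ) (i j : ℕ) : ∫ x in Set.Ioo (-1:ℝ) 1, pq b i j x = ∫ x in Set.Ioo (-1:ℝ) 1, pq b j i x := by
  rw [← integral_Ioc_eq_integral_Ioo, ← intervalIntegral.integral_of_le (by norm_num), ← integral_Ioc_eq_integral_Ioo, ← intervalIntegral.integral_of_le (by norm_num)]
  have := intervalIntegral.integral_comp_neg (a := -1) (b := 1) (pq b j i)
  rw [neg_neg] at this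
  rw [← this]
  congr 1; ext x
  unfold pq; rw [neg_neg, neg_sq]; ring

lemma pr_symm (b x : ℝ) : pr (1-b) x = pr b x := fr_symm _ _

lemma Gq_gt {b x : ℝ} (h : 1 ≤ x) : (Gq b (x:ℂ)).im = 0 := by
  unfold Gq wq
  have e1 : (x:ℂ) - 1 = ((x-1:ℝ):ℂ) := by push_cast; rfl
  have e2 : (x:ℂ) + 1 = ((x+1:ℝ):ℂ) := by push_cast; rfl
  rw [Uq_gt h, Uq_gt h, e1, e2, ← Complex.ofReal_cpow (by linarith), ← Complex.ofReal_cpow (by linarith), ← Complex.ofReal_pow, ← Complex.ofReal_mul, ← Complex.ofReal_mul, ← Complex.ofReal_mul, Complex.ofReal_im]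

lemma Gq_lt {b x : ℝ} (h : x ≤ -1) : (Gq b (x:ℂ)).im = 0 := by
  unfold Gq wq
  have e1 : (x:ℂ) - 1 = ((x-1:ℝ):ℂ) := by push_cast; rfl
  have e2 : (x:ℂ) + 1 = ((x+1:ℝ):ℂ) := by push_cast; rfl
  rw [Uq_lt h, Uq_lt h, e1, e2, Complex.ofReal_cpow_of_nonpos (by linarith), Complex.ofReal_cpow_of_nonpos (by linarith),
    ← Complex.ofReal_neg, ← Complex.ofReal_neg, ← Complex.ofReal_cpow (by linarith), ← Complex.ofReal_cpow (by linarith)]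
  set e := Complex.exp (π * I * ((b/2-1:ℝ):ℂ))
  have hph : ph b^2 * ph (1-b) * (e*e) = -1 := by
    simp only [ph, e]
    rw [pow_two, ← Complex.exp_add, ← Complex.exp_add, ← Complex.exp_add, ← Complex.exp_add, ← Complex.exp_pi_mul_I, Complex.exp_eq_exp_iff_exists_int]
    refine ⟨-2, ?_⟩
    push_cast; ring
  generalize (∫ t in Set.Ioo (-1:ℝ) 1, uh b x t) = A
  generalize (∫ t in Set.Ioo (-1:ℝ) 1, uh (1-b) x t) = B
  generalize (-(x-1))^(b/2-1) = w1
  generalize (-(x+1))^(b/2-1) = w2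
  have : (ph b * (A:ℂ))^2 * (ph (1-b) * (B:ℂ)) * ((w1:ℂ) * e * ((w2:ℂ) * e)) = ((-(A^2*B*w1*w2):ℝ):ℂ) := by
    push_cast
    linear_combination (A^2*B*w1*w2:ℂ) * hph
  rw [this, Complex.ofReal_im]

lemma trig_alg (E E' p q : ℂ) (h : E * E' = 1) : E * (q + E'^2 * p)^2 * (q - E^2*p) =
    q^3*E + 2*p*q^2*E' + p^2*q*E'^3 - p*q^2*E^3 - 2*p^2*q*E - p^3*E' := by
  linear_combination (2*p*q^2*E' + p^2*q*E'^3 - 2*p^2*q*E*(E*E'+1) - p^3*E'*(E^2*E'^2+E*E'+1)) * h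

lemma Gq_in {b x : ℝ} (hb : 0 < b) (hb1 : b < 1) (h1 : -1 < x) (h2 : x < 1) : (Gq b (x:ℂ)).im =
    -(kc b^2 * kc (1-b)) * (Real.sin (π*b/2) * (pq b 0 3 x + pq b 3 0 x) - (2*Real.sin (π*b/2) + Real.sin (3*(π*b/2))) * (pq b 1 2 x + pq b 2 1 x)) := by
  have q : 0 < 1 - x^2 := by nlinarith
  set θ := π*b/2 with hθ
  set E := Complex.exp ((θ:ℂ) * I) with hE
  set E' := Complex.exp (((-θ:ℝ):ℂ) * I) with hE'
  have hEE : E * E' = 1 := by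
    rw [hE, hE', ← Complex.exp_add]; push_cast; rw [show (θ:ℂ)*I + -θ*I = 0 by ring, Complex.exp_zero]
  have p1 : ph b = E'^2 := by
    rw [hE', ← Complex.exp_nat_mul, ph]; congr 1; rw [hθ]; push_cast; ring
  have p2 : ph (1-b) = -E^2 := by
    rw [hE, ← Complex.exp_nat_mul, ph, ← neg_one_mul (Complex.exp _), ← Complex.exp_pi_mul_I, ← Complex.exp_add, Complex.exp_eq_exp_iff_exists_int]
    refine ⟨-1, ?_⟩
    rw [hθ]; push_cast; ring
  have hw : wq b (x:ℂ) = -E * (((1-x^2)^(b/2-1) : ℝ):ℂ) := by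
    unfold wq
    have e1 : (x:ℂ) - 1 = ((x-1:ℝ):ℂ) := by push_cast; rfl
    have e2 : (x:ℂ) + 1 = ((x+1:ℝ):ℂ) := by push_cast; rfl
    rw [e1, e2, Complex.ofReal_cpow_of_nonpos (by linarith), ← Complex.ofReal_neg, ← Complex.ofReal_cpow (by linarith), ← Complex.ofReal_cpow (by linarith),
      show 1 - x^2 = (-(x-1)) * (x+1) by ring, Real.mul_rpow (by linarith) (by linarith)]
    have : Complex.exp (π * I * ((b/2-1:ℝ):ℂ)) = -E := by
      rw [hE, ← neg_one_mul, ← Complex.exp_pi_mul_I, ← Complex.exp_add, Complex.exp_eq_exp_iff_exists_int]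
      refine ⟨-1, ?_⟩
      rw [hθ]; push_cast; ring
    rw [this]; push_cast; ring
  have i1 : E.im = Real.sin θ := by rw [hE, Complex.exp_ofReal_mul_I_im]
  have i2 : E'.im = -Real.sin θ := by rw [hE', Complex.exp_ofReal_mul_I_im, Real.sin_neg]
  have i3 : (E^3).im = Real.sin (3*θ) := by
    rw [hE, ← Complex.exp_nat_mul, ← Complex.exp_ofReal_mul_I_im]; congr 2; push_cast; ring
  have i4 : (E'^3).im = -Real.sin (3*θ) := by
    rw [hE', ← Complex.exp_nat_mul, ← Real.sin_neg, ← Complex.exp_ofReal_mul_I_im]; congr 2; push_cast; ring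
  have hG : Gq b (x:ℂ) = ((-(kc b^2 * kc (1-b)) * (1-x^2)^(b/2-1) : ℝ):ℂ) *
     (((pr b (-x)^3:ℝ):ℂ)*E + ((2*pr b x*pr b (-x)^2:ℝ):ℂ)*E' + ((pr b x^2*pr b (-x):ℝ):ℂ)*E'^3 - ((pr b x*pr b (-x)^2:ℝ):ℂ)*E^3 - ((2*pr b x^2*pr b (-x):ℝ):ℂ)*E - ((pr b x^3:ℝ):ℂ)*E') := by
    have := trig_alg E E' (pr b x) (pr b (-x)) hEE
    push_cast
    rw [← this]
    unfold Gq
    rw [Uq_in hb hb1 h1 h2, Uq_in (by linarith) (by linarith) h1 h2, hw, p1, p2, pr_symm, pr_symm]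
    push_cast; ring
  rw [hG, Complex.im_ofReal_mul]
  simp only [Complex.add_im, Complex.sub_im, Complex.im_ofReal_mul, i1, i2, i3, i4]
  unfold pq; ring

lemma relation {b : ℝ} (hb : 0 < b) (hb1 : b < 1) :
    ∫ x in Set.Ioo (-1:ℝ) 1, pq b 3 0 x = (3 + 2 * Real.cos (π*b)) * ∫ x in Set.Ioo (-1:ℝ) 1, pq b 2 1 x := by
  obtain ⟨hi, h0⟩ := Gq_main hb hb1
  have h1 : ∫ x : ℝ, (Gq b (x:ℂ)).im = 0 := by
    have := integral_im hi
    simp only [RCLike.im_to_complex] at this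
    rw [this, h0]; simp
  have h2 : ∫ x in Set.Ioo (-1:ℝ) 1, (Gq b (x:ℂ)).im = 0 := by
    rw [← h1]
    apply setIntegral_eq_integral_of_forall_compl_eq_zero
    intro x hx
    rw [Set.mem_Ioo, not_and_or] at hx
    rcases hx with h | h
    · exact Gq_lt (by linarith)
    · exact Gq_gt (by linarith)
  rw [setIntegral_congr_fun measurableSet_Ioo (fun x hx => Gq_in hb hb1 hx.1 hx.2), MeasureTheory.integral_const_mul] at h2
  have k1 := kc_pos hb hb1
  have k2 := kc_pos (show 0 < 1-b by linarith) (by linarith)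
  have h3 := (mul_eq_zero.1 h2).resolve_left (by simp; constructor <;> positivity)
  have i03 := pq_int hb hb1 0 3 (by norm_num)
  have i30 := pq_int hb hb1 3 0 (by norm_num)
  have i12 := pq_int hb hb1 1 2 (by norm_num)
  have i21 := pq_int hb hb1 2 1 (by norm_num)
  have j1 : IntegrableOn (fun x => pq b 0 3 x + pq b 3 0 x) (Set.Ioo (-1) 1) := i03.add i30
  have j2 : IntegrableOn (fun x => pq b 1 2 x + pq b 2 1 x) (Set.Ioo (-1) 1) := i12.add i21
  rw [MeasureTheory.integral_sub (j1.const_mul _) (j2.const_mul _), MeasureTheory.integral_const_mul, MeasureTheory.integral_const_mul,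
    MeasureTheory.integral_add i03 i30, MeasureTheory.integral_add i12 i21, pq_symm b 0 3, pq_symm b 1 2] at h3
  have hs : 0 < Real.sin (π*b/2) := Real.sin_pos_of_pos_of_lt_pi (by positivity) (by nlinarith [Real.pi_pos])
  have t1 : Real.cos (π*b) = 1 - 2*Real.sin (π*b/2)^2 := by
    rw [show π*b = 2*(π*b/2) by ring, Real.cos_two_mul, Real.cos_sq']; ring_nf
  rw [Real.sin_three_mul] at h3
  rw [t1]
  apply mul_left_cancel₀ hs.ne'
  linear_combination h3/2


lemma B_int {b : ℝ} (hb : 0 < b) (hb1 : b < 1) : ∫ x in Set.Ioo (-1:ℝ) 1, pq b 2 1 x =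
    (1/π)*(Real.cos ((b-1)*π/2)/2^(b-1))^3*(Real.Gamma (b/2)/Real.Gamma (b/2+1/2))^4 := by
  have h := LB_value (a := b/2) (by linarith) (by linarith) (fun x h1 h2 => hprod (by linarith) (by linarith) h1 h2)
  rw [B_closed (by linarith) (by linarith), show 2*(b/2) = b by ring] at h
  have hc : 0 ≤ Real.cos ((b-1)*π/2) := Real.cos_nonneg_of_neg_pi_div_two_le_of_le (by nlinarith [Real.pi_pos]) (by nlinarith [Real.pi_pos])
  have hn : 0 ≤ᵐ[volume.restrict (Set.Ioo (-1:ℝ) 1)] (pq b 2 1) := by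
    rw [Filter.EventuallyLE, ae_restrict_iff' measurableSet_Ioo]
    refine Filter.Eventually.of_forall fun x hx => ?_
    have q : 0 < 1 - x^2 := by nlinarith [hx.1, hx.2]
    have a2 := pr_ge_one hb hb1 (x := -x) (by linarith [hx.2]) (by linarith [hx.1])
    have : 0 ≤ pr b x ^ 2 * pr b (-x) ^ 1 * (1-x^2)^(b/2-1) := by positivity
    exact this
  rw [integral_eq_lintegral_of_nonneg_ae hn (pq_int hb hb1 2 1 (by norm_num)).aestronglyMeasurable]
  have e : ∫⁻ x in Set.Ioo (-1:ℝ) 1, ENNReal.ofReal (pq b 2 1 x) = ∫⁻ x in Set.Ioo (-1:ℝ) 1, ENNReal.ofReal (pr b x^2*pr b (-x)*(1-x^2)^(b/2-1)) := by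
    simp only [pq, pow_one]
  rw [e, h, ENNReal.toReal_ofReal (by positivity)]

lemma A3_real {b : ℝ} (hb : 0 < b) (hb1 : b < 1) : A3 ((b-1:ℝ):ℂ) = rhs3 ((b-1:ℝ):ℂ) := by
  have h1 : A3 ((b-1:ℝ):ℂ) = ((∫ x in Set.Ioo (-1:ℝ) 1, pq b 3 0 x : ℝ):ℂ) := by
    rw [A3, jJ, intervalIntegral.integral_of_le (by norm_num), integral_Ioc_eq_integral_Ioo, ← integral_complex_ofReal]
    refine setIntegral_congr_fun measurableSet_Ioo (fun x hx => ?_)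
    have q : 0 < 1 - x^2 := by nlinarith [hx.1, hx.2]
    simp only [jF, pP_pr, wt, pq]
    rw [show (((b-1:ℝ):ℂ)-1)/2 = ((b/2-1:ℝ):ℂ) by push_cast; ring, ← Complex.ofReal_cpow q.le]
    push_cast; ring
  rw [h1, relation hb hb1, B_int hb hb1, rhs3]
  have e0 : (3 + 2*Real.cos (π*b)) = 3 - 2*Real.cos ((b-1)*π) := by
    rw [show (b-1)*π = π*b - π by ring, Real.cos_sub_pi]; ring
  have e1 : (1 + ((b-1:ℝ):ℂ))/2 = ((b/2:ℝ):ℂ) := by push_cast; ring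
  have e2 : 1 + ((b-1:ℝ):ℂ)/2 = ((b/2+1/2:ℝ):ℂ) := by push_cast; ring
  have e3 : (2:ℂ)^((b-1:ℝ):ℂ) = ((2^(b-1):ℝ):ℂ) := by rw [Complex.ofReal_cpow (by norm_num)]; norm_num
  rw [e0, e1, e2, e3, Complex.Gamma_ofReal, Complex.Gamma_ofReal]
  push_cast
  ring

lemma A3_all (ν : ℂ) (hν : -1 < ν.re) : A3 ν = rhs3 ν := by
  refine continuation (1/4) (by norm_num) (fun r h1 h2 => ?_) ν hν
  have := A3_real (b := r+1) (by linarith) (by linarith)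
  rwa [add_sub_cancel_right] at this


theorem stmt16 (ν : ℂ) (hν : -1 < ν.re) :
    (∫ x in (-1:ℝ)..1, (legendreP (ν + 2) (x : ℂ)) ^ 3 * ((1 - (x:ℂ) ^ 2) ^ ((ν - 1)/2)))
      = ((3 - 2 * Complex.cos (ν * π)) / π) *
        ((2 * ν ^ 3 + 15 * ν ^ 2 + 36 * ν + 29) / (16 * (ν + 2) ^ 3)) *
        (Complex.cos (ν * π / 2) / 2 ^ ν) ^ 3 *
        (Complex.Gamma ((1 + ν)/2) / Complex.Gamma (1 + ν/2)) ^ 4 := by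
  exact final_of_A3 A3_all ν hν
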